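/- Let B^n be the John ellipsoid of a convex body K ⊇ B^n in ℝ^n and let ε > 0. If ℓ(K) ≤ (1+ε)ℓ(Δ_n°), then there exists an orthogonal transformation T ∈ O(n) such that δ_vol(K, TΔ_n°) ≤ n^{27n}·ε^{1/4} and δ_H(K, TΔ_n°) ≤ n^{27}·ε^{1/(4n)}. -/

import Mathlib

open MeasureTheory Metric Set
open scoped RealInnerProductSpace ENNReal

noncomputable section

/-- The standard Gaussian measure `γ_n` on `ℝ^n`. -/
def gaussianM (n : ℕ) : Measure (EuclideanSpace ℝ (Fin n)) :=
  volume.withDensity fun x =>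
    ENNReal.ofReal ((2 * Real.pi) ^ (-(n : ℝ) / 2) * Real.exp (-‖x‖ ^ 2 / 2))

/-- The ℓ-norm of a convex body: `ℓ(K) = ∫ ‖x‖_K dγ_n(x)`, where `‖·‖_K` is the gauge of `K`. -/
def ellNorm (n : ℕ) (K : Set (EuclideanSpace ℝ (Fin n))) : ℝ :=
  ∫ x, gauge K x ∂(gaussianM n)

/-- The support function `h_K`. -/
def suppFn {n : ℕ} (K : Set (EuclideanSpace ℝ (Fin n))) (u : EuclideanSpace ℝ (Fin n)) : ℝ :=
  sSup ((fun y => ⟪u, y⟫) '' K)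

/-- The mean width `W(K) = (1/(n κ_n)) ∫_{S^{n-1}} (h_K(u) + h_K(-u)) du`, the integration over
the unit sphere being with respect to the (n-1)-dimensional Hausdorff measure. -/
def meanWidth (n : ℕ) (K : Set (EuclideanSpace ℝ (Fin n))) : ℝ :=
  (1 / (n * (volume (closedBall (0 : EuclideanSpace ℝ (Fin n)) 1)).toReal)) *
    ∫ u in sphere (0 : EuclideanSpace ℝ (Fin n)) 1,
      (suppFn K u + suppFn K (-u)) ∂(μH[(n : ℝ) - 1])

/-- The polar set `K° = {x : ⟨x,y⟩ ≤ 1 for all y ∈ K}`. -/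
def polarSet {n : ℕ} (K : Set (EuclideanSpace ℝ (Fin n))) : Set (EuclideanSpace ℝ (Fin n)) :=
  {x | ∀ y ∈ K, ⟪x, y⟫ ≤ 1}

/-- `w` lists the vertices of a regular simplex inscribed in the unit ball: `n+1` unit vectors
with pairwise inner products `-1/n`. -/
def IsRegVerts {n : ℕ} (w : Fin (n + 1) → EuclideanSpace ℝ (Fin n)) : Prop :=
  (∀ i, ‖w i‖ = 1) ∧ ∀ i j, i ≠ j → ⟪w i, w j⟫ = -1 / n

/-- An ellipsoid: an image of the closed Euclidean unit ball under an invertible affine map. -/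
def IsEllipsoid {n : ℕ} (D : Set (EuclideanSpace ℝ (Fin n))) : Prop :=
  ∃ f : EuclideanSpace ℝ (Fin n) ≃ᵃ[ℝ] EuclideanSpace ℝ (Fin n),
    D = f '' closedBall 0 1

/-- `D` is the Löwner ellipsoid (minimal volume ellipsoid containing) of `K`. -/
def IsLoewnerEllipsoid {n : ℕ} (D K : Set (EuclideanSpace ℝ (Fin n))) : Prop :=
  IsEllipsoid D ∧ K ⊆ D ∧ ∀ D', IsEllipsoid D' → K ⊆ D' → volume D ≤ volume D'

/-- `D` is the John ellipsoid (maximal volume ellipsoid contained in) of `K`. -/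
def IsJohnEllipsoid {n : ℕ} (D K : Set (EuclideanSpace ℝ (Fin n))) : Prop :=
  IsEllipsoid D ∧ D ⊆ K ∧ ∀ D', IsEllipsoid D' → D' ⊆ K → volume D' ≤ volume D

/-- The symmetric difference (volume) distance `δ_vol(K,C) = V(K∖C) + V(C∖K)`. -/
def volDist {n : ℕ} (K C : Set (EuclideanSpace ℝ (Fin n))) : ℝ :=
  (volume (K \ C)).toReal + (volume (C \ K)).toReal


/-- Euclidean space shorthand. -/
abbrev Eu (n : ℕ) := EuclideanSpace ℝ (Fin n)

section
open MeasureTheory Metric Set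
open scoped RealInnerProductSpace ENNReal


theorem isCompact_convexHull_of_compact {V : Type*} [NormedAddCommGroup V] [NormedSpace ℝ V]
    [FiniteDimensional ℝ V] {s : Set V} (hs : IsCompact s) : IsCompact (convexHull ℝ s) := by
  rcases s.eq_empty_or_nonempty with rfl | ⟨s0, hs0⟩
  · simp
  set d := Module.finrank ℝ V + 1 with hd
  let f : (Fin d → ℝ) × (Fin d → V) → V := fun p => ∑ i, p.1 i • p.2 i
  have hf : Continuous f := by fun_prop
  have hc : IsCompact (stdSimplex ℝ (Fin d) ×ˢ Set.univ.pi (fun _ : Fin d => s)) :=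
    (isCompact_stdSimplex ℝ (Fin d)).prod (isCompact_univ_pi fun _ => hs)
  convert hc.image hf using 1
  apply Subset.antisymm
  · intro x hx
    obtain ⟨ι, _, z, w, hz, haff, hw, hw1, hx⟩ := eq_pos_convex_span_of_mem_convexHull hx
    have hcard : Fintype.card ι ≤ Fintype.card (Fin d) := by
      rw [Fintype.card_fin]
      refine haff.card_le_finrank_succ.trans ?_
      rw [hd]
      gcongr
      exact Submodule.finrank_le _
    obtain ⟨e⟩ := Function.Embedding.nonempty_of_card_le hcard
    refine ⟨(Function.extend e w 0, Function.extend e z (fun _ => s0)), ⟨⟨?_, ?_⟩, ?_⟩, ?_⟩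
    · intro j
      by_cases h : ∃ i, e i = j
      · obtain ⟨i, rfl⟩ := h
        simp only [e.injective.extend_apply]
        exact (hw i).le
      · simp [Function.extend_apply' _ _ _ h]
    · rw [← hw1]
      symm
      apply Fintype.sum_of_injective e e.injective
      · intro i hi
        simp [Function.extend_apply' (f := e) w (0 : Fin d → ℝ) i (by simpa using hi)]
      · intro i
        simp [e.injective.extend_apply]
    · intro j _
      by_cases h : ∃ i, e i = j
      · obtain ⟨i, rfl⟩ := h
        simp only [e.injective.extend_apply]
        exact hz ⟨i, rfl⟩
      · simpa [Function.extend_apply' _ _ _ h] using hs0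
    · rw [← hx]
      symm
      apply Fintype.sum_of_injective e e.injective
      · intro i hi
        simp [Function.extend_apply' (f := e) w (0 : Fin d → ℝ) i (by simpa using hi)]
      · intro i
        simp [e.injective.extend_apply]
  · rintro _ ⟨⟨w, z⟩, ⟨hw, hz⟩, rfl⟩
    exact (convex_convexHull ℝ s).sum_mem (fun i _ => hw.1 i) hw.2
      (fun i _ => subset_convexHull ℝ s (hz i (mem_univ i)))

/-- contact directions -/
def contactSet {n : ℕ} (K : Set (Eu n)) : Set (Eu n) :=
  {u | ‖u‖ = 1 ∧ ∀ x ∈ K, ⟪x, u⟫ ≤ 1}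

theorem contactSet_compact {n : ℕ} (K : Set (Eu n)) : IsCompact (contactSet K) := by
  have : contactSet K = sphere 0 1 ∩ ⋂ x ∈ K, {u | ⟪x, u⟫ ≤ 1} := by
    ext u; simp [contactSet]
  rw [this]
  refine (isCompact_sphere _ _).inter_right (isClosed_biInter fun x _ => ?_)
  exact isClosed_le (by fun_prop) (by fun_prop)

theorem contact_gap {n : ℕ} (K : Set (Eu n)) (q : Eu n → ℝ) (hq : Continuous q) (δ : ℝ)
    (hδ : 0 < δ) (h : ∀ v ∈ contactSet K, δ ≤ q v) :
    ∃ η > 0, ∀ v : Eu n, ‖v‖ = 1 → (∀ x ∈ K, ⟪x, v⟫ ≤ 1 + η) → δ / 2 < q v := by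
  by_contra! hcon
  have hpos : ∀ k : ℕ, (0:ℝ) < 1 / ((k:ℝ) + 1) := fun k => by positivity
  choose v hv1 hv2 hv3 using fun k : ℕ => hcon (1 / ((k:ℝ) + 1)) (hpos k)
  obtain ⟨a, ha, φ, hφ, hlim⟩ := (isCompact_sphere (0 : Eu n) 1).tendsto_subseq
    (x := v) (fun k => by simp [hv1])
  have hac : a ∈ contactSet K := by
    refine ⟨by simpa using ha, fun x hx => ?_⟩
    have h1 : Filter.Tendsto (fun k => ⟪x, v (φ k)⟫) Filter.atTop (nhds ⟪x, a⟫) :=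
      (Filter.Tendsto.inner tendsto_const_nhds hlim)
    have h2 : Filter.Tendsto (fun k => 1 + 1 / (((φ k : ℕ) : ℝ) + 1)) Filter.atTop
        (nhds (1 + 0)) :=
      tendsto_const_nhds.add (tendsto_one_div_add_atTop_nhds_zero_nat.comp hφ.tendsto_atTop)
    have := le_of_tendsto_of_tendsto' h1 h2 (fun k => hv2 (φ k) x hx)
    simpa using this
  have h3 : Filter.Tendsto (fun k => q (v (φ k))) Filter.atTop (nhds (q a)) :=
    (hq.tendsto a).comp hlim
  have := le_of_tendsto' h3 (fun k => hv3 (φ k))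
  have := h a hac
  linarith

theorem det_pert {n : ℕ} (hn : 1 ≤ n) (H : Matrix (Fin n) (Fin n) ℝ) (htr : H.trace = 0) (κ : ℝ) (hκ : 0 < κ) :
    ∀ᶠ s in nhdsWithin (0:ℝ) (Ioi 0), 1 < (1 + κ * s) ^ n * (1 - s • H).det := by
  obtain ⟨p, hp⟩ : ∃ p : Polynomial ℝ, ∀ s : ℝ, (1 - s • H).det = 1 + p.eval s * s ^ 2 := by
    refine ⟨(1 + (Polynomial.X : Polynomial ℝ) • (-H).map Polynomial.C).det.divX.divX,
      fun s => ?_⟩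
    have := Matrix.det_one_add_smul s (-H)
    rw [smul_neg, ← sub_eq_add_neg, Matrix.trace_neg, htr] at this
    rw [this]; simp
  have hcont : Filter.Tendsto (fun s : ℝ => κ + p.eval s * s * (1 + κ * s)) (nhdsWithin 0 (Ioi 0))
      (nhds κ) := by
    have : Continuous (fun s : ℝ => κ + p.eval s * s * (1 + κ * s)) := by fun_prop
    have := (this.tendsto 0).mono_left (nhdsWithin_le_nhds (s := Ioi 0))
    simpa using this
  have hcont2 : Filter.Tendsto (fun s : ℝ => 1 + p.eval s * s ^ 2) (nhdsWithin 0 (Ioi 0))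
      (nhds 1) := by
    have : Continuous (fun s : ℝ => 1 + p.eval s * s ^ 2) := by fun_prop
    have := (this.tendsto 0).mono_left (nhdsWithin_le_nhds (s := Ioi 0))
    simpa using this
  filter_upwards [hcont.eventually (lt_mem_nhds hκ), hcont2.eventually (lt_mem_nhds one_pos),
    self_mem_nhdsWithin] with s hs hs2 hs0
  have hs0 : 0 < s := hs0
  rw [hp]
  have hb : 1 + κ * s ≤ (1 + κ * s) ^ n := by
    apply le_self_pow₀ _ (by omega)
    nlinarith [mul_pos hκ hs0]
  have : 1 < (1 + κ * s) * (1 + p.eval s * s ^ 2) := by nlinarith [mul_pos hs hs0]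
  calc _ < _ := this
    _ ≤ _ := by gcongr


theorem volume_affine_image {n : ℕ} (L : Eu n →ₗ[ℝ] Eu n) (hL : LinearMap.det L ≠ 0) (b : Eu n) :
    IsEllipsoid ((fun x => L x + b) '' closedBall (0 : Eu n) 1) ∧
    volume ((fun x => L x + b) '' closedBall (0 : Eu n) 1) =
      ENNReal.ofReal |LinearMap.det L| * volume (closedBall (0 : Eu n) 1) := by
  constructor
  · let e := LinearEquiv.ofIsUnitDet (f := L) (v := (EuclideanSpace.basisFun (Fin n) ℝ).toBasis)
      (v' := (EuclideanSpace.basisFun (Fin n) ℝ).toBasis) (by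
        rw [LinearMap.det_toMatrix]; exact isUnit_iff_ne_zero.mpr hL)
    refine ⟨e.toAffineEquiv.trans (AffineEquiv.constVAdd ℝ _ b), ?_⟩
    congr 1
    ext1 x
    simp [e, add_comm]
  · have : (fun x => L x + b) '' closedBall (0 : Eu n) 1
        = (fun x => x + b) '' (L '' closedBall (0 : Eu n) 1) := by
      rw [image_image]
    rw [this, image_add_right, measure_preimage_add_right, Measure.addHaar_image_linearMap]

set_option maxHeartbeats 1000000 in
theorem john_sep {n : ℕ} (hn : 1 ≤ n) (K : Set (Eu n)) (hKcomp : IsCompact K) (hKconv : Convex ℝ K)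
    (hJohn : IsJohnEllipsoid (closedBall (0 : Eu n) 1) K)
    (H : Matrix (Fin n) (Fin n) ℝ) (hsym : H.IsHermitian) (htr : H.trace = 0) (b : Eu n)
    (δ : ℝ) (hδ : 0 < δ)
    (hq : ∀ v ∈ contactSet K, δ ≤ ⟪H.toEuclideanLin v, v⟫ + ⟪b, v⟫) : False := by
  set L : Eu n →L[ℝ] Eu n := LinearMap.toContinuousLinearMap H.toEuclideanLin with hL
  have hLs : ∀ x y : Eu n, ⟪L x, y⟫ = ⟪x, L y⟫ := by
    intro x y
    exact (Matrix.isSymmetric_toEuclideanLin_iff.mpr hsym) x y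
  set q : Eu n → ℝ := fun v => ⟪L v, v⟫ + ⟪b, v⟫ with hqdef
  obtain ⟨η, hη, hgap⟩ := contact_gap K q (by fun_prop) δ hδ hq
  set B := ‖L‖
  have hB : 0 ≤ B := norm_nonneg _
  set κ := δ / 4 with hκ
  have hκ0 : 0 < κ := by positivity
  set C := κ * B + B ^ 2 with hC
  have hC0 : 0 ≤ C := by positivity
  have hlim : Filter.Tendsto (fun s : ℝ => κ * s + s * (B + ‖b‖) + s ^ 2 * C)
      (nhdsWithin 0 (Ioi 0)) (nhds 0) := by
    have : Continuous (fun s : ℝ => κ * s + s * (B + ‖b‖) + s ^ 2 * C) := by fun_prop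
    have := (this.tendsto 0).mono_left (nhdsWithin_le_nhds (s := Ioi 0))
    simpa using this
  have hlim2 : Filter.Tendsto (fun s : ℝ => s * C)
      (nhdsWithin 0 (Ioi 0)) (nhds 0) := by
    have : Continuous (fun s : ℝ => s * C) := by fun_prop
    have := (this.tendsto 0).mono_left (nhdsWithin_le_nhds (s := Ioi 0))
    simpa using this
  have hlim3 : Filter.Tendsto (fun s : ℝ => κ * s)
      (nhdsWithin 0 (Ioi 0)) (nhds 0) := by
    have : Continuous (fun s : ℝ => κ * s) := by fun_prop
    have := (this.tendsto 0).mono_left (nhdsWithin_le_nhds (s := Ioi 0))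
    simpa using this
  obtain ⟨s, hs0, hdet, hs1, hs2, hs3⟩ := ((eventually_mem_nhdsWithin (a := (0:ℝ)) (s := Ioi (0:ℝ))).and
    ((det_pert hn H htr κ hκ0).and ((hlim.eventually (gt_mem_nhds hη)).and
    ((hlim2.eventually (gt_mem_nhds hκ0)).and
    (hlim3.eventually (gt_mem_nhds one_pos)))))).exists
  have hs0 : 0 < s := hs0
  let M : Eu n →ₗ[ℝ] Eu n := (1 + κ * s) • (LinearMap.id - s • H.toEuclideanLin)
  have hM : LinearMap.det M = (1 + κ * s) ^ n * (1 - s • H).det := by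
    have h1 : LinearMap.id - s • H.toEuclideanLin = (1 - s • H).toEuclideanLin := by
      ext x : 1
      simp [Matrix.toLpLin_apply]
    rw [LinearMap.det_smul, finrank_euclideanSpace, Fintype.card_fin, h1]
    congr 1
    exact (congrArg LinearMap.det (congrArg (fun g => g (1 - s • H))
      (Matrix.toLpLin_eq_toLin 2 2))).trans (LinearMap.det_toLin _ _)
  have hM1 : 1 < LinearMap.det M := hM ▸ hdet
  obtain ⟨hell, hvol⟩ := volume_affine_image M (by linarith) (-(s • b))
  have hsub : (fun x => M x + -(s • b)) '' closedBall (0 : Eu n) 1 ⊆ K := by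
    rintro _ ⟨x, hx, rfl⟩
    by_contra hnot
    obtain ⟨f, r, hf1, hf2⟩ := geometric_hahn_banach_closed_point hKconv hKcomp.isClosed hnot
    set v0 := (InnerProductSpace.toDual ℝ (Eu n)).symm f with hv0
    have hfv : ∀ y, f y = ⟪v0, y⟫ := fun y => by
      rw [hv0, InnerProductSpace.toDual_symm_apply]
    have h0K : (0 : Eu n) ∈ K := hJohn.2.1 (by simp)
    have hv0ne : v0 ≠ 0 := by
      intro h
      have := (hf1 0 h0K).trans hf2
      simp [hfv, h] at this
    have hnv : 0 < ‖v0‖ := norm_pos_iff.mpr hv0ne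
    set v := (‖v0‖⁻¹) • v0 with hv
    have hv1 : ‖v‖ = 1 := by
      rw [hv, norm_smul, norm_inv, norm_norm, inv_mul_cancel₀ hnv.ne']
    have hlt : ∀ y ∈ K, ⟪y, v⟫ < ⟪M x + -(s • b), v⟫ := by
      intro y hy
      have := (hf1 y hy).trans hf2
      rw [hfv, hfv] at this
      rw [hv, inner_smul_right, inner_smul_right, real_inner_comm, real_inner_comm v0]
      exact mul_lt_mul_of_pos_left this (by positivity)
    have hx1 : ‖x‖ ≤ 1 := by simpa using hx
    have hLv : ‖L v‖ ≤ B := by simpa [hv1] using L.le_opNorm v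
    have hLvv : |⟪L v, v⟫| ≤ B := by
      refine (abs_real_inner_le_norm _ _).trans ?_
      rw [hv1, mul_one]; exact hLv
    have hbv : |⟪b, v⟫| ≤ ‖b‖ := by
      simpa [hv1] using abs_real_inner_le_norm b v
    have hMx : ⟪M x, v⟫ = (1 + κ * s) * ⟪x, v - s • L v⟫ := by
      simp only [M, LinearMap.smul_apply, LinearMap.sub_apply, LinearMap.id_apply,
        inner_smul_left, inner_sub_left, inner_sub_right, inner_smul_right]
      have : ⟪H.toEuclideanLin x, v⟫ = ⟪x, L v⟫ := hLs x v
      rw [this]; simp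
    have hnorm : ‖v - s • L v‖ ≤ 1 - s * ⟪L v, v⟫ + s ^ 2 * B ^ 2 / 2 := by
      have h1 : ‖v - s • L v‖ ^ 2 = 1 - 2 * (s * ⟪L v, v⟫) + s ^ 2 * ‖L v‖ ^ 2 := by
        rw [norm_sub_sq_real, hv1, inner_smul_right, norm_smul, real_inner_comm]
        rw [mul_pow, Real.norm_eq_abs, sq_abs]; ring
      have h2 : ‖L v‖ ^ 2 ≤ B ^ 2 := by gcongr
      nlinarith [sq_nonneg (‖v - s • L v‖ - 1), mul_le_mul_of_nonneg_left h2 (sq_nonneg s)]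
    have hin : ⟪x, v - s • L v⟫ ≤ 1 - s * ⟪L v, v⟫ + s ^ 2 * B ^ 2 / 2 := by
      refine (real_inner_le_norm _ _).trans (le_trans ?_ hnorm)
      calc ‖x‖ * ‖v - s • L v‖ ≤ 1 * ‖v - s • L v‖ := by gcongr
        _ = _ := one_mul _
    have hupper : ⟪M x + -(s • b), v⟫ ≤ 1 + κ * s - s * q v + s ^ 2 * C := by
      rw [inner_add_left, hMx, inner_neg_left, inner_smul_left]
      have h3 : (1 + κ * s) * ⟪x, v - s • L v⟫ ≤
          (1 + κ * s) * (1 - s * ⟪L v, v⟫ + s ^ 2 * B ^ 2 / 2) :=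
        mul_le_mul_of_nonneg_left hin (by positivity)
      have h4 : κ * s * (s * (- ⟪L v, v⟫)) ≤ κ * s * (s * B) := by
        gcongr
        exact (abs_le.mp hLvv).1 |> fun h => by linarith
      have h5 : (κ * s) * (s ^ 2 * B ^ 2) ≤ 1 * (s ^ 2 * B ^ 2) := by gcongr
      simp only [conj_trivial, hqdef, hC]
      nlinarith
    have hqb : - q v ≤ B + ‖b‖ := by
      simp only [hqdef]
      linarith [(abs_le.mp hLvv).1, (abs_le.mp hbv).1]
    have hqv := hgap v hv1 (fun y hy => by
      have := (hlt y hy).le.trans hupper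
      have := mul_le_mul_of_nonneg_left hqb hs0.le
      linarith)
    have hvK : v ∈ K := hJohn.2.1 (by simp [hv1])
    have h6 := (hlt v hvK).trans_le hupper
    rw [real_inner_self_eq_norm_sq, hv1] at h6
    have h7 : s * (δ / 2) ≤ s * q v := by gcongr
    have h8 : s * (s * C) ≤ s * κ := by gcongr
    nlinarith
  have hle := hJohn.2.2 _ hell hsub
  rw [hvol, abs_of_pos (by linarith)] at hle
  have hfin : volume (closedBall (0 : Eu n) 1) ≠ ⊤ := measure_closedBall_lt_top.ne
  have hpos : volume (closedBall (0 : Eu n) 1) ≠ 0 :=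
    (measure_closedBall_pos volume _ one_pos).ne'
  have : ENNReal.ofReal (LinearMap.det M) ≤ 1 := by
    by_contra hcon
    push Not at hcon
    have h9 := (ENNReal.mul_lt_mul_iff_left hpos hfin).mpr hcon
    rw [one_mul] at h9
    exact (lt_irrefl _ (lt_of_lt_of_le h9 hle))
  rw [← ENNReal.ofReal_one, ENNReal.ofReal_le_ofReal_iff one_pos.le] at this
  linarith


theorem john_decomp {n : ℕ} (hn : 1 ≤ n) (K : Set (Eu n)) (hKcomp : IsCompact K)
    (hKconv : Convex ℝ K) (hJohn : IsJohnEllipsoid (closedBall (0 : Eu n) 1) K) :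
    ∃ (ι : Type) (_ : Fintype ι) (c : ι → ℝ) (u : ι → Eu n), (∀ i, 0 ≤ c i) ∧ (∀ i, ‖u i‖ = 1) ∧
      (∀ i, ∀ x ∈ K, ⟪x, u i⟫ ≤ 1) ∧ ∑ i, c i • u i = 0 ∧
      ∀ x y, ∑ i, c i * (⟪x, u i⟫ * ⟪y, u i⟫) = ⟪x, y⟫ := by
  have hn0 : (n : ℝ) ≠ 0 := by positivity
  let ψ : Eu n → (Fin n → Fin n → ℝ) × Eu n := fun u => (fun i j => u i * u j, u)
  have hψ : Continuous ψ := by fun_prop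
  have hcomp : IsCompact (convexHull ℝ (ψ '' contactSet K)) :=
    isCompact_convexHull_of_compact ((contactSet_compact K).image hψ)
  let p0 : (Fin n → Fin n → ℝ) × Eu n := (fun i j => if i = j then 1 / (n : ℝ) else 0, 0)
  by_cases hp : p0 ∈ convexHull ℝ (ψ '' contactSet K)
  · obtain ⟨ι, t, w, z, hw0, hw1, hz, hx⟩ : ∃ (ι : Type) (t : Finset ι) (w : ι → ℝ) (z : ι → (Fin n → Fin n → ℝ) × Eu n),
        (∀ i ∈ t, 0 ≤ w i) ∧ ∑ i ∈ t, w i = 1 ∧ (∀ i ∈ t, z i ∈ ψ '' contactSet K) ∧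
          ∑ i ∈ t, w i • z i = p0 := by
      obtain ⟨ι, t, w, z, h1, h2, h3, h4⟩ := (convexHull_eq (R := ℝ) (ψ '' contactSet K)).subset hp
      refine ⟨ι, t, w, z, h1, h2, h3, ?_⟩
      rw [← h4, Finset.centerMass_eq_of_sum_1 _ _ h2]
    choose! u hu1 hu2 using hz
    refine ⟨t, inferInstance, fun i => n * w i, fun i => u i, fun i => ?_, fun i => ?_,
      fun i => ?_, ?_, ?_⟩
    · have := hw0 i i.2; positivity
    · exact (hu1 i i.2).1
    · exact (hu1 i i.2).2
    · have h2 := congrArg Prod.snd hx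
      simp only [Prod.snd_sum, Prod.smul_snd] at h2
      rw [Finset.sum_coe_sort t (fun i => (n * w i) • u i)]
      simp only [mul_smul, ← Finset.smul_sum]
      rw [show ∑ i ∈ t, w i • u i = ∑ i ∈ t, w i • (z i).2 from
        Finset.sum_congr rfl fun i hi => by rw [← hu2 i hi], h2]
      simp [p0]
    · intro x y
      rw [Finset.sum_coe_sort t (fun i => n * w i * (⟪x, u i⟫ * ⟪y, u i⟫))]
      have h1 : ∀ a b, ∑ i ∈ t, w i * (u i a * u i b) = if a = b then 1 / (n:ℝ) else 0 := by
        intro a b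
        have h2 := congrFun (congrFun (congrArg Prod.fst hx) a) b
        simp only [Prod.fst_sum, Prod.smul_fst, Finset.sum_apply, Pi.smul_apply, smul_eq_mul] at h2
        rw [show p0.1 a b = if a = b then 1 / (n:ℝ) else 0 from rfl] at h2
        rw [← h2]
        exact Finset.sum_congr rfl fun i hi => by rw [← hu2 i hi]
      have h3 : ∀ i, n * w i * (⟪x, u i⟫ * ⟪y, u i⟫) =
          ∑ a, ∑ b, n * (x a * y b * (w i * (u i a * u i b))) := by
        intro i
        simp only [PiLp.inner_apply, RCLike.inner_apply, conj_trivial]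
        rw [Finset.sum_mul_sum, Finset.mul_sum]
        refine Finset.sum_congr rfl fun a _ => ?_
        rw [Finset.mul_sum]
        refine Finset.sum_congr rfl fun b _ => by ring
      simp only [h3]
      rw [Finset.sum_comm]
      simp_rw [Finset.sum_comm (s := t), ← Finset.mul_sum, h1]
      simp only [PiLp.inner_apply, RCLike.inner_apply, conj_trivial]
      rw [Finset.mul_sum]
      refine Finset.sum_congr rfl fun a _ => ?_
      simp
      field_simp
  · exfalso
    obtain ⟨f, r, hf1, hf2⟩ := geometric_hahn_banach_point_closed (convex_convexHull ℝ _)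
      hcomp.isClosed hp
    let h : Matrix (Fin n) (Fin n) ℝ := fun i j => f (Pi.single i (Pi.single j 1), 0)
    have hfA : ∀ (A : Fin n → Fin n → ℝ), f (A, 0) = ∑ i, ∑ j, A i j * h i j := by
      intro A
      have hA : A = ∑ i, ∑ j, A i j • (Pi.single i (Pi.single j 1) : Fin n → Fin n → ℝ) := by
        ext a b
        simp [Finset.sum_apply, Pi.single_apply, apply_ite]
        rw [Finset.sum_eq_single a]
        · simp [Pi.single_apply]
        · intro c _ hc
          simp [Ne.symm hc]
        · simp
      let f1 : (Fin n → Fin n → ℝ) →ₗ[ℝ] ℝ := f.toLinearMap.comp (LinearMap.inl ℝ _ _)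
      have : f (A, 0) = f1 A := rfl
      rw [this]
      conv_lhs => rw [hA]
      simp only [map_sum, map_smul, smul_eq_mul]
      rfl
    let ℓ : Eu n →L[ℝ] ℝ := f.comp (ContinuousLinearMap.inr ℝ _ _)
    set b := (InnerProductSpace.toDual ℝ (Eu n)).symm ℓ with hb
    have hℓ : ∀ y, ℓ y = ⟪b, y⟫ := fun y => by rw [hb, InnerProductSpace.toDual_symm_apply]
    set τ := (∑ i, h i i) / n with hτ
    let H : Matrix (Fin n) (Fin n) ℝ := (1/2 : ℝ) • (h + h.transpose) - τ • 1
    have hfp0 : f p0 = τ := by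
      have : p0 = (p0.1, 0) := rfl
      rw [this, hfA]
      simp [p0, hτ, Finset.mul_sum, div_eq_inv_mul]
    refine john_sep hn K hKcomp hKconv hJohn H ?_ ?_ b (r - f p0) (by linarith) ?_
    · ext i j
      simp [H, Matrix.one_apply, eq_comm]; ring
    · have : ∑ i, h i i = h.trace := rfl
      simp [H, Matrix.trace_sub, Matrix.trace_smul, Matrix.trace_add, hτ, this]
      field_simp
      ring
    · intro v hv
      have h1 := hf2 _ (subset_convexHull ℝ _ ⟨v, hv, rfl⟩)
      have h2 : f (ψ v) = ∑ i, ∑ j, v i * v j * h i j + ⟪b, v⟫ := by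
        rw [← hℓ, ← hfA]
        have : ψ v = ((ψ v).1, 0) + (0, v) := by simp [ψ]
        rw [this, map_add]; rfl
      have h3 : ⟪H.toEuclideanLin v, v⟫ = ∑ i, ∑ j, v i * v j * h i j - τ := by
        have hvn : ∑ i, v i * v i = 1 := by
          have := EuclideanSpace.real_norm_sq_eq v
          rw [hv.1] at this
          simp only [one_pow] at this
          rw [this]; exact Finset.sum_congr rfl fun i _ => by ring
        have e1 : ⟪H.toEuclideanLin v, v⟫ = ∑ i, ∑ j, v i * v j * H i j := by
          simp only [PiLp.inner_apply, RCLike.inner_apply, conj_trivial, Matrix.toLpLin_apply,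
            Matrix.mulVec, dotProduct]
          refine Finset.sum_congr rfl fun i _ => ?_
          rw [Finset.mul_sum]
          exact Finset.sum_congr rfl fun j _ => by ring
        have e2 : ∀ i j, v i * v j * H i j = (1/2) * (v i * v j * h i j) + (1/2) * (v i * v j * h j i)
            - τ * (if i = j then v i * v j else 0) := by
          intro i j
          simp only [H, Matrix.sub_apply, Matrix.smul_apply, Matrix.add_apply,
            Matrix.transpose_apply, Matrix.one_apply, smul_eq_mul]
          split_ifs <;> ring
        have e3 : ∑ i, ∑ j, v i * v j * h j i = ∑ i, ∑ j, v i * v j * h i j := by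
          rw [Finset.sum_comm]
          exact Finset.sum_congr rfl fun i _ => Finset.sum_congr rfl fun j _ => by ring
        rw [e1]
        simp_rw [e2, Finset.sum_sub_distrib, Finset.sum_add_distrib, ← Finset.mul_sum]
        rw [e3]
        simp only [Finset.sum_ite_eq, Finset.mem_univ, if_true]
        rw [hvn]; ring
      rw [h3, hfp0]
      linarith

end

section
open MeasureTheory Metric Set
open scoped RealInnerProductSpace ENNReal


/-! ### One-dimensional Gaussian distribution function and the transport map -/

/-- Gaussian density. -/
def gphi (s : ℝ) : ℝ := (√(2 * Real.pi))⁻¹ * Real.exp (-s ^ 2 / 2)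

theorem gphi_eq (s : ℝ) : gphi s = ProbabilityTheory.gaussianPDFReal 0 1 s := by
  simp [gphi, ProbabilityTheory.gaussianPDFReal]

theorem gphi_pos (s : ℝ) : 0 < gphi s := by unfold gphi; positivity

theorem gphi_cont : Continuous gphi := by unfold gphi; fun_prop

theorem gphi_int : Integrable gphi := by
  have : gphi = ProbabilityTheory.gaussianPDFReal 0 1 := funext gphi_eq
  rw [this]
  exact ProbabilityTheory.integrable_gaussianPDFReal 0 1

theorem gphi_integral : ∫ x, gphi x = 1 := by
  have := ProbabilityTheory.integral_gaussianPDFReal_eq_one 0 (v := 1) one_ne_zero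
  simpa only [← gphi_eq] using this

/-- Gaussian distribution function. -/
def Phi (s : ℝ) : ℝ := ∫ x in Iic s, gphi x

theorem Phi_sub (a b : ℝ) : Phi b - Phi a = ∫ x in a..b, gphi x :=
  intervalIntegral.integral_Iic_sub_Iic gphi_int.integrableOn gphi_int.integrableOn

theorem Phi_hasDerivAt (s : ℝ) : HasDerivAt Phi (gphi s) s := by
  have h : HasDerivAt (fun b => Phi 0 + ∫ x in (0:ℝ)..b, gphi x) (gphi s) s := by
    refine HasDerivAt.const_add _ ?_
    exact intervalIntegral.integral_hasDerivAt_right gphi_int.intervalIntegrable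
      (gphi_cont.stronglyMeasurableAtFilter _ _) gphi_cont.continuousAt
  convert h using 1
  ext b
  rw [← Phi_sub]; ring

theorem Phi_cont : Continuous Phi :=
  continuous_iff_continuousAt.mpr fun s => (Phi_hasDerivAt s).continuousAt

theorem Phi_strictMono : StrictMono Phi :=
  strictMono_of_hasDerivAt_pos Phi_hasDerivAt gphi_pos

theorem one_sub_Phi (s : ℝ) : 1 - Phi s = ∫ x in Ioi s, gphi x := by
  have := intervalIntegral.integral_Iic_add_Ioi (b := s) (f := gphi) (μ := volume)
    gphi_int.integrableOn gphi_int.integrableOn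
  rw [gphi_integral] at this
  unfold Phi
  linarith

theorem Phi_nonneg (s : ℝ) : 0 ≤ Phi s :=
  setIntegral_nonneg measurableSet_Iic fun x _ => (gphi_pos x).le

theorem Phi_le_one (s : ℝ) : Phi s ≤ 1 := by
  have : 0 ≤ 1 - Phi s := by
    rw [one_sub_Phi]
    exact setIntegral_nonneg measurableSet_Ioi fun x _ => (gphi_pos x).le
  linarith

theorem Phi_pos (s : ℝ) : 0 < Phi s := (Phi_nonneg (s - 1)).trans_lt (Phi_strictMono (by linarith))

theorem Phi_lt_one (s : ℝ) : Phi s < 1 := (Phi_strictMono (by linarith)).trans_le (Phi_le_one (s + 1))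

theorem gphi_even (s : ℝ) : gphi (-s) = gphi s := by simp [gphi]

theorem Phi_neg (s : ℝ) : Phi (-s) = 1 - Phi s := by
  rw [one_sub_Phi, Phi]
  have := integral_comp_neg_Iic (-s) gphi
  simp only [gphi_even, neg_neg] at this
  exact this

theorem Phi_zero : Phi 0 = 1 / 2 := by
  have := Phi_neg 0
  rw [neg_zero] at this; linarith

theorem one_sub_Phi_le {T : ℝ} (hT : 0 ≤ T) : 1 - Phi T ≤ Real.exp (-T ^ 2 / 2) := by
  have h1 : ∫ x in Ioi T, gphi x = ∫ x in Ioi 0, gphi (x + T) := by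
    have := (measurePreserving_add_right (volume : Measure ℝ) T).setIntegral_preimage_emb
      (measurableEmbedding_addRight T) gphi (Ioi T)
    rw [← this]; simp
  have h2 : ∫ x in Ioi 0, gphi (x + T) ≤ ∫ x in Ioi 0, Real.exp (-T ^ 2 / 2) * gphi x := by
    refine setIntegral_mono_on (gphi_int.comp_add_right T).integrableOn
      (gphi_int.const_mul _).integrableOn measurableSet_Ioi fun x hx => ?_
    have hx : 0 < x := hx
    unfold gphi
    rw [mul_left_comm, ← Real.exp_add]
    gcongr
    nlinarith [mul_nonneg hx.le hT]
  rw [one_sub_Phi, h1]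
  refine h2.trans ?_
  rw [integral_const_mul, ← one_sub_Phi, Phi_zero]
  nlinarith [Real.exp_pos (-T ^ 2 / 2)]

theorem Phi_tendsto_atTop (p : ℝ) (hp : p < 1) : ∃ z, p < Phi z := by
  have h : Filter.Tendsto (fun T : ℝ => Real.exp (-T ^ 2 / 2)) Filter.atTop (nhds 0) := by
    refine Real.tendsto_exp_atBot.comp ?_
    have : Filter.Tendsto (fun T : ℝ => T ^ 2 / 2) Filter.atTop Filter.atTop :=
      (Filter.tendsto_pow_atTop two_ne_zero).atTop_div_const two_pos
    simpa [neg_div] using this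
  obtain ⟨T, hT, hT0⟩ := ((h.eventually (gt_mem_nhds (sub_pos.mpr hp))).and
    (Filter.eventually_ge_atTop 0)).exists
  exact ⟨T, by linarith [one_sub_Phi_le hT0]⟩

theorem Phi_surj {p : ℝ} (h0 : 0 < p) (h1 : p < 1) : ∃ z, Phi z = p := by
  obtain ⟨z1, hz1⟩ := Phi_tendsto_atTop p h1
  obtain ⟨z2, hz2⟩ := Phi_tendsto_atTop (1 - p) (by linarith)
  refine mem_range_of_exists_le_of_exists_ge Phi_cont ⟨-z2, ?_⟩ ⟨z1, hz1.le⟩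
  rw [Phi_neg]; linarith

/-- Inverse of `Phi`. -/
def PhiInv : ℝ → ℝ := Function.invFun Phi

theorem Phi_PhiInv {p : ℝ} (h0 : 0 < p) (h1 : p < 1) : Phi (PhiInv p) = p :=
  Function.invFun_eq (Phi_surj h0 h1)

theorem PhiInv_Phi (s : ℝ) : PhiInv (Phi s) = s :=
  Function.leftInverse_invFun Phi_strictMono.injective s

theorem PhiInv_hasDerivAt {p : ℝ} (h0 : 0 < p) (h1 : p < 1) :
    HasDerivAt PhiInv (gphi (PhiInv p))⁻¹ p := by
  have hmem : Ioo (0:ℝ) 1 ∈ nhds p := Ioo_mem_nhds h0 h1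
  have hmono : StrictMonoOn PhiInv (Ioo 0 1) := by
    intro a ha b hb hab
    rw [← Phi_strictMono.lt_iff_lt, Phi_PhiInv ha.1 ha.2, Phi_PhiInv hb.1 hb.2]
    exact hab
  have him : PhiInv '' Ioo 0 1 = univ := by
    refine eq_univ_of_forall fun s => ⟨Phi s, ⟨Phi_pos s, Phi_lt_one s⟩, PhiInv_Phi s⟩
  have hcont : ContinuousAt PhiInv p :=
    hmono.continuousAt_of_image_mem_nhds hmem (by rw [him]; exact Filter.univ_mem)
  refine HasDerivAt.of_local_left_inverse hcont (Phi_hasDerivAt _) (gphi_pos _).ne' ?_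
  filter_upwards [hmem] with y hy using Phi_PhiInv hy.1 hy.2

/-- The transport map from the truncated Gaussian to the Gaussian. -/
def Tr (t s : ℝ) : ℝ := PhiInv (Phi s / Phi t)

/-- Its derivative. -/
def Tr' (t s : ℝ) : ℝ := Real.exp ((Tr t s ^ 2 - s ^ 2) / 2) / Phi t

theorem Phi_Tr {t s : ℝ} (h : s < t) : Phi (Tr t s) = Phi s / Phi t :=
  Phi_PhiInv (div_pos (Phi_pos s) (Phi_pos t)) ((div_lt_one (Phi_pos t)).mpr (Phi_strictMono h))

theorem Tr'_pos (t s : ℝ) : 0 < Tr' t s := div_pos (Real.exp_pos _) (Phi_pos t)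

theorem Tr_hasDerivAt {t s : ℝ} (h : s < t) : HasDerivAt (Tr t) (Tr' t s) s := by
  have h1 := PhiInv_hasDerivAt (div_pos (Phi_pos s) (Phi_pos t))
    ((div_lt_one (Phi_pos t)).mpr (Phi_strictMono h))
  have h2 : HasDerivAt (fun s => Phi s / Phi t) (gphi s / Phi t) s :=
    (Phi_hasDerivAt s).div_const _
  have h3 := HasDerivAt.comp s h1 h2
  suffices e : Tr' t s = (gphi (Tr t s))⁻¹ * (gphi s / Phi t) by
    rw [e]; exact h3
  have e1 : Real.exp ((Tr t s ^ 2 - s ^ 2) / 2) = (Real.exp (- Tr t s ^ 2 / 2))⁻¹ * Real.exp (-s ^ 2 / 2) := by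
    rw [← Real.exp_neg, ← Real.exp_add]; congr 1; ring
  have := Real.exp_pos (- Tr t s ^ 2 / 2)
  have h4 : 0 < √(2 * Real.pi) := by positivity
  rw [Tr', gphi, gphi, e1]
  field_simp

theorem Tr_strictMonoOn (t : ℝ) : StrictMonoOn (Tr t) (Iio t) := by
  intro a ha b hb hab
  rw [← Phi_strictMono.lt_iff_lt, Phi_Tr ha, Phi_Tr hb]
  exact div_lt_div_of_pos_right (Phi_strictMono hab) (Phi_pos t)

theorem Phi_diff_le {a b : ℝ} (h : a ≤ b) : Phi b - Phi a ≤ (b - a) / 2 := by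
  rw [Phi_sub]
  have h2 : ∀ x, gphi x ≤ 1 / 2 := by
    intro x
    unfold gphi
    have h1 : Real.exp (-x ^ 2 / 2) ≤ 1 := Real.exp_le_one_iff.mpr (by nlinarith [sq_nonneg x])
    have h2 : (2:ℝ) ≤ √(2 * Real.pi) := by
      apply Real.le_sqrt_of_sq_le; nlinarith [Real.pi_gt_three]
    have h3 : (√(2 * Real.pi))⁻¹ ≤ 1 / 2 := by
      rw [one_div]; exact inv_anti₀ two_pos h2
    have := Real.exp_pos (-x ^ 2 / 2)
    nlinarith [inv_pos.mpr (two_pos.trans_le h2)]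
  calc ∫ x in a..b, gphi x ≤ ∫ x in a..b, (1/2 : ℝ) :=
        intervalIntegral.integral_mono_on h gphi_int.intervalIntegrable (by simp) fun x _ => h2 x
    _ = (b - a) / 2 := by simp; ring

theorem Phi_diff_ge {a b : ℝ} (h0 : 0 ≤ a) (h : a ≤ b) : (b - a) * gphi b ≤ Phi b - Phi a := by
  rw [Phi_sub]
  calc (b - a) * gphi b = ∫ x in a..b, gphi b := by simp
    _ ≤ _ := by
      refine intervalIntegral.integral_mono_on h (by simp) gphi_int.intervalIntegrable fun x hx => ?_
      unfold gphi
      have : x ^ 2 ≤ b ^ 2 := by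
        have := h0.trans hx.1
        have := hx.2
        gcongr
      gcongr

theorem gphi_one_ge : 1 / 5 ≤ gphi 1 := by
  unfold gphi
  have h1 : √(2 * Real.pi) * Real.exp (1 / 2) ≤ 5 := by
    have e : Real.exp (1/2) ^ 2 = Real.exp 1 := by rw [← Real.exp_nat_mul]; norm_num
    have s : √(2 * Real.pi) ^ 2 = 2 * Real.pi := Real.sq_sqrt (by positivity)
    refine abs_le_of_sq_le_sq' ?_ (by norm_num) |>.2
    rw [mul_pow, e, s]
    nlinarith [Real.pi_lt_d2, Real.exp_one_lt_d9, Real.pi_pos, Real.exp_pos 1]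
  rw [show (-(1:ℝ) ^ 2 / 2) = -(1/2) by norm_num, Real.exp_neg, ← mul_inv, one_div]
  exact inv_anti₀ (by positivity) h1

theorem gphi_three_ge : 1 / 256 ≤ gphi 3 := by
  unfold gphi
  have h1 : √(2 * Real.pi) * Real.exp (9 / 2) ≤ 256 := by
    have e : Real.exp (9/2) ^ 2 = Real.exp 1 ^ 9 := by
      rw [← Real.exp_nat_mul, ← Real.exp_nat_mul]; norm_num
    have s : √(2 * Real.pi) ^ 2 = 2 * Real.pi := Real.sq_sqrt (by positivity)
    refine abs_le_of_sq_le_sq' ?_ (by norm_num) |>.2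
    rw [mul_pow, e, s]
    have h2 : Real.exp 1 ^ 9 ≤ 2.7183 ^ 9 := by
      gcongr; linarith [Real.exp_one_lt_d9]
    have h3 : 2 * Real.pi ≤ 6.3 := by linarith [Real.pi_lt_d2]
    calc _ ≤ (6.3:ℝ) * 2.7183 ^ 9 := by gcongr
      _ ≤ _ := by norm_num
  rw [show (-(3:ℝ) ^ 2 / 2) = -(9/2) by norm_num, Real.exp_neg, ← mul_inv, one_div]
  exact inv_anti₀ (by positivity) h1

theorem Tr_gt {t s : ℝ} (h : s < t) : s < Tr t s := by
  rw [← Phi_strictMono.lt_iff_lt, Phi_Tr h, lt_div_iff₀ (Phi_pos t)]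
  nlinarith [Phi_pos s, Phi_lt_one t]

theorem Phi_ge_half {s : ℝ} (h : 0 ≤ s) : 1 / 2 ≤ Phi s := by
  rw [← Phi_zero]; exact Phi_strictMono.monotone h

theorem Tr'_le {t s : ℝ} (ht : 1 ≤ t) (hs0 : 0 ≤ s) (hs : s ≤ 3 / 5) : Tr' t s ≤ 32 := by
  have hst : s < t := by linarith
  have hT : 0 ≤ Tr t s := hs0.trans (Tr_gt hst).le
  have h1 := one_sub_Phi_le hT
  rw [Phi_Tr hst] at h1
  have h2 : Phi s ≤ Phi (3/5) := Phi_strictMono.monotone hs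
  have h3 : Phi 1 ≤ Phi t := Phi_strictMono.monotone ht
  have h4 := Phi_diff_ge (a := 3/5) (b := 1) (by norm_num) (by norm_num)
  have h5 := gphi_one_ge
  have h6 := Phi_pos t
  have h7 := Phi_lt_one t
  have h8 : 1 / 16 ≤ 1 - Phi s / Phi t := by
    rw [one_sub_div h6.ne', le_div_iff₀ h6]
    nlinarith
  have h9 : Real.exp (Tr t s ^ 2 / 2) ≤ 16 := by
    have := h8.trans h1
    rw [show Tr t s ^ 2 / 2 = - (- Tr t s ^ 2 / 2) by ring, Real.exp_neg]
    rw [show (16:ℝ) = (1/16)⁻¹ by norm_num]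
    exact inv_anti₀ (by norm_num) this
  have h10 : Real.exp ((Tr t s ^ 2 - s ^ 2) / 2) ≤ 16 := by
    refine le_trans (Real.exp_le_exp.mpr ?_) h9
    nlinarith [sq_nonneg s]
  unfold Tr'
  rw [div_le_iff₀ h6]
  have := Phi_ge_half (s := t) (by linarith)
  linarith

theorem Tr'_ge_one {t s : ℝ} (hs0 : 0 ≤ s) (hs : s < t) : 1 ≤ Tr' t s := by
  unfold Tr'
  rw [le_div_iff₀ (Phi_pos t)]
  have h1 : 1 ≤ Real.exp ((Tr t s ^ 2 - s ^ 2) / 2) := by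
    apply Real.one_le_exp
    have := Tr_gt hs
    nlinarith
  linarith [Phi_lt_one t]

theorem Tr_sub_ge {t s : ℝ} (ht : t ≤ 2) (hs0 : 0 ≤ s) (hs : s < t) : 1 / 256 ≤ Tr t s - s := by
  have h1 := Phi_diff_le (Tr_gt hs).le
  rw [Phi_Tr hs] at h1
  have h2 := Phi_diff_ge (a := 2) (b := 3) (by norm_num) (by norm_num)
  have h3 := gphi_three_ge
  have h4 : Phi t ≤ Phi 2 := Phi_strictMono.monotone ht
  have h5 := Phi_lt_one 3
  have h6 := Phi_pos t
  have h7 := Phi_lt_one t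
  have h8 := Phi_ge_half hs0
  have h9 : (1 - Phi t) / 2 ≤ Phi s / Phi t - Phi s := by
    rw [div_sub' h6.ne', le_div_iff₀ h6]
    nlinarith [mul_pos h6 (sub_pos.mpr h7)]
  linarith

theorem Tr_incr {t a b : ℝ} (hb : 0 ≤ b) (hab : b ≤ a) (ha : a < t) :
    a - b ≤ Tr t a - Tr t b := by
  have hmono : MonotoneOn (fun s => Tr t s - s) (Ico 0 t) := by
    apply monotoneOn_of_deriv_nonneg (convex_Ico 0 t)
    · intro s hs
      exact ((Tr_hasDerivAt hs.2).sub (hasDerivAt_id s)).continuousAt.continuousWithinAt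
    · intro s hs
      rw [interior_Ico] at hs
      exact ((Tr_hasDerivAt hs.2).sub (hasDerivAt_id s)).differentiableAt.differentiableWithinAt
    · intro s hs
      rw [interior_Ico] at hs
      have := ((Tr_hasDerivAt hs.2).sub (hasDerivAt_id s)).deriv
      have h2 := Tr'_ge_one hs.1.le hs.2
      have h3 : deriv (fun s => Tr t s - s) s = Tr' t s - 1 := this
      rw [h3]; linarith
  have := hmono ⟨hb, hab.trans_lt ha⟩ ⟨hb.trans hab, ha⟩ hab
  simp only at this
  linarith

theorem Tr'_diff {t a b : ℝ} (ht : t ≤ 2) (hb : 0 ≤ b) (hab : b ≤ a) (ha : a < t) :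
    (a - b) / 256 ≤ Tr' t a - Tr' t b := by
  have h1 := Tr_incr hb hab ha
  have h2 := Tr_sub_ge ht hb (hab.trans_lt ha)
  have h3 := Tr_gt (hab.trans_lt ha)
  have h4 := Tr'_ge_one hb (hab.trans_lt ha)
  have h5 : Tr' t b * (1 + (a - b) / 256) ≤ Tr' t a := by
    have h6 : Tr' t a = Tr' t b *
        Real.exp ((Tr t a ^ 2 - a ^ 2) / 2 - (Tr t b ^ 2 - b ^ 2) / 2) := by
      unfold Tr'
      rw [Real.exp_sub]
      have := (Phi_pos t).ne'
      field_simp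
    rw [h6]
    gcongr
    refine le_trans ?_ (Real.add_one_le_exp _)
    have h7 : 0 ≤ a - b := by linarith
    set A := Tr t a
    set B := Tr t b
    have : (B - b) * (A + a - (B + b)) ≤ A ^ 2 - a ^ 2 - (B ^ 2 - b ^ 2) := by
      nlinarith [mul_nonneg (by linarith : (0:ℝ) ≤ (A - a) - (B - b)) (by linarith : 0 ≤ A + a)]
    nlinarith
  nlinarith

end

section
open MeasureTheory Metric Set
open scoped RealInnerProductSpace ENNReal


/-! ### The standard Gaussian measure -/

/-- Gaussian density on `ℝ^n`. -/
def gdens (n : ℕ) (x : Eu n) : ℝ := (2 * Real.pi) ^ (-(n : ℝ) / 2) * Real.exp (-‖x‖ ^ 2 / 2)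

theorem gdens_pos (n : ℕ) (x : Eu n) : 0 < gdens n x := by unfold gdens; positivity

theorem gdens_cont (n : ℕ) : Continuous (gdens n) := by unfold gdens; fun_prop

theorem gaussianM_def (n : ℕ) : gaussianM n = volume.withDensity fun x => ENNReal.ofReal (gdens n x) := rfl

theorem gdens_integrable (n : ℕ) : Integrable (gdens n) := by
  have h := (GaussianFourier.integrable_cexp_neg_mul_sq_norm_add (V := Eu n) (b := 1/2) (by norm_num) 0 0).re
  have h2 := h.const_mul ((2 * Real.pi) ^ (-(n : ℝ) / 2))
  refine h2.congr (Filter.Eventually.of_forall fun x => ?_)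
  simp only [gdens]
  congr 1
  have : (-(1 / 2 : ℂ) * (‖x‖:ℂ) ^ 2 + 0 * (⟪(0 : Eu n), x⟫ : ℝ)) = ((-‖x‖ ^ 2 / 2 : ℝ) : ℂ) := by
    push_cast; ring
  rw [this, ← Complex.ofReal_exp]
  exact Complex.ofReal_re _

instance gaussianM_finite (n : ℕ) : IsFiniteMeasure (gaussianM n) :=
  isFiniteMeasure_withDensity_ofReal (gdens_integrable n).2

theorem gaussianM_integral_C (n : ℕ) (f : Eu n → ℂ) :
    ∫ x, f x ∂(gaussianM n) = ∫ x, (gdens n x : ℂ) * f x := by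
  rw [gaussianM_def, integral_withDensity_eq_integral_toReal_smul
    (gdens_cont n).measurable.ennreal_ofReal (Filter.Eventually.of_forall fun _ => ENNReal.ofReal_lt_top)]
  refine integral_congr_ae (Filter.Eventually.of_forall fun x => ?_)
  simp only [ENNReal.toReal_ofReal (gdens_pos n x).le]
  exact Complex.real_smul

theorem gaussianM_eq (n : ℕ) : gaussianM n = ProbabilityTheory.stdGaussian (Eu n) := by
  apply Measure.ext_of_charFun
  ext t
  rw [ProbabilityTheory.charFun_stdGaussian, charFun_apply, gaussianM_integral_C]
  have h := GaussianFourier.integral_cexp_neg_mul_sq_norm_add (V := Eu n) (b := 1/2) (by norm_num) Complex.I t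
  have e : ∀ x : Eu n, (gdens n x : ℂ) * Complex.exp (⟪x, t⟫ * Complex.I) =
      (((2 * Real.pi) ^ (-(n : ℝ) / 2) : ℝ) : ℂ) *
        Complex.exp (-(1/2) * ‖x‖ ^ 2 + Complex.I * ⟪t, x⟫) := by
    intro x
    rw [gdens, Complex.ofReal_mul, Complex.ofReal_exp, mul_assoc, ← Complex.exp_add]
    congr 2
    rw [real_inner_comm]
    push_cast; ring
  simp_rw [e]
  rw [integral_const_mul, h, ← mul_assoc]
  have h1 : (((2 * Real.pi) ^ (-(n : ℝ) / 2) : ℝ) : ℂ) * ((Real.pi : ℂ) / (1/2)) ^ ((Module.finrank ℝ (Eu n) : ℂ) / 2) = 1 := by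
    have : ((Real.pi : ℂ) / (1/2)) = ((2 * Real.pi : ℝ) : ℂ) := by push_cast; ring
    rw [this, finrank_euclideanSpace_fin]
    have h2 : ((n : ℂ) / 2) = (((n:ℝ) / 2 : ℝ) : ℂ) := by push_cast; ring
    rw [h2, ← Complex.ofReal_cpow (by positivity), ← Complex.ofReal_mul, ← Real.rpow_add (by positivity)]
    simp [neg_div]
  rw [h1, one_mul]
  congr 1
  rw [Complex.I_sq]; ring

instance gaussianM_prob (n : ℕ) : IsProbabilityMeasure (gaussianM n) := by
  rw [gaussianM_eq]; infer_instance

instance gaussianM_gaussian (n : ℕ) : ProbabilityTheory.IsGaussian (gaussianM n) := by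
  rw [gaussianM_eq]; infer_instance

theorem gaussianM_integrable_norm (n : ℕ) : Integrable (fun x : Eu n => ‖x‖) (gaussianM n) :=
  (ProbabilityTheory.IsGaussian.integrable_id (μ := gaussianM n)).norm

theorem gaussianM_map_isometry {n : ℕ} (T : Eu n ≃ₗᵢ[ℝ] Eu n) : (gaussianM n).map T = gaussianM n := by
  rw [gaussianM_eq]; exact ProbabilityTheory.stdGaussian_map T

/-- Forget the first coordinate. -/
def tailE {n : ℕ} (y : Eu (n + 1)) : Eu n := WithLp.toLp 2 fun i => y i.succ

/-- Add a first coordinate. -/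
def liftE {n : ℕ} (a : ℝ) (x : Eu n) : Eu (n + 1) := WithLp.toLp 2 (Fin.cons a fun i => x i)

theorem tailE_cont {n : ℕ} : Continuous (tailE (n := n)) := by
  unfold tailE
  exact (PiLp.continuous_toLp 2 _).comp (by fun_prop)

theorem inner_liftE_left {n : ℕ} (a : ℝ) (x : Eu n) (y : Eu (n + 1)) :
    ⟪y, liftE a x⟫ = y 0 * a + ⟪tailE y, x⟫ := by
  simp [liftE, tailE, PiLp.inner_apply, Fin.sum_univ_succ, mul_comm]

theorem inner_liftE {n : ℕ} (a b : ℝ) (x y : Eu n) :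
    ⟪liftE a x, liftE b y⟫ = a * b + ⟪x, y⟫ := by
  rw [inner_liftE_left]; simp [liftE, tailE]

theorem liftE_eta {n : ℕ} (y : Eu (n + 1)) : liftE (y 0) (tailE y) = y := by
  ext i
  refine Fin.cases ?_ (fun j => ?_) i <;> simp [liftE, tailE]

theorem gaussianM_map_tail (n : ℕ) : (gaussianM (n + 1)).map tailE = gaussianM n := by
  have : IsProbabilityMeasure ((gaussianM (n + 1)).map tailE) :=
    Measure.isProbabilityMeasure_map tailE_cont.measurable.aemeasurable
  apply Measure.ext_of_charFun
  ext t
  rw [charFun_apply, integral_map tailE_cont.measurable.aemeasurable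
    (Measurable.aestronglyMeasurable (by fun_prop))]
  have e : ∀ y : Eu (n + 1), ⟪tailE y, t⟫ = ⟪y, liftE 0 t⟫ := by
    intro y; rw [inner_liftE_left]; simp
  simp_rw [e]
  rw [← charFun_apply, gaussianM_eq, gaussianM_eq, ProbabilityTheory.charFun_stdGaussian,
    ProbabilityTheory.charFun_stdGaussian]
  have : ‖liftE 0 t‖ ^ 2 = ‖t‖ ^ 2 := by
    rw [← real_inner_self_eq_norm_sq, inner_liftE, ← real_inner_self_eq_norm_sq]; simp
  congr 1
  norm_cast
  rw [this]

theorem gaussianM_inner_integrable {n : ℕ} (v : Eu n) : Integrable (fun x => ⟪x, v⟫) (gaussianM n) :=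
  (ProbabilityTheory.IsGaussian.integrable_id (μ := gaussianM n)).inner_const v

theorem gaussianM_inner_integral {n : ℕ} (v : Eu n) : ∫ x, ⟪x, v⟫ ∂(gaussianM n) = 0 := by
  rw [gaussianM_eq]
  have := ProbabilityTheory.integral_strongDual_stdGaussian (E := Eu n) (innerSL ℝ v)
  simpa [real_inner_comm] using this

theorem gaussianM_inner_sq {n : ℕ} (v : Eu n) (hv : ‖v‖ = 1) :
    Integrable (fun x => ⟪x, v⟫ ^ 2) (gaussianM n) ∧ ∫ x, ⟪x, v⟫ ^ 2 ∂(gaussianM n) = 1 := by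
  have h1 : MemLp (fun x => ⟪x, v⟫) 2 (gaussianM n) :=
    (ProbabilityTheory.IsGaussian.memLp_two_id (μ := gaussianM n)).inner_const v
  refine ⟨h1.integrable_sq, ?_⟩
  have h2 := ProbabilityTheory.variance_dual_stdGaussian (E := Eu n) (innerSL ℝ v)
  rw [← gaussianM_eq] at h2
  rw [innerSL_apply_norm, hv] at h2
  have h3 := ProbabilityTheory.variance_of_integral_eq_zero (μ := gaussianM n) (X := fun x => ⟪x, v⟫)
    (gaussianM_inner_integrable v).aemeasurable (gaussianM_inner_integral v)
  rw [← h3]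
  have : (fun x => ⟪x, v⟫) = ⇑(innerSL ℝ v) := by
    ext x; simp [real_inner_comm]
  rw [this, h2]; norm_num

theorem gaussianM_norm_le (n : ℕ) : ∫ x, ‖x‖ ∂(gaussianM n) ≤ n := by
  rcases Nat.eq_zero_or_pos n with rfl | hn
  · have : ∀ x : Eu 0, ‖x‖ = 0 := fun x => by rw [Subsingleton.elim x 0, norm_zero]
    simp [this]
  have h := fun i : Fin n => gaussianM_inner_sq (EuclideanSpace.single i (1:ℝ)) (by simp)
  have h1 : ∫ x : Eu n, ∑ i, ⟪x, EuclideanSpace.single i (1:ℝ)⟫ ^ 2 ∂(gaussianM n) = n := by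
    rw [integral_finset_sum _ fun i _ => (h i).1]
    simp_rw [(h _).2]; simp
  have h2 : ∀ x : Eu n, ∑ i, ⟪x, EuclideanSpace.single i (1:ℝ)⟫ ^ 2 = ‖x‖ ^ 2 := by
    intro x
    rw [EuclideanSpace.real_norm_sq_eq]
    simp [EuclideanSpace.inner_single_right]
  have hi : Integrable (fun x : Eu n => ‖x‖ ^ 2) (gaussianM n) := by
    simp_rw [← h2]
    exact integrable_finset_sum _ fun i _ => (h i).1
  simp_rw [h2] at h1
  calc ∫ x, ‖x‖ ∂(gaussianM n) ≤ ∫ x, ((1 + ‖x‖ ^ 2) / 2) ∂(gaussianM n) := by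
        refine integral_mono (gaussianM_integrable_norm n) (((integrable_const 1).add hi).div_const 2) fun x => ?_
        simp only
        nlinarith [sq_nonneg (‖x‖ - 1)]
    _ = (1 + n) / 2 := by
        rw [integral_div, integral_add (integrable_const _) hi, h1]; simp
    _ ≤ n := by
        have : (1:ℝ) ≤ n := by exact_mod_cast hn
        linarith

theorem gaussianReal_Iio (t : ℝ) : ProbabilityTheory.gaussianReal 0 1 (Iio t) = ENNReal.ofReal (Phi t) := by
  rw [ProbabilityTheory.gaussianReal_apply_eq_integral _ one_ne_zero, ← integral_Iic_eq_integral_Iio, Phi]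
  simp_rw [gphi_eq]

theorem gaussianM_orth {n : ℕ} (b : OrthonormalBasis (Fin n) ℝ (Eu n)) (t : ℝ) :
    gaussianM n {y | ∀ a, ⟪y, b a⟫ < t} = ENNReal.ofReal (Phi t ^ n) := by
  have hm : MeasurableSet {y : Eu n | ∀ a, ⟪y, b a⟫ < t} := by
    rw [setOf_forall]
    exact MeasurableSet.iInter fun a => measurableSet_lt (by fun_prop) measurable_const
  rw [gaussianM_eq, ProbabilityTheory.stdGaussian_eq_map_pi_orthonormalBasis b,
    Measure.map_apply (by fun_prop) hm]
  have : (fun x : Fin n → ℝ => ∑ i, x i • b i) ⁻¹' {y : Eu n | ∀ a, ⟪y, b a⟫ < t} = univ.pi fun _ => Iio t := by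
    ext x
    simp [b.inner_eq_ite, sum_inner, inner_smul_left]
  rw [this, Measure.pi_pi]
  simp [gaussianReal_Iio, ENNReal.ofReal_pow (Phi_nonneg t)]

end

section
open MeasureTheory Metric Set
open scoped RealInnerProductSpace ENNReal


/-! ### Decompositions of the identity and the Ball-Barthe determinant inequality -/

/-- A decomposition of the identity. -/
structure IsFrame {N : ℕ} {ι : Type} [Fintype ι] (c : ι → ℝ) (v : ι → Eu N) : Prop where
  nonneg : ∀ i, 0 ≤ c i
  unit : ∀ i, ‖v i‖ = 1
  frame : ∀ x y : Eu N, ∑ i, c i * (⟪x, v i⟫ * ⟪y, v i⟫) = ⟪x, y⟫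

namespace IsFrame

variable {N : ℕ} {ι : Type} [Fintype ι] {c : ι → ℝ} {v : ι → Eu N}

theorem sum_sq (h : IsFrame c v) (x : Eu N) : ∑ i, c i * ⟪x, v i⟫ ^ 2 = ‖x‖ ^ 2 := by
  rw [← real_inner_self_eq_norm_sq, ← h.frame]
  simp_rw [sq]

theorem inner_self (h : IsFrame c v) (i : ι) : ⟪v i, v i⟫ = 1 := by
  rw [real_inner_self_eq_norm_sq, h.unit]; norm_num

theorem sum_c (h : IsFrame c v) : ∑ i, c i = N := by
  let b := EuclideanSpace.basisFun (Fin N) ℝ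
  have h1 : ∑ k, ∑ i, c i * ⟪b k, v i⟫ ^ 2 = N := by
    simp_rw [h.sum_sq]; simp
  rw [Finset.sum_comm] at h1
  rw [← h1]
  refine Finset.sum_congr rfl fun i _ => ?_
  rw [← Finset.mul_sum, b.sum_sq_inner_right, h.unit]; norm_num

theorem row (h : IsFrame c v) (i : ι) : ∑ j, c j * ⟪v i, v j⟫ ^ 2 = 1 := by
  rw [h.sum_sq, h.unit]; norm_num

theorem norm_sum_le (h : IsFrame c v) (a : ι → ℝ) :
    ‖∑ i, (c i * a i) • v i‖ ^ 2 ≤ ∑ i, c i * a i ^ 2 := by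
  set z := ∑ i, (c i * a i) • v i with hz
  have h1 : ‖z‖ ^ 2 = ∑ i, c i * (a i * ⟪z, v i⟫) := by
    rw [← real_inner_self_eq_norm_sq]
    conv_lhs => rw [hz]
    rw [sum_inner]
    refine Finset.sum_congr rfl fun i _ => ?_
    rw [real_inner_smul_left, real_inner_comm]; ring
  have h2 : ∑ i, c i * (a i * ⟪z, v i⟫) ≤ ∑ i, (c i * a i ^ 2 / 2 + c i * ⟪z, v i⟫ ^ 2 / 2) := by
    refine Finset.sum_le_sum fun i _ => ?_
    nlinarith [mul_nonneg (h.nonneg i) (sq_nonneg (a i - ⟪z, v i⟫))]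
  rw [Finset.sum_add_distrib, ← Finset.sum_div, ← Finset.sum_div, h.sum_sq] at h2
  linarith

end IsFrame

/-- The operator `∑ cᵢ tᵢ vᵢ ⊗ vᵢ`. -/
def frameOp {N : ℕ} {ι : Type} [Fintype ι] (c : ι → ℝ) (v : ι → Eu N) (t : ι → ℝ) : Eu N →L[ℝ] Eu N :=
  ∑ i, (c i * t i) • (innerSL ℝ (v i)).smulRight (v i)

theorem frameOp_apply {N : ℕ} {ι : Type} [Fintype ι] (c : ι → ℝ) (v : ι → Eu N) (t : ι → ℝ) (x : Eu N) :
    frameOp c v t x = ∑ i, (c i * t i * ⟪x, v i⟫) • v i := by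
  simp [frameOp, real_inner_comm, smul_smul]

theorem frameOp_inner {N : ℕ} {ι : Type} [Fintype ι] (c : ι → ℝ) (v : ι → Eu N) (t : ι → ℝ) (x y : Eu N) :
    ⟪frameOp c v t x, y⟫ = ∑ i, c i * t i * (⟪x, v i⟫ * ⟪y, v i⟫) := by
  rw [frameOp_apply, sum_inner]
  refine Finset.sum_congr rfl fun i _ => ?_
  rw [real_inner_smul_left, real_inner_comm (v i) y]; ring

theorem frameOp_symm {N : ℕ} {ι : Type} [Fintype ι] (c : ι → ℝ) (v : ι → Eu N) (t : ι → ℝ) :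
    (frameOp c v t : Eu N →ₗ[ℝ] Eu N).IsSymmetric := by
  intro x y
  change ⟪frameOp c v t x, y⟫ = ⟪x, frameOp c v t y⟫
  rw [frameOp_inner, real_inner_comm, frameOp_inner]
  refine Finset.sum_congr rfl fun i _ => ?_
  ring

theorem log_stab {t l M : ℝ} (ht : 0 < t) (hl : 0 < l) (htM : t ≤ M) (hlM : l ≤ M) :
    Real.log t + (t - l) ^ 2 / (4 * M ^ 2) ≤ Real.log l + (t - l) / l := by
  have hM : 0 < M := ht.trans_le htM
  obtain ⟨a, ha, rfl⟩ : ∃ a, 0 < a ∧ t = a ^ 2 := ⟨√t, by positivity, (Real.sq_sqrt ht.le).symm⟩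
  obtain ⟨b, hb, rfl⟩ : ∃ b, 0 < b ∧ l = b ^ 2 := ⟨√l, by positivity, (Real.sq_sqrt hl.le).symm⟩
  have h1 := Real.log_le_sub_one_of_pos (div_pos ha hb)
  rw [Real.log_div ha.ne' hb.ne'] at h1
  rw [Real.log_pow, Real.log_pow]
  have h2 : (a ^ 2 - b ^ 2) / b ^ 2 - 2 * (a / b - 1) = (a - b) ^ 2 / b ^ 2 := by
    field_simp; ring
  have h3 : (a ^ 2 - b ^ 2) ^ 2 / (4 * M ^ 2) ≤ (a - b) ^ 2 / b ^ 2 := by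
    rw [div_le_div_iff₀ (by positivity) (by positivity)]
    have : (a + b) ^ 2 * b ^ 2 ≤ 4 * M ^ 2 := by
      have e1 : (a + b) ^ 2 ≤ 4 * M := by nlinarith [sq_nonneg (a - b)]
      calc (a + b) ^ 2 * b ^ 2 ≤ 4 * M * M := by gcongr
        _ = _ := by ring
    calc (a ^ 2 - b ^ 2) ^ 2 * b ^ 2 = (a - b) ^ 2 * ((a + b) ^ 2 * b ^ 2) := by ring
      _ ≤ _ := by gcongr
  push_cast
  linarith

/-- The stability term. -/
def qterm {N : ℕ} {ι : Type} [Fintype ι] (c : ι → ℝ) (v : ι → Eu N) (t : ι → ℝ) : ℝ :=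
  ∑ i, ∑ j, c i * c j * ⟪v i, v j⟫ ^ 2 * (t i - t j) ^ 2

theorem IsFrame.qterm_eq {N : ℕ} {ι : Type} [Fintype ι] {c : ι → ℝ} {v : ι → Eu N} (h : IsFrame c v)
    (t : ι → ℝ) : qterm c v t =
      2 * (∑ i, c i * t i ^ 2 - ∑ i, ∑ j, c i * c j * t i * t j * ⟪v i, v j⟫ ^ 2) := by
  have e1 : ∑ i, ∑ j, c i * c j * ⟪v i, v j⟫ ^ 2 * t i ^ 2 = ∑ i, c i * t i ^ 2 := by
    refine Finset.sum_congr rfl fun i _ => ?_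
    have := h.row i
    calc _ = ∑ j, (c i * t i ^ 2) * (c j * ⟪v i, v j⟫ ^ 2) :=
          Finset.sum_congr rfl fun j _ => by ring
      _ = _ := by rw [← Finset.mul_sum, this, mul_one]
  have e2 : ∑ i, ∑ j, c i * c j * ⟪v i, v j⟫ ^ 2 * t j ^ 2 = ∑ i, c i * t i ^ 2 := by
    rw [Finset.sum_comm, ← e1]
    refine Finset.sum_congr rfl fun i _ => Finset.sum_congr rfl fun j _ => ?_
    rw [real_inner_comm]; ring
  have e3 : qterm c v t = ∑ i, ∑ j, c i * c j * ⟪v i, v j⟫ ^ 2 * t i ^ 2 +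
      ∑ i, ∑ j, c i * c j * ⟪v i, v j⟫ ^ 2 * t j ^ 2 -
      2 * ∑ i, ∑ j, c i * c j * t i * t j * ⟪v i, v j⟫ ^ 2 := by
    rw [qterm, Finset.mul_sum, ← Finset.sum_add_distrib, ← Finset.sum_sub_distrib]
    refine Finset.sum_congr rfl fun i _ => ?_
    rw [Finset.mul_sum, ← Finset.sum_add_distrib, ← Finset.sum_sub_distrib]
    refine Finset.sum_congr rfl fun j _ => ?_
    ring
  rw [e3, e1, e2]; ring

theorem IsFrame.qterm_nonneg {N : ℕ} {ι : Type} [Fintype ι] {c : ι → ℝ} {v : ι → Eu N} (h : IsFrame c v)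
    (t : ι → ℝ) : 0 ≤ qterm c v t :=
  Finset.sum_nonneg fun i _ => Finset.sum_nonneg fun j _ => by
    have := h.nonneg i
    have := h.nonneg j
    positivity

theorem IsFrame.det_ge {N : ℕ} {ι : Type} [Fintype ι] {c : ι → ℝ} {v : ι → Eu N} (h : IsFrame c v)
    {t : ι → ℝ} {M : ℝ} (ht : ∀ i, 0 < t i) (hM : ∀ i, t i ≤ M) :
    Real.exp (qterm c v t / (8 * M ^ 2) + ∑ i, c i * Real.log (t i)) ≤ (frameOp c v t).det := by
  have hsym := frameOp_symm c v t
  have hfin : Module.finrank ℝ (Eu N) = N := by simp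
  set b := hsym.eigenvectorBasis hfin with hb
  set l := hsym.eigenvalues hfin with hl
  have hAb : ∀ k, frameOp c v t (b k) = l k • b k := fun k => hsym.apply_eigenvectorBasis hfin k
  have hdet : (frameOp c v t).det = ∏ k, l k := by
    have := hsym.det_eq_prod_eigenvalues hfin
    simpa using this
  have hbb : ∀ k, ⟪b k, b k⟫ = 1 := fun k => by
    rw [real_inner_self_eq_norm_sq, b.norm_eq_one]; norm_num
  have hlk : ∀ k, l k = ∑ i, c i * ⟪b k, v i⟫ ^ 2 * t i := by
    intro k
    have h1 : ⟪frameOp c v t (b k), b k⟫ = l k := by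
      rw [hAb, real_inner_smul_left, hbb, mul_one]
    rw [← h1, frameOp_inner]
    exact Finset.sum_congr rfl fun i _ => by ring
  have hw : ∀ k, ∑ i, c i * ⟪b k, v i⟫ ^ 2 = 1 := by
    intro k; rw [h.sum_sq, b.norm_eq_one]; norm_num
  have hp : ∀ i, ∑ k, ⟪b k, v i⟫ ^ 2 = 1 := by
    intro i; rw [b.sum_sq_inner_right, h.unit]; norm_num
  have hnn : ∀ k i, 0 ≤ c i * ⟪b k, v i⟫ ^ 2 := fun k i => mul_nonneg (h.nonneg i) (sq_nonneg _)
  have hlpos : ∀ k, 0 < l k := by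
    intro k
    have h1 : ∃ i ∈ Finset.univ, 0 < c i * ⟪b k, v i⟫ ^ 2 := by
      apply Finset.exists_lt_of_sum_lt
      rw [hw k]; simp
    obtain ⟨i, _, hi⟩ := h1
    rw [hlk]
    exact Finset.sum_pos' (fun i _ => mul_nonneg (hnn k i) (ht i).le) ⟨i, Finset.mem_univ _, mul_pos hi (ht i)⟩
  have hlM : ∀ k, l k ≤ M := by
    intro k
    calc l k = ∑ i, c i * ⟪b k, v i⟫ ^ 2 * t i := hlk k
      _ ≤ ∑ i, c i * ⟪b k, v i⟫ ^ 2 * M :=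
        Finset.sum_le_sum fun i _ => mul_le_mul_of_nonneg_left (hM i) (hnn k i)
      _ = M := by rw [← Finset.sum_mul, hw, one_mul]
  -- Jensen for each k
  have hJ : ∀ k, ∑ i, c i * ⟪b k, v i⟫ ^ 2 * Real.log (t i) +
      (∑ i, c i * ⟪b k, v i⟫ ^ 2 * (t i - l k) ^ 2) / (4 * M ^ 2) ≤ Real.log (l k) := by
    intro k
    have h1 : ∑ i, c i * ⟪b k, v i⟫ ^ 2 * (Real.log (t i) + (t i - l k) ^ 2 / (4 * M ^ 2)) ≤
        ∑ i, c i * ⟪b k, v i⟫ ^ 2 * (Real.log (l k) + (t i - l k) / l k) :=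
      Finset.sum_le_sum fun i _ =>
        mul_le_mul_of_nonneg_left (log_stab (ht i) (hlpos k) (hM i) (hlM k)) (hnn k i)
    have h2 : ∑ i, c i * ⟪b k, v i⟫ ^ 2 * (Real.log (l k) + (t i - l k) / l k) = Real.log (l k) := by
      have : ∀ i, c i * ⟪b k, v i⟫ ^ 2 * (Real.log (l k) + (t i - l k) / l k) =
          c i * ⟪b k, v i⟫ ^ 2 * (Real.log (l k) - 1) + c i * ⟪b k, v i⟫ ^ 2 * t i / l k := by
        intro i
        have := (hlpos k).ne'
        field_simp
        ring
      simp_rw [this]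
      rw [Finset.sum_add_distrib, ← Finset.sum_mul, hw, ← Finset.sum_div, ← hlk,
        div_self (hlpos k).ne']
      ring
    rw [h2] at h1
    refine le_trans (le_of_eq ?_) h1
    rw [Finset.sum_div, ← Finset.sum_add_distrib]
    exact Finset.sum_congr rfl fun i _ => by ring
  -- sum over k
  have hS := Finset.sum_le_sum fun k (_ : k ∈ Finset.univ) => hJ k
  rw [Finset.sum_add_distrib] at hS
  have e1 : ∑ k, ∑ i, c i * ⟪b k, v i⟫ ^ 2 * Real.log (t i) = ∑ i, c i * Real.log (t i) := by
    rw [Finset.sum_comm]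
    refine Finset.sum_congr rfl fun i _ => ?_
    calc _ = ∑ k, c i * Real.log (t i) * ⟪b k, v i⟫ ^ 2 := Finset.sum_congr rfl fun k _ => by ring
      _ = _ := by rw [← Finset.mul_sum, hp, mul_one]
  have e2 : ∑ k, ∑ i, c i * ⟪b k, v i⟫ ^ 2 * (t i - l k) ^ 2 =
      ∑ i, c i * t i ^ 2 - ∑ k, l k ^ 2 := by
    have a1 : ∀ k, ∑ i, c i * ⟪b k, v i⟫ ^ 2 * (t i - l k) ^ 2 =
        ∑ i, c i * t i ^ 2 * ⟪b k, v i⟫ ^ 2 - l k ^ 2 := by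
      intro k
      have : ∀ i, c i * ⟪b k, v i⟫ ^ 2 * (t i - l k) ^ 2 = c i * t i ^ 2 * ⟪b k, v i⟫ ^ 2
          - (2 * l k) * (c i * ⟪b k, v i⟫ ^ 2 * t i) + l k ^ 2 * (c i * ⟪b k, v i⟫ ^ 2) := by
        intro i; ring
      simp_rw [this]
      rw [Finset.sum_add_distrib, Finset.sum_sub_distrib, ← Finset.mul_sum, ← Finset.mul_sum, hw,
        ← hlk]
      ring
    simp_rw [a1]
    rw [Finset.sum_sub_distrib, Finset.sum_comm]
    congr 1
    refine Finset.sum_congr rfl fun i _ => ?_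
    rw [← Finset.mul_sum, hp, mul_one]
  have e3 : ∑ k, l k ^ 2 = ∑ i, ∑ j, c i * c j * t i * t j * ⟪v i, v j⟫ ^ 2 := by
    have a1 : ∀ k, l k ^ 2 = ∑ i, ∑ j, c i * c j * t i * t j * ⟪v i, v j⟫ * (⟪v i, b k⟫ * ⟪b k, v j⟫) := by
      intro k
      have : l k ^ 2 = ⟪frameOp c v t (b k), frameOp c v t (b k)⟫ := by
        rw [hAb, real_inner_smul_left, real_inner_smul_right, hbb]; ring
      rw [this, frameOp_inner]
      refine Finset.sum_congr rfl fun i _ => ?_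
      rw [frameOp_inner, Finset.mul_sum, Finset.mul_sum]
      refine Finset.sum_congr rfl fun j _ => ?_
      rw [real_inner_comm (v i) (b k)]; ring
    simp_rw [a1]
    rw [Finset.sum_comm]
    refine Finset.sum_congr rfl fun i _ => ?_
    rw [Finset.sum_comm]
    refine Finset.sum_congr rfl fun j _ => ?_
    rw [← Finset.mul_sum, b.sum_inner_mul_inner]; ring
  rw [e1, ← Finset.sum_div, e2, e3] at hS
  have e4 := h.qterm_eq t
  have e5 : ∑ k, Real.log (l k) = Real.log (∏ k, l k) := (Real.log_prod fun k _ => (hlpos k).ne').symm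
  have hprod : 0 < ∏ k, l k := Finset.prod_pos fun k _ => hlpos k
  rw [hdet, ← Real.exp_log hprod, Real.exp_le_exp, ← e5]
  refine le_trans (le_of_eq ?_) hS
  rw [e4]
  rw [add_comm]
  congr 1
  rw [show (8:ℝ) * M ^ 2 = 2 * (4 * M ^ 2) by ring, mul_div_mul_left _ _ two_ne_zero]

end

section
open MeasureTheory Metric Set
open scoped RealInnerProductSpace ENNReal


/-! ### Barthe's transport argument -/

/-- The polyhedral set. -/
def polyA {N : ℕ} {ι : Type} (v : ι → Eu N) (t : ℝ) : Set (Eu N) := {y | ∀ i, ⟪y, v i⟫ < t}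

theorem polyA_meas {N : ℕ} {ι : Type} [Fintype ι] (v : ι → Eu N) (t : ℝ) : MeasurableSet (polyA v t) := by
  have : polyA v t = ⋂ i, {y | ⟪y, v i⟫ < t} := by ext; simp [polyA]
  rw [this]
  exact MeasurableSet.iInter fun a => measurableSet_lt (by fun_prop) measurable_const

/-- The transport map. -/
def thetaMap {N : ℕ} {ι : Type} [Fintype ι] (c : ι → ℝ) (v : ι → Eu N) (t : ℝ) (y : Eu N) : Eu N :=
  ∑ i, (c i * Tr t ⟪y, v i⟫) • v i

theorem thetaMap_hasFDerivAt {N : ℕ} {ι : Type} [Fintype ι] (c : ι → ℝ) (v : ι → Eu N) (t : ℝ) {y : Eu N}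
    (hy : y ∈ polyA v t) :
    HasFDerivAt (thetaMap c v t) (frameOp c v fun i => Tr' t ⟪y, v i⟫) y := by
  have h1 : ∀ i, HasFDerivAt (fun y : Eu N => (c i * Tr t ⟪y, v i⟫) • v i)
      ((c i * Tr' t ⟪y, v i⟫) • (innerSL ℝ (v i)).smulRight (v i)) y := by
    intro i
    have hl : HasFDerivAt (fun y : Eu N => ⟪y, v i⟫) (innerSL ℝ (v i)) y := by
      have := (innerSL ℝ (v i)).hasFDerivAt (x := y)
      refine this.congr_of_eventuallyEq (Filter.Eventually.of_forall fun z => ?_)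
      simp [real_inner_comm]
    have h2 := ((Tr_hasDerivAt (hy i)).comp_hasFDerivAt y hl).const_mul (c i)
    have h3 := h2.smul_const (v i)
    have e : ((c i * Tr' t ⟪y, v i⟫) • (innerSL ℝ (v i)).smulRight (v i)) =
        (c i • Tr' t ⟪y, v i⟫ • innerSL ℝ (v i)).smulRight (v i) := by
      ext z; simp [mul_assoc]
    rw [e]
    exact h3
  exact HasFDerivAt.fun_sum fun i _ => h1 i

theorem IsFrame.thetaMap_injOn {N : ℕ} {ι : Type} [Fintype ι] {c : ι → ℝ} {v : ι → Eu N}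
    (h : IsFrame c v) (t : ℝ) : InjOn (thetaMap c v t) (polyA v t) := by
  intro y hy z hz hyz
  have h0 : ∀ x w : Eu N, ⟪thetaMap c v t x, w⟫ = ∑ i, c i * Tr t ⟪x, v i⟫ * ⟪w, v i⟫ := by
    intro x w
    rw [thetaMap, sum_inner]
    refine Finset.sum_congr rfl fun i _ => ?_
    rw [real_inner_smul_left, real_inner_comm (v i) w]
  have h1 : ∑ i, c i * ((Tr t ⟪y, v i⟫ - Tr t ⟪z, v i⟫) * (⟪y, v i⟫ - ⟪z, v i⟫)) = 0 := by
    have e1 := h0 y (y - z)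
    have e2 := h0 z (y - z)
    rw [hyz, e2] at e1
    rw [← sub_eq_zero, ← Finset.sum_sub_distrib] at e1
    have : ∀ i, c i * Tr t ⟪z, v i⟫ * ⟪y - z, v i⟫ - c i * Tr t ⟪y, v i⟫ * ⟪y - z, v i⟫ =
        - (c i * ((Tr t ⟪y, v i⟫ - Tr t ⟪z, v i⟫) * (⟪y, v i⟫ - ⟪z, v i⟫))) := by
      intro i; rw [inner_sub_left]; ring
    simp_rw [this, Finset.sum_neg_distrib] at e1
    linarith
  have hmono := (Tr_strictMonoOn t).monotoneOn
  have hnn : ∀ i, 0 ≤ (Tr t ⟪y, v i⟫ - Tr t ⟪z, v i⟫) * (⟪y, v i⟫ - ⟪z, v i⟫) := by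
    intro i
    rcases le_total ⟪y, v i⟫ ⟪z, v i⟫ with hle | hle
    · have := hmono (hy i) (hz i) hle
      exact mul_nonneg_of_nonpos_of_nonpos (by linarith) (by linarith)
    · have := hmono (hz i) (hy i) hle
      exact mul_nonneg (by linarith) (by linarith)
  rw [Finset.sum_eq_zero_iff_of_nonneg fun i _ => mul_nonneg (h.nonneg i) (hnn i)] at h1
  have h2 : ‖y - z‖ ^ 2 = 0 := by
    rw [← h.sum_sq]
    refine Finset.sum_eq_zero fun i hi => ?_
    rcases mul_eq_zero.mp (h1 i hi) with hc | hc
    · rw [hc, zero_mul]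
    rcases mul_eq_zero.mp hc with hc | hc
    · have := (Tr_strictMonoOn t).injOn (hy i) (hz i) (by linarith)
      rw [inner_sub_left, this]; ring
    · rw [inner_sub_left, hc]; ring
  have := pow_eq_zero_iff (two_ne_zero) |>.mp h2
  rwa [norm_eq_zero, sub_eq_zero] at this

theorem IsFrame.pointwise {N : ℕ} {ι : Type} [Fintype ι] {c : ι → ℝ} {v : ι → Eu N}
    (h : IsFrame c v) (t : ℝ) (y : Eu N) (G : ℝ)
    (hG : Real.exp (G + ∑ i, c i * Real.log (Tr' t ⟪y, v i⟫)) ≤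
      (frameOp c v fun i => Tr' t ⟪y, v i⟫).det) :
    Real.exp G * gdens N y ≤
      Phi t ^ N * (|(frameOp c v fun i => Tr' t ⟪y, v i⟫).det| * gdens N (thetaMap c v t y)) := by
  have h1 : ∑ i, c i * Real.log (Tr' t ⟪y, v i⟫) =
      (∑ i, c i * Tr t ⟪y, v i⟫ ^ 2) / 2 - ‖y‖ ^ 2 / 2 - N * Real.log (Phi t) := by
    rw [← h.sum_sq, ← h.sum_c, Finset.sum_div, Finset.sum_div, Finset.sum_mul,
      ← Finset.sum_sub_distrib, ← Finset.sum_sub_distrib]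
    refine Finset.sum_congr rfl fun i _ => ?_
    rw [Tr', Real.log_div (Real.exp_pos _).ne' (Phi_pos t).ne', Real.log_exp]
    ring
  have h2 := h.norm_sum_le fun i => Tr t ⟪y, v i⟫
  change ‖thetaMap c v t y‖ ^ 2 ≤ _ at h2
  set D := (frameOp c v fun i => Tr' t ⟪y, v i⟫).det
  have hD : Real.exp G * Real.exp (‖thetaMap c v t y‖ ^ 2 / 2) * Real.exp (-‖y‖ ^ 2 / 2) ≤ Phi t ^ N * |D| := by
    have e1 : Phi t ^ N = Real.exp (N * Real.log (Phi t)) := by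
      rw [Real.exp_nat_mul, Real.exp_log (Phi_pos t)]
    calc _ = Real.exp (G + ‖thetaMap c v t y‖ ^ 2 / 2 + -‖y‖ ^ 2 / 2) := by
            rw [Real.exp_add, Real.exp_add]
      _ ≤ Real.exp (N * Real.log (Phi t) + (G + ∑ i, c i * Real.log (Tr' t ⟪y, v i⟫))) := by
            rw [Real.exp_le_exp, h1]; linarith
      _ = Phi t ^ N * Real.exp (G + ∑ i, c i * Real.log (Tr' t ⟪y, v i⟫)) := by
            rw [Real.exp_add, e1]
      _ ≤ Phi t ^ N * |D| := by
            have := Phi_pos t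
            have := hG.trans (le_abs_self D)
            gcongr
  unfold gdens
  set K := (2 * Real.pi) ^ (-(N : ℝ) / 2)
  have hK : 0 < K := by positivity
  calc Real.exp G * (K * Real.exp (-‖y‖ ^ 2 / 2))
      = K * (Real.exp G * Real.exp (‖thetaMap c v t y‖ ^ 2 / 2) * Real.exp (-‖y‖ ^ 2 / 2)) *
          Real.exp (-‖thetaMap c v t y‖ ^ 2 / 2) := by
        rw [show -‖thetaMap c v t y‖ ^ 2 / 2 = -(‖thetaMap c v t y‖ ^ 2 / 2) by ring, Real.exp_neg]
        field_simp
    _ ≤ K * (Phi t ^ N * |D|) * Real.exp (-‖thetaMap c v t y‖ ^ 2 / 2) := by gcongr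
    _ = _ := by ring

theorem IsFrame.transport {N : ℕ} {ι : Type} [Fintype ι] {c : ι → ℝ} {v : ι → Eu N}
    (h : IsFrame c v) (t : ℝ) (G : Eu N → ℝ)
    (hG : ∀ y ∈ polyA v t, Real.exp (G y + ∑ i, c i * Real.log (Tr' t ⟪y, v i⟫)) ≤
      (frameOp c v fun i => Tr' t ⟪y, v i⟫).det) :
    ∫⁻ y in polyA v t, ENNReal.ofReal (Real.exp (G y)) ∂(gaussianM N) ≤ ENNReal.ofReal (Phi t ^ N) := by
  have hA := polyA_meas v t
  rw [gaussianM_def, restrict_withDensity hA,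
    lintegral_withDensity_eq_lintegral_mul_non_measurable _ (gdens_cont N).measurable.ennreal_ofReal
      (Filter.Eventually.of_forall fun _ => ENNReal.ofReal_lt_top)]
  have h1 := lintegral_image_eq_lintegral_abs_det_fderiv_mul volume hA
    (fun y hy => (thetaMap_hasFDerivAt c v t hy).hasFDerivWithinAt) (h.thetaMap_injOn t)
    (fun y => ENNReal.ofReal (gdens N y))
  calc _ ≤ ∫⁻ y in polyA v t, ENNReal.ofReal (Phi t ^ N) *
        (ENNReal.ofReal |(frameOp c v fun i => Tr' t ⟪y, v i⟫).det| *
          ENNReal.ofReal (gdens N (thetaMap c v t y))) := by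
        refine setLIntegral_mono' hA fun y hy => ?_
        have := h.pointwise t y (G y) (hG y hy)
        simp only [Pi.mul_apply]
        rw [← ENNReal.ofReal_mul (gdens_pos N y).le, ← ENNReal.ofReal_mul (abs_nonneg _),
          ← ENNReal.ofReal_mul (pow_nonneg (Phi_nonneg t) N), mul_comm]
        exact ENNReal.ofReal_le_ofReal this
    _ = ENNReal.ofReal (Phi t ^ N) * ∫⁻ y in thetaMap c v t '' polyA v t, ENNReal.ofReal (gdens N y) := by
        rw [lintegral_const_mul' _ _ ENNReal.ofReal_ne_top, h1]
    _ ≤ ENNReal.ofReal (Phi t ^ N) * 1 := by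
        gcongr
        calc _ ≤ ∫⁻ y, ENNReal.ofReal (gdens N y) := setLIntegral_le_lintegral _ _
          _ = gaussianM N univ := by rw [gaussianM_def, withDensity_apply _ MeasurableSet.univ]; simp
          _ = 1 := measure_univ
          _ ≤ 1 := le_rfl
    _ = _ := mul_one _

theorem IsFrame.slepian {N : ℕ} {ι : Type} [Fintype ι] {c : ι → ℝ} {v : ι → Eu N}
    (h : IsFrame c v) (t : ℝ) : gaussianM N (polyA v t) ≤ ENNReal.ofReal (Phi t ^ N) := by
  have := h.transport t (fun _ => 0) (fun y hy => by
    have h1 := h.det_ge (t := fun i => Tr' t ⟪y, v i⟫) (M := ∑ i, Tr' t ⟪y, v i⟫)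
      (fun i => Tr'_pos _ _) (fun i =>
        Finset.single_le_sum (f := fun i => Tr' t ⟪y, v i⟫) (fun j _ => (Tr'_pos _ _).le) (Finset.mem_univ i))
    refine le_trans (Real.exp_le_exp.mpr ?_) h1
    have := h.qterm_nonneg fun i => Tr' t ⟪y, v i⟫
    have : 0 ≤ qterm c v (fun i => Tr' t ⟪y, v i⟫) / (8 * (∑ i, Tr' t ⟪y, v i⟫) ^ 2) := by positivity
    linarith)
  simpa using this

/-- Quadratic form measuring the deficit. -/
def qform {N : ℕ} {ι : Type} [Fintype ι] (c : ι → ℝ) (v : ι → Eu N) (y : Eu N) : ℝ :=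
  ∑ i, ∑ j, c i * c j * ⟪v i, v j⟫ ^ 2 * (⟪y, v i⟫ - ⟪y, v j⟫) ^ 2

theorem IsFrame.deficit {N : ℕ} {ι : Type} [Fintype ι] {c : ι → ℝ} {v : ι → Eu N}
    (h : IsFrame c v) {t : ℝ} (ht1 : 1 ≤ t) (ht2 : t ≤ 2) {B : Set (Eu N)} (hBm : MeasurableSet B)
    (hB0 : ∀ y ∈ B, ∀ i, 0 ≤ ⟪y, v i⟫) (hB1 : ∀ y ∈ B, ∀ i, ⟪y, v i⟫ ≤ 3 / 5) :
    gaussianM N (polyA v t) + ∫⁻ y in B, ENNReal.ofReal (qform c v y / 2 ^ 29) ∂(gaussianM N) ≤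
      ENNReal.ofReal (Phi t ^ N) := by
  classical
  have hBA : B ⊆ polyA v t := fun y hy i => (hB1 y hy i).trans_lt (by linarith)
  have hq : ∀ y, 0 ≤ qform c v y := fun y => Finset.sum_nonneg fun i _ => Finset.sum_nonneg fun j _ => by
    have := h.nonneg i
    have := h.nonneg j
    positivity
  have hT := h.transport t (B.indicator fun y => qform c v y / 2 ^ 29) (fun y hy => by
    by_cases hyB : y ∈ B
    · rw [indicator_of_mem hyB]
      have h1 := h.det_ge (t := fun i => Tr' t ⟪y, v i⟫) (M := 32)
        (fun i => Tr'_pos _ _) (fun i => Tr'_le ht1 (hB0 y hyB i) (hB1 y hyB i))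
      refine le_trans (Real.exp_le_exp.mpr ?_) h1
      have : qform c v y / 2 ^ 16 ≤ qterm c v fun i => Tr' t ⟪y, v i⟫ := by
        rw [qform, qterm, Finset.sum_div]
        refine Finset.sum_le_sum fun i _ => ?_
        rw [Finset.sum_div]
        refine Finset.sum_le_sum fun j _ => ?_
        rw [mul_div_assoc]
        have := h.nonneg i
        have := h.nonneg j
        gcongr
        have key : ∀ i j, ⟪y, v j⟫ ≤ ⟪y, v i⟫ → (⟪y, v i⟫ - ⟪y, v j⟫) ^ 2 / 2 ^ 16 ≤
            (Tr' t ⟪y, v i⟫ - Tr' t ⟪y, v j⟫) ^ 2 := by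
          intro i j hij
          have h2 := Tr'_diff ht2 (hB0 y hyB j) hij (hy i)
          have h3 : 0 ≤ (⟪y, v i⟫ - ⟪y, v j⟫) / 256 := by
            have := sub_nonneg.mpr hij; positivity
          calc (⟪y, v i⟫ - ⟪y, v j⟫) ^ 2 / 2 ^ 16 = ((⟪y, v i⟫ - ⟪y, v j⟫) / 256) ^ 2 := by ring
            _ ≤ _ := by gcongr
        rcases le_total ⟪y, v j⟫ ⟪y, v i⟫ with hij | hij
        · exact key i j hij
        · have := key j i hij
          rw [sub_sq_comm, sub_sq_comm (Tr' t ⟪y, v i⟫)]; exact this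
      have : qform c v y / 2 ^ 29 ≤ qterm c v (fun i => Tr' t ⟪y, v i⟫) / (8 * 32 ^ 2) := by
        rw [div_le_div_iff₀ (by positivity) (by positivity)]
        rw [div_le_iff₀ (by positivity)] at this
        linarith
      linarith
    · rw [indicator_of_notMem hyB]
      have h1 := h.det_ge (t := fun i => Tr' t ⟪y, v i⟫) (M := ∑ i, Tr' t ⟪y, v i⟫)
        (fun i => Tr'_pos _ _) (fun i =>
          Finset.single_le_sum (f := fun i => Tr' t ⟪y, v i⟫) (fun j _ => (Tr'_pos _ _).le) (Finset.mem_univ i))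
      refine le_trans (Real.exp_le_exp.mpr ?_) h1
      have := h.qterm_nonneg fun i => Tr' t ⟪y, v i⟫
      have : 0 ≤ qterm c v (fun i => Tr' t ⟪y, v i⟫) / (8 * (∑ i, Tr' t ⟪y, v i⟫) ^ 2) := by positivity
      linarith)
  refine le_trans ?_ hT
  have e1 : gaussianM N (polyA v t) = ∫⁻ y in polyA v t, 1 ∂(gaussianM N) := by simp
  have e2 : ∫⁻ y in B, ENNReal.ofReal (qform c v y / 2 ^ 29) ∂(gaussianM N) =
      ∫⁻ y in polyA v t, B.indicator (fun y => ENNReal.ofReal (qform c v y / 2 ^ 29)) y ∂(gaussianM N) := by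
    rw [setLIntegral_indicator hBm, inter_eq_left.mpr hBA]
  rw [e1, e2, ← lintegral_add_left measurable_const]
  refine lintegral_mono fun y => ?_
  by_cases hyB : y ∈ B
  · simp only [indicator_of_mem hyB]
    rw [← ENNReal.ofReal_one, ← ENNReal.ofReal_add zero_le_one (by have := hq y; positivity)]
    exact ENNReal.ofReal_le_ofReal (by linarith [Real.add_one_le_exp (qform c v y / 2 ^ 29)])
  · simp [indicator_of_notMem hyB]

end

section
open MeasureTheory Metric Set
open scoped RealInnerProductSpace ENNReal


/-! ### Layer cake and choice of the level -/

theorem lcake_pos {Ω : Type} [MeasurableSpace Ω] (μ : Measure Ω) (Z : Ω → ℝ) (hZ : Measurable Z) :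
    ∫⁻ ω, ENNReal.ofReal (Z ω) ∂μ = ∫⁻ s in Ioi (0:ℝ), μ {ω | s ≤ Z ω} := by
  have h := lintegral_eq_lintegral_meas_le μ (f := fun ω => max (Z ω) 0)
    (Filter.Eventually.of_forall fun ω => le_max_right _ _) (hZ.max measurable_const).aemeasurable
  have e1 : ∀ ω, ENNReal.ofReal (max (Z ω) 0) = ENNReal.ofReal (Z ω) := by
    intro ω; rw [ENNReal.ofReal_max]; simp
  simp_rw [e1] at h
  rw [h]
  refine setLIntegral_congr_fun measurableSet_Ioi fun s hs => ?_
  have hs : 0 < s := hs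
  simp only [le_max_iff, not_le.mpr hs, or_false]

theorem lcake_neg {Ω : Type} [MeasurableSpace Ω] (μ : Measure Ω) (Z : Ω → ℝ) (hZ : Measurable Z) :
    ∫⁻ ω, ENNReal.ofReal (-Z ω) ∂μ = ∫⁻ s in Ioi (0:ℝ), μ {ω | Z ω < -s} := by
  have h := lintegral_eq_lintegral_meas_lt μ (f := fun ω => max (-Z ω) 0)
    (Filter.Eventually.of_forall fun ω => le_max_right _ _) (hZ.neg.max measurable_const).aemeasurable
  have e1 : ∀ ω, ENNReal.ofReal (max (-Z ω) 0) = ENNReal.ofReal (-Z ω) := by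
    intro ω; rw [ENNReal.ofReal_max]; simp
  simp_rw [e1] at h
  rw [h]
  refine setLIntegral_congr_fun measurableSet_Ioi fun s hs => ?_
  have hs : 0 < s := hs
  simp only [lt_max_iff, not_lt.mpr hs.le, or_false]
  congr 1
  ext ω
  simp only [mem_ofPred_eq]
  exact lt_neg

theorem exists_level {Ω : Type} [MeasurableSpace Ω] (μ : Measure Ω) [IsProbabilityMeasure μ]
    {Z1 Z2 : Ω → ℝ} (h1 : Measurable Z1) (h2 : Measurable Z2) (i1 : Integrable Z1 μ) (i2 : Integrable Z2 μ)
    (hle : ∀ s, μ {ω | Z1 ω < s} ≤ μ {ω | Z2 ω < s}) {ε : ℝ} (hε : 0 < ε)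
    (hE : ∫ ω, Z1 ω ∂μ ≤ ∫ ω, Z2 ω ∂μ + ε) :
    ∃ t, 1 ≤ t ∧ t ≤ 2 ∧ μ.real {ω | Z2 ω < t} - μ.real {ω | Z1 ω < t} ≤ 2 * ε := by
  by_contra! hcon
  rw [integral_eq_lintegral_pos_part_sub_lintegral_neg_part i1,
    integral_eq_lintegral_pos_part_sub_lintegral_neg_part i2] at hE
  have hfin : ∀ Z : Ω → ℝ, Integrable Z μ → ∫⁻ ω, ENNReal.ofReal (Z ω) ∂μ ≠ ⊤ := by
    intro Z hZ
    refine ne_top_of_le_ne_top hZ.2.ne (lintegral_mono fun ω => ?_)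
    exact (ENNReal.ofReal_le_ofReal (le_abs_self _)).trans_eq (Real.enorm_eq_ofReal_abs _).symm
  have hn : ∫⁻ ω, ENNReal.ofReal (-Z1 ω) ∂μ ≤ ∫⁻ ω, ENNReal.ofReal (-Z2 ω) ∂μ := by
    rw [lcake_neg μ Z1 h1, lcake_neg μ Z2 h2]
    exact lintegral_mono fun s => hle _
  have hcomp : ∀ Z : Ω → ℝ, Measurable Z → ∀ s, μ.real {ω | s ≤ Z ω} = 1 - μ.real {ω | Z ω < s} := by
    intro Z hZ s
    have : {ω | s ≤ Z ω} = {ω | Z ω < s}ᶜ := by ext; simp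
    rw [this, probReal_compl_eq_one_sub (measurableSet_lt hZ measurable_const)]
  have hp : ∫⁻ ω, ENNReal.ofReal (Z2 ω) ∂μ + ENNReal.ofReal (2 * ε) ≤ ∫⁻ ω, ENNReal.ofReal (Z1 ω) ∂μ := by
    rw [lcake_pos μ Z1 h1, lcake_pos μ Z2 h2]
    have e : ENNReal.ofReal (2 * ε) = ∫⁻ s in Ioi (0:ℝ), (Icc (1:ℝ) 2).indicator (fun _ => ENNReal.ofReal (2 * ε)) s := by
      rw [setLIntegral_indicator measurableSet_Icc]
      have : Icc (1:ℝ) 2 ∩ Ioi 0 = Icc 1 2 := inter_eq_left.mpr fun x hx => lt_of_lt_of_le one_pos hx.1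
      rw [this]; simp; norm_num
    rw [e, ← lintegral_add_right _ (measurable_const.indicator measurableSet_Icc)]
    refine lintegral_mono fun s => ?_
    by_cases hs : s ∈ Icc (1:ℝ) 2
    · simp only [indicator_of_mem hs]
      have := hcon s hs.1 hs.2
      have a1 := hcomp Z1 h1 s
      have a2 := hcomp Z2 h2 s
      rw [← ofReal_measureReal (μ := μ) (s := {ω | s ≤ Z2 ω}), ← ofReal_measureReal (μ := μ) (s := {ω | s ≤ Z1 ω}),
        ← ENNReal.ofReal_add measureReal_nonneg (by positivity)]
      exact ENNReal.ofReal_le_ofReal (by linarith)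
    · simp only [indicator_of_notMem hs, add_zero]
      have a1 := hcomp Z1 h1 s
      have a2 := hcomp Z2 h2 s
      have a3 : μ.real {ω | Z1 ω < s} ≤ μ.real {ω | Z2 ω < s} :=
        ENNReal.toReal_mono (measure_ne_top _ _) (hle s)
      rw [← ofReal_measureReal (μ := μ) (s := {ω | s ≤ Z2 ω}), ← ofReal_measureReal (μ := μ) (s := {ω | s ≤ Z1 ω})]
      exact ENNReal.ofReal_le_ofReal (by linarith)
  have hn' := ENNReal.toReal_mono (hfin _ i2.neg) hn
  simp only [Pi.neg_apply] at hn'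
  have hp' := ENNReal.toReal_mono (hfin _ i1) hp
  rw [ENNReal.toReal_add (hfin _ i2) ENNReal.ofReal_ne_top, ENNReal.toReal_ofReal (by positivity)] at hp'
  linarith

/-! ### Lower bounds for Gaussian measures of balls -/

theorem vol_ball_ge {N : ℕ} (hN : 2 ≤ N) (x : Eu N) {ρ : ℝ} (hρ : 0 ≤ ρ) :
    ρ ^ N * (√Real.pi ^ N / (N : ℝ) ^ N) ≤ volume.real (closedBall x ρ) := by
  have : Nonempty (Fin N) := ⟨⟨0, by omega⟩⟩
  rw [measureReal_def, EuclideanSpace.volume_closedBall, ENNReal.toReal_mul, ENNReal.toReal_pow,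
    ENNReal.toReal_ofReal hρ, Fintype.card_fin, ENNReal.toReal_ofReal (by
      have : 0 < Real.Gamma ((N:ℝ) / 2 + 1) := Real.Gamma_pos_of_pos (by positivity)
      positivity)]
  have hN' : (2:ℝ) ≤ N := by exact_mod_cast hN
  have h1 : Real.Gamma ((N:ℝ) / 2 + 1) ≤ Real.Gamma (N + 1) :=
    Real.Gamma_strictMonoOn_Ici.monotoneOn (by simp only [mem_Ici]; linarith) (by simp only [mem_Ici]; linarith) (by linarith)
  have h2 : Real.Gamma ((N:ℝ) / 2 + 1) ≤ (N:ℝ) ^ N := by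
    refine h1.trans ?_
    rw [Real.Gamma_nat_eq_factorial]
    exact_mod_cast Nat.factorial_le_pow N
  have h3 : 0 < Real.Gamma ((N:ℝ) / 2 + 1) := Real.Gamma_pos_of_pos (by positivity)
  gcongr

theorem gaussianM_ball_ge {N : ℕ} (hN : 2 ≤ N) (x : Eu N) {ρ : ℝ} (hρ : 0 ≤ ρ)
    (hsub : closedBall x ρ ⊆ closedBall 0 1) :
    (1 / 2) * (ρ / (2 * N)) ^ N ≤ (gaussianM N).real (closedBall x ρ) := by
  have h1 := vol_ball_ge hN x hρ
  set κ : ℝ := (2 * Real.pi) ^ (-(N : ℝ) / 2) * Real.exp (-1 / 2) with hκ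
  have hκ0 : 0 < κ := by positivity
  have h2 : ENNReal.ofReal κ * volume (closedBall x ρ) ≤ gaussianM N (closedBall x ρ) := by
    rw [gaussianM_def, withDensity_apply _ measurableSet_closedBall, ← setLIntegral_const]
    refine setLIntegral_mono' measurableSet_closedBall fun y hy => ENNReal.ofReal_le_ofReal ?_
    have hy1 : ‖y‖ ≤ 1 := by simpa using hsub hy
    unfold gdens
    rw [hκ]
    have : ‖y‖ ^ 2 ≤ 1 := pow_le_one₀ (norm_nonneg _) hy1
    gcongr
  have h3 : κ * volume.real (closedBall x ρ) ≤ (gaussianM N).real (closedBall x ρ) := by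
    have := ENNReal.toReal_mono (measure_ne_top _ _) h2
    rwa [ENNReal.toReal_mul, ENNReal.toReal_ofReal hκ0.le] at this
  refine le_trans ?_ h3
  have hN0 : (0:ℝ) < N := by exact_mod_cast (by omega : 0 < N)
  have h4 : (1:ℝ) / 2 ≤ Real.exp (-1 / 2) := by
    have := Real.add_one_le_exp (-1 / 2 : ℝ)
    linarith
  have h5 : (2 * Real.pi) ^ (-(N : ℝ) / 2) = (√(2 * Real.pi) ^ N)⁻¹ := by
    rw [Real.sqrt_eq_rpow, ← Real.rpow_natCast, ← Real.rpow_mul (by positivity), ← Real.rpow_neg (by positivity)]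
    congr 1; ring
  have h6 : √(2 * Real.pi) ≤ 2 * √Real.pi := by
    rw [Real.sqrt_mul two_pos.le]
    have : √2 ≤ 2 := by rw [Real.sqrt_le_left (by norm_num)]; norm_num
    gcongr
  calc (1 / 2) * (ρ / (2 * N)) ^ N = (1/2) * (((2 * √Real.pi) ^ N)⁻¹ * (ρ ^ N * (√Real.pi ^ N / (N : ℝ) ^ N))) := by
        have : 0 < √Real.pi := by positivity
        rw [div_pow, mul_pow, mul_pow]; field_simp
    _ ≤ Real.exp (-1/2) * ((√(2 * Real.pi) ^ N)⁻¹ * (ρ ^ N * (√Real.pi ^ N / (N : ℝ) ^ N))) := by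
        gcongr
    _ = κ * (ρ ^ N * (√Real.pi ^ N / (N : ℝ) ^ N)) := by rw [hκ, h5]; ring
    _ ≤ _ := by gcongr

end

section
open MeasureTheory Metric Set
open scoped RealInnerProductSpace ENNReal


/-- The total defect. -/
def defectS {N : ℕ} {ι : Type} [Fintype ι] (c : ι → ℝ) (v : ι → Eu N) : ℝ :=
  ∑ i, ∑ j, c i * c j * (⟪v i, v j⟫ ^ 2 * (1 - ⟪v i, v j⟫))

theorem int_sq_ge {N : ℕ} (hN : 3 ≤ N) {e u : Eu N} (he : ‖e‖ = 1) (heu : ⟪e, u⟫ = 0) :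
    (1 / (16 * N)) * ‖u‖ ^ 2 * ((1 / 2) * (1 / (16 * (N:ℝ) ^ 2)) ^ N) ≤
      ∫ y in closedBall ((1 / 2 : ℝ) • e) (1 / (2 * √N)), ⟪y, u⟫ ^ 2 ∂(gaussianM N) := by
  have hN3 : (3:ℝ) ≤ N := by exact_mod_cast hN
  set s := √(N:ℝ) with hs
  have hs2 : s ^ 2 = N := Real.sq_sqrt (by positivity)
  have hs1 : 1 ≤ s := by rw [hs, Real.one_le_sqrt]; linarith
  have hsN : s ≤ N := by nlinarith
  have hs0 : 0 < s := by linarith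
  set r := 1 / (2 * s) with hr
  have hr0 : 0 < r := by positivity
  have hr1 : r ≤ 1 / 2 := by
    rw [hr]; exact one_div_le_one_div_of_le two_pos (by linarith)
  set û : Eu N := ‖u‖⁻¹ • u with hû
  have hûn : ‖û‖ ≤ 1 := by
    rw [hû, norm_smul, norm_inv, norm_norm]; exact inv_mul_le_one
  have hûu : ⟪û, u⟫ = ‖u‖ := by
    rw [hû, real_inner_smul_left, real_inner_self_eq_norm_sq]
    by_cases h : ‖u‖ = 0
    · simp [h]
    · field_simp
  set B := closedBall ((1 / 2 : ℝ) • e) r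
  set B' := closedBall ((1 / 2 : ℝ) • e + (3 * r / 4) • û) (r / 4)
  have hB'B : B' ⊆ B := by
    apply closedBall_subset_closedBall'
    rw [dist_eq_norm, add_sub_cancel_left, norm_smul, Real.norm_of_nonneg (by positivity)]
    nlinarith
  have hB1 : B ⊆ closedBall 0 1 := by
    apply closedBall_subset_closedBall'
    rw [dist_zero_right, norm_smul, he]
    norm_num; linarith
  have hlow : ∀ y ∈ B', (r / 2 * ‖u‖) ^ 2 ≤ ⟪y, u⟫ ^ 2 := by
    intro y hy
    have h1 : ⟪y, u⟫ = 3 * r / 4 * ‖u‖ + ⟪y - ((1 / 2 : ℝ) • e + (3 * r / 4) • û), u⟫ := by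
      rw [inner_sub_left, inner_add_left, real_inner_smul_left, real_inner_smul_left, heu, hûu]; ring
    have h2 : |⟪y - ((1 / 2 : ℝ) • e + (3 * r / 4) • û), u⟫| ≤ r / 4 * ‖u‖ := by
      refine (abs_real_inner_le_norm _ _).trans ?_
      gcongr
      rwa [← dist_eq_norm]
    have h3 : r / 2 * ‖u‖ ≤ ⟪y, u⟫ := by
      rw [h1]; have := (abs_le.mp h2).1; linarith
    have : 0 ≤ r / 2 * ‖u‖ := by positivity
    gcongr
  have hIntg : IntegrableOn (fun y => ⟪y, u⟫ ^ 2) B (gaussianM N) :=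
    ContinuousOn.integrableOn_compact (isCompact_closedBall _ _) (by fun_prop)
  have hg := gaussianM_ball_ge (N := N) (by omega) ((1 / 2 : ℝ) • e + (3 * r / 4) • û) (ρ := r / 4) (by positivity)
    (hB'B.trans hB1)
  calc (1 / (16 * N)) * ‖u‖ ^ 2 * ((1 / 2) * (1 / (16 * (N:ℝ) ^ 2)) ^ N)
      ≤ (r / 2 * ‖u‖) ^ 2 * ((1 / 2) * (r / 4 / (2 * N)) ^ N) := by
        have e1 : (r / 2 * ‖u‖) ^ 2 = (1 / (16 * N)) * ‖u‖ ^ 2 := by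
          rw [← hs2, hr]; field_simp; ring
        rw [e1]
        have e2 : 1 / (16 * (N:ℝ) ^ 2) ≤ r / 4 / (2 * N) := by
          rw [hr, div_div, div_div, div_le_div_iff₀ (by positivity) (by positivity)]
          nlinarith
        have e3 := pow_le_pow_left₀ (by positivity) e2 N
        have e4 : 0 ≤ 1 / (16 * (N:ℝ)) * ‖u‖ ^ 2 := by positivity
        exact mul_le_mul_of_nonneg_left (by linarith) e4
    _ ≤ (r / 2 * ‖u‖) ^ 2 * (gaussianM N).real B' := by gcongr
    _ = ∫ y in B', (r / 2 * ‖u‖) ^ 2 ∂(gaussianM N) := by rw [setIntegral_const, smul_eq_mul, mul_comm]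
    _ ≤ ∫ y in B', ⟪y, u⟫ ^ 2 ∂(gaussianM N) :=
        setIntegral_mono_on (integrable_const _) (hIntg.mono_set hB'B) measurableSet_closedBall hlow
    _ ≤ ∫ y in B, ⟪y, u⟫ ^ 2 ∂(gaussianM N) :=
        setIntegral_mono_set hIntg (Filter.Eventually.of_forall fun y => sq_nonneg _)
          (LE.le.eventuallyLE hB'B)

theorem IsFrame.defect_le {N : ℕ} (hN : 3 ≤ N) {ι : Type} [Fintype ι] {c : ι → ℝ} {v : ι → Eu N}
    (h : IsFrame c v) {e : Eu N} (he : ‖e‖ = 1) (hev : ∀ i, ⟪e, v i⟫ = 1 / √N)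
    {t : ℝ} (ht1 : 1 ≤ t) (ht2 : t ≤ 2) {D : ℝ}
    (hD : Phi t ^ N - (gaussianM N).real (polyA v t) ≤ D) :
    defectS c v ≤ 2 ^ 33 * N * (16 * (N:ℝ) ^ 2) ^ N * D := by
  have hN3 : (3:ℝ) ≤ N := by exact_mod_cast hN
  set s := √(N:ℝ) with hs
  have hs2 : s ^ 2 = N := Real.sq_sqrt (by positivity)
  have hs1 : 5 / 3 ≤ s := by
    rw [hs]; apply Real.le_sqrt_of_sq_le; norm_num; linarith
  have hs0 : 0 < s := by linarith
  set B := closedBall ((1 / 2 : ℝ) • e) (1 / (2 * s)) with hB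
  have hBi : ∀ y ∈ B, ∀ i, |⟪y, v i⟫ - 1 / (2 * s)| ≤ 1 / (2 * s) := by
    intro y hy i
    have e1 : ⟪y, v i⟫ - 1 / (2 * s) = ⟪y - (1 / 2 : ℝ) • e, v i⟫ := by
      rw [inner_sub_left, real_inner_smul_left, hev]; field_simp
    rw [e1]
    refine (abs_real_inner_le_norm _ _).trans ?_
    rw [h.unit, mul_one, ← dist_eq_norm]; exact hy
  have hdef := h.deficit ht1 ht2 (B := B) measurableSet_closedBall
    (fun y hy i => by have := (abs_le.mp (hBi y hy i)).1; linarith)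
    (fun y hy i => by
      have h1 := (abs_le.mp (hBi y hy i)).2
      have h2 : 1 / (2 * s) ≤ 3 / 10 := by
        rw [div_le_div_iff₀ (by positivity) (by norm_num)]; linarith
      linarith)
  have hqc : Continuous (qform c v) := by unfold qform; fun_prop
  have hq : ∀ y, 0 ≤ qform c v y := fun y => Finset.sum_nonneg fun i _ => Finset.sum_nonneg fun j _ => by
    have := h.nonneg i
    have := h.nonneg j
    positivity
  have hqi : IntegrableOn (fun y => qform c v y / 2 ^ 29) B (gaussianM N) :=
    ContinuousOn.integrableOn_compact (isCompact_closedBall _ _) (by fun_prop)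
  rw [← ofReal_integral_eq_lintegral_ofReal hqi
    (Filter.Eventually.of_forall fun y => by have := hq y; positivity)] at hdef
  have hI0 : 0 ≤ ∫ y in B, qform c v y / 2 ^ 29 ∂(gaussianM N) :=
    setIntegral_nonneg measurableSet_closedBall fun y _ => by have := hq y; positivity
  have hdef2 : (gaussianM N).real (polyA v t) + ∫ y in B, qform c v y / 2 ^ 29 ∂(gaussianM N) ≤ Phi t ^ N := by
    have := ENNReal.toReal_mono ENNReal.ofReal_ne_top hdef
    rwa [ENNReal.toReal_add (measure_ne_top _ _) ENNReal.ofReal_ne_top, ENNReal.toReal_ofReal hI0,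
      ENNReal.toReal_ofReal (pow_nonneg (Phi_nonneg t) N)] at this
  rw [integral_div] at hdef2
  have hsqi : ∀ u : Eu N, IntegrableOn (fun y => ⟪y, u⟫ ^ 2) B (gaussianM N) := fun u =>
    ContinuousOn.integrableOn_compact (isCompact_closedBall _ _) (by fun_prop)
  have hsum : ∫ y in B, qform c v y ∂(gaussianM N) =
      ∑ i, ∑ j, c i * c j * ⟪v i, v j⟫ ^ 2 * ∫ y in B, ⟪y, v i - v j⟫ ^ 2 ∂(gaussianM N) := by
    unfold qform
    simp_rw [← inner_sub_right]
    rw [integral_finsetSum _ fun i _ => integrable_finsetSum _ fun j _ => (hsqi _).const_mul _]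
    refine Finset.sum_congr rfl fun i _ => ?_
    rw [integral_finsetSum _ fun j _ => (hsqi _).const_mul _]
    refine Finset.sum_congr rfl fun j _ => ?_
    rw [integral_const_mul]
  set X : ℝ := (1 / 2) * (1 / (16 * (N:ℝ) ^ 2)) ^ N with hX
  have hge : (1 / (8 * N)) * X * defectS c v ≤ ∫ y in B, qform c v y ∂(gaussianM N) := by
    rw [hsum, defectS, Finset.mul_sum]
    refine Finset.sum_le_sum fun i _ => ?_
    rw [Finset.mul_sum]
    refine Finset.sum_le_sum fun j _ => ?_
    have h1 := int_sq_ge hN (e := e) (u := v i - v j) he (by rw [inner_sub_right, hev, hev, sub_self])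
    have h2 : ‖v i - v j‖ ^ 2 = 2 * (1 - ⟪v i, v j⟫) := by
      rw [norm_sub_sq_real, h.unit, h.unit]; ring
    rw [h2] at h1
    have h3 : 0 ≤ c i * c j * ⟪v i, v j⟫ ^ 2 := by
      have := h.nonneg i
      have := h.nonneg j
      positivity
    refine le_trans (le_of_eq ?_) (mul_le_mul_of_nonneg_left h1 h3)
    rw [← hX]
    field_simp
    ring
  have hX0 : 0 < X := by positivity
  have hfin : (1 / (8 * N)) * X * defectS c v ≤ 2 ^ 29 * D := by
    linarith
  have hXi : 2 * (16 * (N:ℝ) ^ 2) ^ N * X = 1 := by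
    rw [hX, one_div_pow]; field_simp
  calc defectS c v = (8 * N * (2 * (16 * (N:ℝ) ^ 2) ^ N)) * ((1 / (8 * N)) * X * defectS c v) := by
        have : (8 * N * (2 * (16 * (N:ℝ) ^ 2) ^ N)) * ((1 / (8 * N)) * X * defectS c v) =
          (2 * (16 * (N:ℝ) ^ 2) ^ N * X) * defectS c v := by field_simp
        rw [this, hXi, one_mul]
    _ ≤ (8 * N * (2 * (16 * (N:ℝ) ^ 2) ^ N)) * (2 ^ 29 * D) := by gcongr
    _ = _ := by ring

end

section
open MeasureTheory Metric Set
open scoped RealInnerProductSpace ENNReal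


/-! ### Lifting a John decomposition by one dimension -/

/-- A centred decomposition of the identity. -/
structure IsJohn {n : ℕ} {ι : Type} [Fintype ι] (c : ι → ℝ) (u : ι → Eu n) : Prop extends IsFrame c u where
  bary : ∑ i, c i • u i = 0

/-- The lifted vectors. -/
def liftV {n : ℕ} {ι : Type} (u : ι → Eu n) (i : ι) : Eu (n + 1) :=
  √((n:ℝ) / (n + 1)) • liftE (1 / √(n:ℝ)) (u i)

/-- The lifted weights. -/
def liftC (n : ℕ) {ι : Type} (c : ι → ℝ) (i : ι) : ℝ := ((n + 1 : ℝ) / n) * c i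

theorem inner_liftV_left {n : ℕ} {ι : Type} (u : ι → Eu n) (i : ι) (y : Eu (n + 1)) :
    ⟪y, liftV u i⟫ = √((n:ℝ) / (n + 1)) * (y 0 / √(n:ℝ) + ⟪tailE y, u i⟫) := by
  rw [liftV, real_inner_smul_right, inner_liftE_left]; ring

theorem inner_liftV {n : ℕ} (hn : 1 ≤ n) {ι : Type} (u : ι → Eu n) (i j : ι) :
    ⟪liftV u i, liftV u j⟫ = (1 + n * ⟪u i, u j⟫) / (n + 1) := by
  have hn1 : (1:ℝ) ≤ n := by exact_mod_cast hn
  rw [liftV, liftV, real_inner_smul_left, real_inner_smul_right, inner_liftE, ← mul_assoc,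
    Real.mul_self_sqrt (by positivity), div_mul_div_comm, Real.mul_self_sqrt (by positivity)]
  field_simp

theorem IsJohn.bary_inner {n : ℕ} {ι : Type} [Fintype ι] {c : ι → ℝ} {u : ι → Eu n}
    (h : IsJohn c u) (x : Eu n) : ∑ i, c i * ⟪x, u i⟫ = 0 := by
  have := congrArg (fun z => ⟪x, z⟫) h.bary
  simpa [inner_sum, real_inner_smul_right] using this

theorem IsJohn.lift {n : ℕ} (hn : 1 ≤ n) {ι : Type} [Fintype ι] {c : ι → ℝ} {u : ι → Eu n}
    (h : IsJohn c u) : IsFrame (liftC n c) (liftV u) := by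
  have hn1 : (1:ℝ) ≤ n := by exact_mod_cast hn
  refine ⟨fun i => mul_nonneg (by positivity) (h.nonneg i), fun i => ?_, fun x y => ?_⟩
  · have : ‖liftV u i‖ ^ 2 = 1 := by
      rw [← real_inner_self_eq_norm_sq, inner_liftV hn, h.inner_self]; field_simp; ring
    have h0 := norm_nonneg (liftV u i)
    nlinarith
  · have h0 := h.sum_c
    have h1 := h.bary_inner (tailE x)
    have h2 := h.bary_inner (tailE y)
    have h3 := h.frame (tailE x) (tailE y)
    have e : ∀ i, liftC n c i * (⟪x, liftV u i⟫ * ⟪y, liftV u i⟫) =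
        (x 0 * y 0 / n) * c i + (x 0 / √(n:ℝ)) * (c i * ⟪tailE y, u i⟫)
          + (y 0 / √(n:ℝ)) * (c i * ⟪tailE x, u i⟫) + c i * (⟪tailE x, u i⟫ * ⟪tailE y, u i⟫) := by
      intro i
      rw [inner_liftV_left, inner_liftV_left, liftC]
      have e1 : √((n:ℝ) / (n + 1)) * √((n:ℝ) / (n + 1)) = n / (n + 1) := Real.mul_self_sqrt (by positivity)
      have e2 : (1 / √(n:ℝ)) * (1 / √(n:ℝ)) = 1 / n := by
        rw [div_mul_div_comm, Real.mul_self_sqrt (by positivity), one_mul]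
      have e3 : ((n + 1 : ℝ) / n) * (n / (n + 1)) = 1 := by field_simp
      set a := √((n:ℝ) / (n + 1))
      have e4 : x 0 / √(n:ℝ) = x 0 * (1 / √(n:ℝ)) := by ring
      have e5 : y 0 / √(n:ℝ) = y 0 * (1 / √(n:ℝ)) := by ring
      have e6 : x 0 * y 0 / n = x 0 * y 0 * (1 / n) := by ring
      rw [e4, e5, e6]
      set b := 1 / √(n:ℝ)
      have e7 : ∀ p q : ℝ, ((n + 1 : ℝ) / n) * c i * (a * p * (a * q)) = c i * (p * q) := by
        intro p q
        calc _ = (((n + 1 : ℝ) / n) * (a * a)) * (c i * (p * q)) := by ring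
          _ = _ := by rw [e1, e3, one_mul]
      rw [e7, ← e2]
      ring
    simp_rw [e, Finset.sum_add_distrib, ← Finset.mul_sum]
    rw [h0, h1, h2, h3]
    conv_rhs => rw [← liftE_eta x, ← liftE_eta y, inner_liftE]
    field_simp
    ring

theorem liftV_e {n : ℕ} (hn : 1 ≤ n) {ι : Type} (u : ι → Eu n) (i : ι) :
    ⟪liftE 1 (0 : Eu n), liftV u i⟫ = 1 / √((n + 1 : ℕ) : ℝ) := by
  have hn1 : (1:ℝ) ≤ n := by exact_mod_cast hn
  rw [liftV, real_inner_smul_right, inner_liftE, inner_zero_left, Real.sqrt_div (by positivity)]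
  have : √(n:ℝ) ≠ 0 := by positivity
  push_cast
  field_simp
  ring

theorem liftE_e_norm {n : ℕ} : ‖liftE 1 (0 : Eu n)‖ = 1 := by
  have : ‖liftE 1 (0 : Eu n)‖ ^ 2 = 1 := by
    rw [← real_inner_self_eq_norm_sq, inner_liftE]; simp
  have h0 := norm_nonneg (liftE 1 (0 : Eu n))
  nlinarith

/-! ### The maximum functional -/

/-- `max_i ⟪x, u i⟫`. -/
def maxI {n : ℕ} {ι : Type} [Fintype ι] [Nonempty ι] (u : ι → Eu n) (x : Eu n) : ℝ :=
  Finset.univ.sup' Finset.univ_nonempty fun i => ⟪x, u i⟫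

section maxI
variable {n : ℕ} {ι : Type} [Fintype ι] [Nonempty ι] (u : ι → Eu n)

theorem le_maxI (x : Eu n) (i : ι) : ⟪x, u i⟫ ≤ maxI u x :=
  Finset.le_sup' (fun i => ⟪x, u i⟫) (Finset.mem_univ i)

theorem maxI_le {x : Eu n} {a : ℝ} (h : ∀ i, ⟪x, u i⟫ ≤ a) : maxI u x ≤ a :=
  Finset.sup'_le _ _ fun i _ => h i

theorem exists_maxI (x : Eu n) : ∃ i, maxI u x = ⟪x, u i⟫ := by
  obtain ⟨i, _, h⟩ := Finset.exists_mem_eq_sup' Finset.univ_nonempty fun i => ⟪x, u i⟫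
  exact ⟨i, h⟩

theorem maxI_lt_iff {x : Eu n} {a : ℝ} : maxI u x < a ↔ ∀ i, ⟪x, u i⟫ < a := by
  simp [maxI]

theorem maxI_cont : Continuous (maxI u) := by
  unfold maxI
  exact Continuous.finset_sup'_apply _ fun i _ => by fun_prop

theorem maxI_abs_le (hu : ∀ i, ‖u i‖ = 1) (x : Eu n) : |maxI u x| ≤ ‖x‖ := by
  obtain ⟨i, h⟩ := exists_maxI u x
  rw [h]
  refine (abs_real_inner_le_norm _ _).trans ?_
  rw [hu, mul_one]

theorem maxI_integrable (hu : ∀ i, ‖u i‖ = 1) : Integrable (maxI u) (gaussianM n) :=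
  (gaussianM_integrable_norm n).mono' (maxI_cont u).aestronglyMeasurable
    (Filter.Eventually.of_forall fun x => maxI_abs_le u hu x)

theorem maxI_liftV (y : Eu (n + 1)) :
    maxI (liftV u) y = √((n:ℝ) / (n + 1)) * (y 0 / √(n:ℝ) + maxI u (tailE y)) := by
  apply le_antisymm
  · refine maxI_le _ fun i => ?_
    rw [inner_liftV_left]
    have := le_maxI u (tailE y) i
    gcongr
  · obtain ⟨i, h⟩ := exists_maxI u (tailE y)
    rw [h, ← inner_liftV_left]
    exact le_maxI _ _ _

theorem integral_maxI_liftV (hu : ∀ i, ‖u i‖ = 1) :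
    ∫ y, maxI (liftV u) y ∂(gaussianM (n + 1)) =
      √((n:ℝ) / (n + 1)) * ∫ x, maxI u x ∂(gaussianM n) := by
  simp_rw [maxI_liftV]
  rw [integral_const_mul]
  congr 1
  have e : ∀ y : Eu (n + 1), y 0 / √(n:ℝ) = ⟪y, liftE (1 / √(n:ℝ)) 0⟫ := by
    intro y; rw [inner_liftE_left, inner_zero_right]; ring
  simp_rw [e]
  have hi : Integrable (fun y => maxI u (tailE y)) (gaussianM (n + 1)) := by
    have := maxI_integrable u hu
    rw [← gaussianM_map_tail n] at this
    exact this.comp_measurable tailE_cont.measurable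
  rw [integral_add (gaussianM_inner_integrable _) hi, gaussianM_inner_integral, zero_add,
    ← gaussianM_map_tail n, integral_map tailE_cont.measurable.aemeasurable
      (maxI_cont u).aestronglyMeasurable]

end maxI

theorem IsJohn.maxI_nonneg {n : ℕ} (hn : 1 ≤ n) {ι : Type} [Fintype ι] [Nonempty ι] {c : ι → ℝ} {u : ι → Eu n}
    (h : IsJohn c u) (x : Eu n) : 0 ≤ maxI u x := by
  by_contra! hlt
  have h1 := h.bary_inner x
  have h2 : ∑ i, c i * ⟪x, u i⟫ ≤ ∑ i, c i * maxI u x :=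
    Finset.sum_le_sum fun i _ => mul_le_mul_of_nonneg_left (le_maxI u x i) (h.nonneg i)
  rw [h1, ← Finset.sum_mul, h.sum_c] at h2
  have : (1:ℝ) ≤ n := by exact_mod_cast hn
  nlinarith

theorem IsJohn.nonempty {n : ℕ} (hn : 1 ≤ n) {ι : Type} [Fintype ι] {c : ι → ℝ} {u : ι → Eu n}
    (h : IsJohn c u) : Nonempty ι := by
  by_contra hne
  rw [not_nonempty_iff] at hne
  have := h.sum_c
  simp at this
  have h0 : (n : ℝ) = 0 := by linarith
  norm_cast at h0; omega

/-! ### The regular simplex -/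

theorem simplex_orthonormal {n : ℕ} (hn : 1 ≤ n) {w : Fin (n + 1) → Eu n} (hw : IsRegVerts w) :
    Orthonormal ℝ (liftV w) := by
  have hn1 : (1:ℝ) ≤ n := by exact_mod_cast hn
  rw [orthonormal_iff_ite]
  intro i j
  rw [inner_liftV hn]
  split_ifs with hij
  · rw [hij, real_inner_self_eq_norm_sq, hw.1]; field_simp; ring
  · rw [hw.2 i j hij]; field_simp; ring

/-- The lifted vertices of the regular simplex as an orthonormal basis. -/
def simplexBasis {n : ℕ} (hn : 1 ≤ n) {w : Fin (n + 1) → Eu n} (hw : IsRegVerts w) :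
    OrthonormalBasis (Fin (n + 1)) ℝ (Eu (n + 1)) :=
  (basisOfOrthonormalOfCardEqFinrank (simplex_orthonormal hn hw) (by simp)).toOrthonormalBasis
    (by rw [coe_basisOfOrthonormalOfCardEqFinrank]; exact simplex_orthonormal hn hw)

theorem simplexBasis_apply {n : ℕ} (hn : 1 ≤ n) {w : Fin (n + 1) → Eu n} (hw : IsRegVerts w) (a) :
    simplexBasis hn hw a = liftV w a := by
  simp [simplexBasis]

theorem simplex_john {n : ℕ} (hn : 1 ≤ n) {w : Fin (n + 1) → Eu n} (hw : IsRegVerts w) :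
    IsJohn (fun _ => (n:ℝ) / (n + 1)) w := by
  have hn1 : (1:ℝ) ≤ n := by exact_mod_cast hn
  have key : ∀ X Y : Eu (n + 1), ∑ a, ⟪X, liftV w a⟫ * ⟪Y, liftV w a⟫ = ⟪X, Y⟫ := by
    intro X Y
    have := (simplexBasis hn hw).sum_inner_mul_inner X Y
    rw [← this]
    refine Finset.sum_congr rfl fun a _ => ?_
    rw [simplexBasis_apply, real_inner_comm Y]
  have l0 : ∀ x a, ⟪liftE 0 x, liftV w a⟫ = √((n:ℝ) / (n + 1)) * ⟪x, w a⟫ := by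
    intro x a
    rw [liftV, real_inner_smul_right, inner_liftE, zero_mul, zero_add]
  refine ⟨⟨fun i => by positivity, hw.1, fun x y => ?_⟩, ?_⟩
  · have := key (liftE 0 x) (liftE 0 y)
    simp_rw [l0] at this
    rw [inner_liftE, zero_mul, zero_add] at this
    rw [← this]
    refine Finset.sum_congr rfl fun a _ => ?_
    have e1 : √((n:ℝ) / (n + 1)) * √((n:ℝ) / (n + 1)) = n / (n + 1) := Real.mul_self_sqrt (by positivity)
    show (n:ℝ) / (n + 1) * _ = _
    calc _ = √((n:ℝ) / (n + 1)) * √((n:ℝ) / (n + 1)) * (⟪x, w a⟫ * ⟪y, w a⟫) := by rw [e1]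
      _ = _ := by ring
  · rw [← Finset.smul_sum]
    suffices ∑ a, w a = 0 by rw [this, smul_zero]
    refine ext_inner_left ℝ fun y => ?_
    have := key (liftE 1 0) (liftE 0 y)
    simp_rw [l0, liftV_e hn] at this
    rw [inner_liftE, mul_zero, inner_zero_left, zero_add, ← Finset.mul_sum, ← Finset.mul_sum, ← inner_sum] at this
    rw [inner_zero_right]
    have h1 : 1 / √((n + 1 : ℕ) : ℝ) ≠ 0 := by positivity
    have h2 : √((n:ℝ) / (n + 1)) ≠ 0 := by positivity
    rcases mul_eq_zero.mp this with h3 | h3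
    · exact absurd h3 h1
    · rcases mul_eq_zero.mp h3 with h4 | h4
      · exact absurd h4 h2
      · exact h4

theorem defect_of_integral {n : ℕ} (hn : 2 ≤ n) {ι : Type} [Fintype ι] [Nonempty ι] {c : ι → ℝ} {u : ι → Eu n}
    (h : IsJohn c u) {w : Fin (n + 1) → Eu n} (hw : IsRegVerts w) {ε : ℝ} (hε : 0 < ε)
    (hE : ∫ x, maxI u x ∂(gaussianM n) ≤ ∫ x, maxI w x ∂(gaussianM n) + ε) :
    defectS (liftC n c) (liftV u) ≤
      2 ^ 33 * (n + 1) * (16 * ((n:ℝ) + 1) ^ 2) ^ (n + 1) * (2 * ε) := by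
  have hn1 : 1 ≤ n := by omega
  have hf := h.lift hn1
  have hfw := (simplex_john hn1 hw).lift hn1
  have hsq : √((n:ℝ) / (n + 1)) ≤ 1 := by
    apply Real.sqrt_le_one.mpr; rw [div_le_one (by positivity)]; linarith
  have hpoly : ∀ (κ : Type) [Fintype κ] [Nonempty κ] (v : κ → Eu (n + 1)) (t : ℝ),
      {y | maxI v y < t} = polyA v t := by
    intro κ _ _ v t
    ext y; simp [polyA, maxI_lt_iff]
  have hP2 : ∀ t, gaussianM (n + 1) (polyA (liftV w) t) = ENNReal.ofReal (Phi t ^ (n + 1)) := by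
    intro t
    rw [← gaussianM_orth (simplexBasis hn1 hw) t]
    simp_rw [simplexBasis_apply]; rfl
  obtain ⟨t, ht1, ht2, ht⟩ := exists_level (gaussianM (n + 1)) (Z1 := maxI (liftV u)) (Z2 := maxI (liftV w))
    (maxI_cont _).measurable (maxI_cont _).measurable (maxI_integrable _ hf.unit) (maxI_integrable _ hfw.unit)
    (fun s => by
      rw [hpoly, hpoly, hP2]; exact hf.slepian s) hε (by
      rw [integral_maxI_liftV _ h.unit, integral_maxI_liftV _ hw.1]
      have h0 := Real.sqrt_nonneg ((n:ℝ) / (n + 1))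
      nlinarith)
  have := hf.defect_le (by omega) liftE_e_norm (liftV_e hn1 u) ht1 ht2 (D := 2 * ε) (by
    rw [hpoly, hpoly] at ht
    have e : (gaussianM (n + 1)).real (polyA (liftV w) t) = Phi t ^ (n + 1) := by
      rw [measureReal_def, hP2, ENNReal.toReal_ofReal (pow_nonneg (Phi_nonneg t) _)]
    rwa [e] at ht)
  push_cast at this
  exact this

end

section
open MeasureTheory Metric Set
open scoped RealInnerProductSpace ENNReal


/-! ### Greedy selection of an almost orthonormal system -/

theorem exists_le_avg {ι : Type} [Fintype ι] {c F : ι → ℝ} {S q : ℝ} (hc : ∀ i, 0 ≤ c i) (hS : ∑ i, c i = S)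
    (hS0 : 0 < S) (hF : ∑ i, c i * F i ≤ S * q) : ∃ i, F i ≤ q := by
  by_contra! hcon
  have h0 : ∃ i, 0 < c i := by
    by_contra! h
    have : ∑ i, c i ≤ 0 := Finset.sum_nonpos fun i _ => h i
    linarith
  obtain ⟨i0, hi0⟩ := h0
  have : ∑ i, c i * q < ∑ i, c i * F i :=
    Finset.sum_lt_sum (fun i _ => mul_le_mul_of_nonneg_left (hcon i).le (hc i))
      ⟨i0, Finset.mem_univ _, mul_lt_mul_of_pos_left (hcon i0) hi0⟩
  rw [← Finset.sum_mul, hS] at this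
  linarith

theorem IsFrame.greedy {N : ℕ} (hN : 1 ≤ N) {ι : Type} [Fintype ι] {c : ι → ℝ} {v : ι → Eu N}
    (h : IsFrame c v) {δ : ℝ} (hδ : 0 < δ) (hS : defectS c v ≤ δ) (m : ℕ) (hm : m ≤ N) :
    ∃ f : Fin m → ι, (∀ a, ∑ k, c k * (⟪v (f a), v k⟫ ^ 2 * (1 - ⟪v (f a), v k⟫)) ≤ 4 * δ) ∧
      ∀ a b, a ≠ b → ⟪v (f a), v (f b)⟫ ^ 2 ≤ 64 * (N:ℝ) ^ 2 * δ := by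
  have hN1 : (1:ℝ) ≤ N := by exact_mod_cast hN
  have hs1 : ∀ i j, ⟪v i, v j⟫ ≤ 1 := by
    intro i j
    refine (real_inner_le_norm _ _).trans ?_
    rw [h.unit, h.unit, mul_one]
  induction m with
  | zero => exact ⟨Fin.elim0, fun a => a.elim0, fun a => a.elim0⟩
  | succ m ih =>
    obtain ⟨f, hf1, hf2⟩ := ih (by omega)
    have hmN : (m:ℝ) + 1 ≤ N := by exact_mod_cast hm
    set r : ι → ℝ := fun j => ∑ k, c k * (⟪v j, v k⟫ ^ 2 * (1 - ⟪v j, v k⟫)) with hr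
    set g : Fin m → ι → ℝ := fun a j => ⟪v (f a), v j⟫ ^ 2 * (1 - ⟪v (f a), v j⟫) with hg
    have hr0 : ∀ j, 0 ≤ r j := fun j => Finset.sum_nonneg fun k _ =>
      mul_nonneg (h.nonneg k) (mul_nonneg (sq_nonneg _) (by linarith [hs1 j k]))
    have hg0 : ∀ a j, 0 ≤ g a j := fun a j => mul_nonneg (sq_nonneg _) (by linarith [hs1 (f a) j])
    have hrS : ∑ j, c j * r j = defectS c v := by
      rw [defectS]
      refine Finset.sum_congr rfl fun j _ => ?_
      rw [hr, Finset.mul_sum]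
      exact Finset.sum_congr rfl fun k _ => by ring
    have hex : ∃ j, ∑ a, ⟪v (f a), v j⟫ ^ 2 + 1 / (16 * N * δ) * ∑ a, g a j + 1 / (4 * δ) * r j ≤
        1 - 1 / (2 * N) := by
      refine exists_le_avg h.nonneg h.sum_c (by linarith) ?_
      have e : ∑ j, c j * (∑ a, ⟪v (f a), v j⟫ ^ 2 + 1 / (16 * N * δ) * ∑ a, g a j + 1 / (4 * δ) * r j)
          = ∑ a, ∑ j, c j * ⟪v (f a), v j⟫ ^ 2 + 1 / (16 * N * δ) * ∑ a, ∑ j, c j * g a j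
            + 1 / (4 * δ) * ∑ j, c j * r j := by
        rw [Finset.sum_comm, Finset.sum_comm (f := fun a j => c j * g a j), Finset.mul_sum, Finset.mul_sum,
          ← Finset.sum_add_distrib, ← Finset.sum_add_distrib]
        refine Finset.sum_congr rfl fun j _ => ?_
        rw [← Finset.mul_sum, ← Finset.mul_sum]; ring
      rw [e, hrS]
      have e1 : ∑ a : Fin m, ∑ j, c j * ⟪v (f a), v j⟫ ^ 2 = m := by simp [h.row]
      have e2 : ∑ a : Fin m, ∑ j, c j * g a j ≤ m * (4 * δ) := by
        calc _ ≤ ∑ a : Fin m, 4 * δ := Finset.sum_le_sum fun a _ => hf1 a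
          _ = _ := by simp
      have e3 : 1 / (16 * N * δ) * ∑ a : Fin m, ∑ j, c j * g a j ≤ 1 / 4 := by
        calc _ ≤ 1 / (16 * N * δ) * (m * (4 * δ)) := by gcongr
          _ = m / (4 * N) := by field_simp; ring
          _ ≤ 1 / 4 := by rw [div_le_div_iff₀ (by positivity) (by norm_num)]; linarith
      have e4 : 1 / (4 * δ) * defectS c v ≤ 1 / 4 := by
        calc _ ≤ 1 / (4 * δ) * δ := by gcongr
          _ = 1 / 4 := by field_simp
      have e5 : (N:ℝ) * (1 - 1 / (2 * N)) = N - 1 / 2 := by field_simp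
      rw [e1, e5]
      linarith
    obtain ⟨j, hj⟩ := hex
    have hA : 0 ≤ ∑ a, ⟪v (f a), v j⟫ ^ 2 := Finset.sum_nonneg fun a _ => sq_nonneg _
    have hB : 0 ≤ ∑ a, g a j := Finset.sum_nonneg fun a _ => hg0 a j
    have hB' : 0 ≤ 1 / (16 * N * δ) * ∑ a, g a j := by positivity
    have hC' : 0 ≤ 1 / (4 * δ) * r j := mul_nonneg (by positivity) (hr0 j)
    have hN0 : 0 < 1 / (2 * (N:ℝ)) := by positivity
    have hrj : r j ≤ 4 * δ := by
      have : 1 / (4 * δ) * r j ≤ 1 := by linarith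
      rw [div_mul_eq_mul_div, one_mul, div_le_one (by positivity)] at this
      exact this
    have hsj : ∀ a, ⟪v (f a), v j⟫ ^ 2 ≤ 64 * (N:ℝ) ^ 2 * δ := by
      intro a
      have h1 : ⟪v (f a), v j⟫ ^ 2 ≤ 1 - 1 / (2 * N) := by
        have := Finset.single_le_sum (f := fun a => ⟪v (f a), v j⟫ ^ 2) (fun a _ => sq_nonneg _) (Finset.mem_univ a)
        linarith
      have h2 : g a j ≤ 16 * N * δ := by
        have h3 := Finset.single_le_sum (f := fun a => g a j) (fun a _ => hg0 a j) (Finset.mem_univ a)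
        have h4 : 1 / (16 * N * δ) * g a j ≤ 1 := by
          have : 1 / (16 * N * δ) * g a j ≤ 1 / (16 * N * δ) * ∑ a, g a j := by gcongr
          linarith
        rw [div_mul_eq_mul_div, one_mul, div_le_one (by positivity)] at h4
        exact h4
      have h3 : 1 / (4 * N) ≤ 1 - ⟪v (f a), v j⟫ := by
        have e : 1 / (2 * (N:ℝ)) = 2 * (1 / (4 * N)) := by field_simp; norm_num
        rw [e] at h1
        nlinarith [sq_nonneg (⟪v (f a), v j⟫ - 1)]
      have h4 : ⟪v (f a), v j⟫ ^ 2 * (1 / (4 * N)) ≤ 16 * N * δ :=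
        (mul_le_mul_of_nonneg_left h3 (sq_nonneg _)).trans h2
      rw [mul_one_div, div_le_iff₀ (by positivity)] at h4
      linarith
    refine ⟨Fin.cons j f, ?_, ?_⟩
    · refine Fin.cases ?_ (fun a => ?_)
      · simpa using hrj
      · simpa using hf1 a
    · refine Fin.cases ?_ (fun a => ?_) <;> refine Fin.cases ?_ (fun b => ?_)
      · intro h; exact absurd rfl h
      · intro _
        simp only [Fin.cons_zero, Fin.cons_succ]
        rw [real_inner_comm]; exact hsj b
      · intro _
        simp only [Fin.cons_zero, Fin.cons_succ]
        exact hsj a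
      · intro hab
        simp only [Fin.cons_succ]
        exact hf2 a b fun h => hab (by rw [h])

/-- Selection of an almost regular simplex among the contact points. -/
theorem IsJohn.select {n : ℕ} (hn : 1 ≤ n) {ι : Type} [Fintype ι] {c : ι → ℝ} {u : ι → Eu n}
    (h : IsJohn c u) {δ : ℝ} (hδ : 0 < δ) (hS : defectS (liftC n c) (liftV u) ≤ δ) :
    ∃ f : Fin (n + 1) → ι, ∀ a b, a ≠ b →
      |⟪u (f a), u (f b)⟫ + 1 / n| ≤ 16 * (n + 1) * √δ := by
  have hn1 : (1:ℝ) ≤ n := by exact_mod_cast hn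
  obtain ⟨f, -, hf⟩ := (h.lift hn).greedy (by omega) hδ hS (n + 1) le_rfl
  refine ⟨f, fun a b hab => ?_⟩
  have h1 := hf a b hab
  rw [inner_liftV hn] at h1
  push_cast at h1
  have h2 : |(1 + n * ⟪u (f a), u (f b)⟫) / (n + 1)| ≤ 8 * (n + 1) * √δ := by
    apply abs_le_of_sq_le_sq _ (by positivity)
    rw [mul_pow, Real.sq_sqrt hδ.le]
    linarith
  have e : ⟪u (f a), u (f b)⟫ + 1 / n = ((n + 1) / n) * ((1 + n * ⟪u (f a), u (f b)⟫) / (n + 1)) := by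
    field_simp; ring
  rw [e, abs_mul, abs_of_nonneg (by positivity)]
  have h3 : ((n:ℝ) + 1) / n ≤ 2 := by rw [div_le_iff₀ (by positivity)]; linarith
  calc _ ≤ 2 * (8 * (n + 1) * √δ) := by gcongr
    _ = _ := by ring

end

section
open MeasureTheory Metric Set
open scoped RealInnerProductSpace ENNReal


/-! ### Approximating an almost isometry by an isometry -/

theorem exists_isometry_near {n : ℕ} (h0 : 0 < n) (M : Eu n →ₗ[ℝ] Eu n) {η : ℝ} (hη : η < 1)
    (hM : ∀ x, |‖M x‖ ^ 2 - ‖x‖ ^ 2| ≤ η * ‖x‖ ^ 2) :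
    ∃ T : Eu n ≃ₗᵢ[ℝ] Eu n, ∀ x, ‖T x - M x‖ ≤ η * ‖x‖ := by
  have hsym : (M.adjoint ∘ₗ M).IsSymmetric := by
    intro x y
    simp [LinearMap.adjoint_inner_left, LinearMap.adjoint_inner_right]
  have hfr : Module.finrank ℝ (Eu n) = n := by simp
  set b := hsym.eigenvectorBasis hfr with hb
  have horth : ∀ i j, i ≠ j → ⟪M (b i), M (b j)⟫ = 0 := by
    intro i j hij
    rw [← LinearMap.adjoint_inner_left M]
    have := hsym.apply_eigenvectorBasis hfr i
    rw [LinearMap.comp_apply] at this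
    rw [hb, this]
    rw [real_inner_smul_left, (hsym.eigenvectorBasis hfr).inner_eq_zero hij, mul_zero]
  have hnorm : ∀ i, |‖M (b i)‖ ^ 2 - 1| ≤ η := by
    intro i
    have := hM (b i)
    rw [b.norm_eq_one] at this
    simpa using this
  have hpos : ∀ i, 0 < ‖M (b i)‖ := by
    intro i
    have h1 := (abs_le.mp (hnorm i)).1
    by_contra! h2
    have h3 : ‖M (b i)‖ = 0 := le_antisymm h2 (norm_nonneg _)
    rw [h3] at h1
    linarith
  set f : Fin n → Eu n := fun i => ‖M (b i)‖⁻¹ • M (b i) with hf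
  have hfo : Orthonormal ℝ f := by
    constructor
    · intro i
      rw [hf, norm_smul, norm_inv, norm_norm, inv_mul_cancel₀ (hpos i).ne']
    · intro i j hij
      simp only [hf, real_inner_smul_left, real_inner_smul_right, horth i j hij, mul_zero]
  have : Nonempty (Fin n) := ⟨⟨0, h0⟩⟩
  set B : OrthonormalBasis (Fin n) ℝ (Eu n) :=
    (basisOfOrthonormalOfCardEqFinrank hfo (by simp)).toOrthonormalBasis
      (by rw [coe_basisOfOrthonormalOfCardEqFinrank]; exact hfo) with hB
  have hBf : ∀ i, B i = f i := by intro i; simp [hB]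
  refine ⟨b.equiv B (Equiv.refl _), fun x => ?_⟩
  have hT : ∀ i, b.equiv B (Equiv.refl _) (b i) = f i := by
    intro i; simp [hBf]
  have hMb : ∀ i, M (b i) = ‖M (b i)‖ • f i := by
    intro i
    simp only [hf]
    rw [smul_smul, mul_inv_cancel₀ (hpos i).ne', one_smul]
  have hη0 : ∀ i : Fin n, 0 ≤ η := fun i => (abs_nonneg _).trans (hnorm i)
  have e : b.equiv B (Equiv.refl _) x - M x = ∑ i, (⟪b i, x⟫ * (1 - ‖M (b i)‖)) • B i := by
    conv_lhs => rw [← b.sum_repr' x]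
    rw [map_sum, map_sum, ← Finset.sum_sub_distrib]
    refine Finset.sum_congr rfl fun i _ => ?_
    rw [map_smul, map_smul, hT, hBf, ← smul_sub]
    conv_lhs => rw [hMb i]
    rw [mul_smul, sub_smul, one_smul]
  have hη00 := hη0 ⟨0, h0⟩
  refine abs_le_of_sq_le_sq' ?_ (by positivity) |>.2
  rw [e, mul_pow]
  have e2 : ‖∑ i, (⟪b i, x⟫ * (1 - ‖M (b i)‖)) • B i‖ ^ 2 = ∑ i, (⟪b i, x⟫ * (1 - ‖M (b i)‖)) ^ 2 := by
    rw [← real_inner_self_eq_norm_sq, B.orthonormal.inner_sum]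
    exact Finset.sum_congr rfl fun i _ => by simp [sq]
  rw [e2, ← b.sum_sq_inner_right x, Finset.mul_sum]
  refine Finset.sum_le_sum fun i _ => ?_
  rw [mul_pow, mul_comm]
  have h3 : (1 - ‖M (b i)‖) ^ 2 ≤ η ^ 2 := by
    have h1 := hnorm i
    have h2 : |‖M (b i)‖ ^ 2 - 1| = (‖M (b i)‖ + 1) * |1 - ‖M (b i)‖| := by
      rw [← abs_of_nonneg (show 0 ≤ ‖M (b i)‖ + 1 by positivity), ← abs_mul, ← abs_neg]
      congr 1
      ring
    rw [h2] at h1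
    apply sq_le_sq'
    · have := neg_abs_le (1 - ‖M (b i)‖)
      nlinarith [mul_nonneg (hpos i).le (abs_nonneg (1 - ‖M (b i)‖))]
    · have := le_abs_self (1 - ‖M (b i)‖)
      nlinarith [mul_nonneg (hpos i).le (abs_nonneg (1 - ‖M (b i)‖))]
  gcongr

theorem exists_rotation {n : ℕ} (hn : 1 ≤ n) {w : Fin (n + 1) → Eu n} (hw : IsRegVerts w)
    {p : Fin (n + 1) → Eu n} (hp : ∀ a, ‖p a‖ = 1) {τ : ℝ}
    (hpw : ∀ a b, a ≠ b → |⟪p a, p b⟫ + 1 / n| ≤ τ) (hτ0 : 0 ≤ τ) (hτ : ((n:ℝ) + 1) ^ 2 * τ ≤ 1 / 2) :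
    ∃ T : Eu n ≃ₗᵢ[ℝ] Eu n, ∀ a, ‖T (w a) - p a‖ ≤ 2 * ((n:ℝ) + 1) ^ 2 * τ := by
  have hn1 : (1:ℝ) ≤ n := by exact_mod_cast hn
  have hJ := simplex_john hn hw
  set κ : ℝ := (n:ℝ) / (n + 1) with hκ
  have hκ0 : 0 ≤ κ := by positivity
  have hκ1 : κ ≤ 1 := by rw [hκ, div_le_one (by positivity)]; linarith
  set η : ℝ := ((n:ℝ) + 1) ^ 2 * τ with hη
  have hη0 : 0 ≤ η := by positivity
  have hG : ∀ a b, |⟪p a, p b⟫ - ⟪w a, w b⟫| ≤ τ := by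
    intro a b
    by_cases hab : a = b
    · rw [hab, real_inner_self_eq_norm_sq, real_inner_self_eq_norm_sq, hp, hw.1]; simpa using hτ0
    · rw [hw.2 a b hab, neg_div, sub_neg_eq_add]; exact hpw a b hab
  have hxw : ∀ x a, |⟪x, w a⟫| ≤ ‖x‖ := by
    intro x a
    refine (abs_real_inner_le_norm _ _).trans ?_
    rw [hw.1, mul_one]
  let M : Eu n →ₗ[ℝ] Eu n :=
    { toFun := fun x => κ • ∑ a, ⟪x, w a⟫ • p a
      map_add' := fun x y => by simp [inner_add_left, add_smul, Finset.sum_add_distrib]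
      map_smul' := fun r x => by
        simp only [real_inner_smul_left, mul_smul, ← Finset.smul_sum, RingHom.id_apply]
        rw [smul_comm] }
  have hMx : ∀ x, M x = κ • ∑ a, ⟪x, w a⟫ • p a := fun x => rfl
  have hx : ∀ x, x = κ • ∑ a, ⟪x, w a⟫ • w a := by
    intro x
    refine ext_inner_left ℝ fun y => ?_
    rw [real_inner_smul_right, inner_sum, ← hJ.frame y x, Finset.mul_sum]
    refine Finset.sum_congr rfl fun a _ => ?_
    rw [real_inner_smul_right]; ring
  have hgram : ∀ (q : Fin (n + 1) → Eu n) (x : Eu n), ‖κ • ∑ a, ⟪x, w a⟫ • q a‖ ^ 2 =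
      ∑ a, ∑ b, κ ^ 2 * (⟪x, w a⟫ * ⟪x, w b⟫) * ⟪q a, q b⟫ := by
    intro q x
    rw [← real_inner_self_eq_norm_sq, real_inner_smul_left, real_inner_smul_right, sum_inner, Finset.mul_sum,
      Finset.mul_sum]
    refine Finset.sum_congr rfl fun a _ => ?_
    rw [inner_sum, Finset.mul_sum, Finset.mul_sum]
    refine Finset.sum_congr rfl fun b _ => ?_
    rw [real_inner_smul_left, real_inner_smul_right]; ring
  have hM : ∀ x, |‖M x‖ ^ 2 - ‖x‖ ^ 2| ≤ η * ‖x‖ ^ 2 := by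
    intro x
    conv_lhs => rw [hMx, hgram]; rw [hx x]
    conv_lhs => enter [1, 2]; rw [hgram]
    conv_lhs => simp only [← hx x]
    rw [← Finset.sum_sub_distrib]
    refine (Finset.abs_sum_le_sum_abs _ _).trans ?_
    calc _ ≤ ∑ a : Fin (n + 1), ∑ b : Fin (n + 1), τ * ‖x‖ ^ 2 := by
          refine Finset.sum_le_sum fun a _ => ?_
          rw [← Finset.sum_sub_distrib]
          refine (Finset.abs_sum_le_sum_abs _ _).trans ?_
          refine Finset.sum_le_sum fun b _ => ?_
          rw [← mul_sub, abs_mul, abs_mul, abs_mul, abs_of_nonneg (sq_nonneg κ)]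
          calc _ ≤ 1 * (‖x‖ * ‖x‖) * τ := by
                have := hxw x a
                have := hxw x b
                have := hG a b
                have : κ ^ 2 ≤ 1 := by nlinarith
                gcongr
            _ = _ := by ring
      _ = _ := by simp [hη]; ring
  obtain ⟨T, hT⟩ := exists_isometry_near (by omega) M (by linarith) hM
  refine ⟨T, fun a => ?_⟩
  set z := ∑ a, p a with hz
  have hwsum : ∀ a, ∑ b, ⟪w a, w b⟫ = 0 := by
    intro a
    have := hJ.bary_inner (w a)
    rw [← Finset.mul_sum] at this
    rcases mul_eq_zero.mp this with h | h
    · have : 0 < κ := by positivity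
      exact absurd h this.ne'
    · exact h
  have hpz : ∀ a, |⟪p a, z⟫| ≤ (n + 1) * τ := by
    intro a
    have : ⟪p a, z⟫ = ∑ b, (⟪p a, p b⟫ - ⟪w a, w b⟫) := by
      rw [Finset.sum_sub_distrib, hwsum, sub_zero, hz, inner_sum]
    rw [this]
    refine (Finset.abs_sum_le_sum_abs _ _).trans ?_
    calc _ ≤ ∑ b : Fin (n + 1), τ := Finset.sum_le_sum fun b _ => hG a b
      _ = _ := by simp
  have hMz : ∀ x, |⟪M x, z⟫| ≤ η * ‖x‖ := by
    intro x
    rw [hMx, real_inner_smul_left, sum_inner, abs_mul, abs_of_nonneg hκ0]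
    calc _ ≤ 1 * ∑ a : Fin (n + 1), ‖x‖ * ((n + 1) * τ) := by
          refine mul_le_mul hκ1 ?_ (abs_nonneg _) zero_le_one
          refine (Finset.abs_sum_le_sum_abs _ _).trans ?_
          refine Finset.sum_le_sum fun a _ => ?_
          rw [real_inner_smul_left, abs_mul]
          exact mul_le_mul (hxw x a) (hpz a) (abs_nonneg _) (norm_nonneg _)
      _ = _ := by simp [hη]; ring
  have hzn : ‖z‖ ≤ 2 * η := by
    have h1 := hMz (T.symm z)
    have h2 := hT (T.symm z)
    rw [T.apply_symm_apply, T.symm.norm_map] at h2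
    rw [T.symm.norm_map] at h1
    have h3 : ‖z‖ ^ 2 = ⟪z - M (T.symm z), z⟫ + ⟪M (T.symm z), z⟫ := by
      rw [← inner_add_left, sub_add_cancel, real_inner_self_eq_norm_sq]
    have h4 : ⟪z - M (T.symm z), z⟫ ≤ η * ‖z‖ * ‖z‖ :=
      (real_inner_le_norm _ _).trans (by gcongr)
    have h5 := le_abs_self ⟪M (T.symm z), z⟫
    by_contra! hcon
    have h6 : 0 ≤ ‖z‖ := norm_nonneg z
    nlinarith [mul_nonneg h6 h6, mul_nonneg hη0 h6]
  have hMw : M (w a) = p a - ((1:ℝ) / (n + 1)) • z := by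
    have e : ∀ b, ⟪w a, w b⟫ • p b = (if a = b then ((n + 1 : ℝ) / n) • p b else 0) - ((1:ℝ) / n) • p b := by
      intro b
      split_ifs with hab
      · rw [hab, real_inner_self_eq_norm_sq, hw.1, ← sub_smul]; congr 1; field_simp; ring
      · rw [hw.2 a b hab, zero_sub, neg_div, neg_smul]
    rw [hMx]
    simp_rw [e]
    rw [Finset.sum_sub_distrib, Finset.sum_ite_eq, if_pos (Finset.mem_univ _), ← Finset.smul_sum, smul_sub,
      smul_smul, smul_smul]
    congr 1
    · have : κ * ((n + 1 : ℝ) / n) = 1 := by rw [hκ]; field_simp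
      rw [this, one_smul]
    · congr 1; rw [hκ]; field_simp
  have h1 := hT (w a)
  rw [hw.1, mul_one, hMw] at h1
  calc ‖T (w a) - p a‖ = ‖(T (w a) - (p a - ((1:ℝ) / (n + 1)) • z)) - ((1:ℝ) / (n + 1)) • z‖ := by
        congr 1; abel
    _ ≤ η + 1 / (n + 1) * ‖z‖ := by
        refine (norm_sub_le _ _).trans ?_
        rw [norm_smul, Real.norm_of_nonneg (by positivity)]
        gcongr
    _ ≤ η + 1 / 2 * (2 * η) := by
        gcongr
        linarith
    _ = _ := by rw [hη]; ring

end

section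
open MeasureTheory Metric Set
open scoped RealInnerProductSpace ENNReal Pointwise


/-! ### Gauges and volumes -/

theorem gaussianM_ge_vol {n : ℕ} {S : Set (Eu n)} (hS : MeasurableSet S) (hsub : S ⊆ closedBall 0 1) :
    ENNReal.ofReal (1 / (2 * 3 ^ n)) * volume S ≤ gaussianM n S := by
  rw [gaussianM_def, withDensity_apply _ hS, ← setLIntegral_const]
  refine setLIntegral_mono' hS fun y hy => ENNReal.ofReal_le_ofReal ?_
  have hy1 : ‖y‖ ≤ 1 := by simpa using hsub hy
  unfold gdens
  have h5 : (2 * Real.pi) ^ (-(n : ℝ) / 2) = (√(2 * Real.pi) ^ n)⁻¹ := by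
    rw [Real.sqrt_eq_rpow, ← Real.rpow_natCast, ← Real.rpow_mul (by positivity), ← Real.rpow_neg (by positivity)]
    congr 1; ring
  have h4 : (1:ℝ) / 2 ≤ Real.exp (-1 / 2) := by
    have := Real.add_one_le_exp (-1 / 2 : ℝ)
    linarith
  have h6 : √(2 * Real.pi) ≤ 3 := by
    rw [Real.sqrt_le_left (by norm_num)]
    have := Real.pi_lt_d2
    linarith
  have h7 : Real.exp (-1 / 2) ≤ Real.exp (-‖y‖ ^ 2 / 2) := by
    have : ‖y‖ ^ 2 ≤ 1 := pow_le_one₀ (norm_nonneg _) hy1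
    gcongr
  rw [h5]
  calc (1:ℝ) / (2 * 3 ^ n) = (3 ^ n)⁻¹ * (1 / 2) := by field_simp
    _ ≤ (√(2 * Real.pi) ^ n)⁻¹ * Real.exp (-‖y‖ ^ 2 / 2) := by
      have h8 := h4.trans h7
      gcongr

theorem vol_ball_le {n : ℕ} (hn : 2 ≤ n) {R : ℝ} (hR : 0 ≤ R) :
    volume.real (closedBall (0 : Eu n) R) ≤ (2 * R) ^ n := by
  have : Nonempty (Fin n) := ⟨⟨0, by omega⟩⟩
  have hn2 : (2:ℝ) ≤ n := by exact_mod_cast hn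
  have hG : 1 ≤ Real.Gamma ((n:ℝ) / 2 + 1) := by
    have h2 : Real.Gamma 2 ≤ Real.Gamma ((n:ℝ) / 2 + 1) :=
      Real.Gamma_strictMonoOn_Ici.monotoneOn (by simp) (by simp only [mem_Ici]; linarith) (by linarith)
    rwa [Real.Gamma_two] at h2
  rw [measureReal_def, EuclideanSpace.volume_closedBall, ENNReal.toReal_mul, ENNReal.toReal_pow,
    ENNReal.toReal_ofReal hR, Fintype.card_fin, ENNReal.toReal_ofReal (by positivity), mul_pow, mul_comm]
  have hpi : √Real.pi ≤ 2 := by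
    rw [Real.sqrt_le_left (by norm_num)]; have := Real.pi_lt_d2; linarith
  have : √Real.pi ^ n / Real.Gamma ((n:ℝ) / 2 + 1) ≤ 2 ^ n := by
    refine (div_le_self (by positivity) hG).trans ?_
    gcongr
  gcongr

theorem IsJohn.norm_le {n : ℕ} {ι : Type} [Fintype ι] {c : ι → ℝ} {u : ι → Eu n}
    (h : IsJohn c u) {x : Eu n} (hx : ∀ i, ⟪x, u i⟫ ≤ 1) : ‖x‖ ≤ n := by
  have h1 : 0 ≤ ∑ i, c i * ((1 - ⟪x, u i⟫) * (‖x‖ + ⟪x, u i⟫)) := by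
    refine Finset.sum_nonneg fun i _ => mul_nonneg (h.nonneg i) (mul_nonneg (by linarith [hx i]) ?_)
    have := neg_le_of_abs_le (abs_real_inner_le_norm x (u i))
    rw [h.unit, mul_one] at this
    linarith
  have h2 : ∑ i, c i * ((1 - ⟪x, u i⟫) * (‖x‖ + ⟪x, u i⟫)) = n * ‖x‖ - ‖x‖ ^ 2 := by
    rw [← h.sum_c, ← h.sum_sq x, Finset.sum_mul]
    have h3 := h.bary_inner x
    have : ∀ i, c i * ((1 - ⟪x, u i⟫) * (‖x‖ + ⟪x, u i⟫)) =
        c i * ‖x‖ - c i * ⟪x, u i⟫ ^ 2 + (1 - ‖x‖) * (c i * ⟪x, u i⟫) := fun i => by ring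
    simp_rw [this, Finset.sum_add_distrib, Finset.sum_sub_distrib, ← Finset.mul_sum, h3]
    ring
  rw [h2] at h1
  by_contra! hcon
  have h4 : (0:ℝ) ≤ n := by positivity
  nlinarith

/-- The polyhedron `{x | ⟪x, w a⟫ ≤ 1}`. -/
def slab {n : ℕ} {ι : Type} (w : ι → Eu n) : Set (Eu n) := {x | ∀ a, ⟪x, w a⟫ ≤ 1}

theorem polar_eq_slab {n : ℕ} (w : Fin (n + 1) → Eu n) :
    polarSet (convexHull ℝ (Set.range w)) = slab w := by
  ext x
  constructor
  · intro hx a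
    exact hx _ (subset_convexHull ℝ _ ⟨a, rfl⟩)
  · intro hx y hy
    have : convexHull ℝ (Set.range w) ⊆ {y | ⟪x, y⟫ ≤ 1} := by
      refine convexHull_min ?_ (convex_halfSpace_le (f := fun y => ⟪x, y⟫) ⟨fun a b => inner_add_right _ _ _, fun r a => real_inner_smul_right _ _ _⟩ 1)
      rintro _ ⟨a, rfl⟩
      exact hx a
    exact this hy

theorem absorbent_of_ball {n : ℕ} {K : Set (Eu n)} (hB : closedBall (0 : Eu n) 1 ⊆ K) : Absorbent ℝ K :=
  absorbent_nhds_zero (Filter.mem_of_superset (closedBall_mem_nhds 0 one_pos) hB)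

section gauge
variable {n : ℕ} {ι : Type} [Fintype ι] [Nonempty ι] (u : ι → Eu n)

theorem maxI_smul {s : ℝ} (hs : 0 ≤ s) (x : Eu n) : maxI u (s • x) = s * maxI u x := by
  apply le_antisymm
  · refine maxI_le _ fun i => ?_
    rw [real_inner_smul_left]
    exact mul_le_mul_of_nonneg_left (le_maxI u x i) hs
  · obtain ⟨i, h⟩ := exists_maxI u x
    rw [h, ← real_inner_smul_left]
    exact le_maxI _ _ _

theorem maxI_le_gauge {K : Set (Eu n)} (hB : closedBall (0 : Eu n) 1 ⊆ K) {ρ : ℝ} (hρ : 0 < ρ)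
    (hK : ∀ x ∈ K, ∀ i, ⟪x, u i⟫ ≤ ρ) (x : Eu n) : maxI u x / ρ ≤ gauge K x := by
  refine le_of_forall_gt_imp_ge_of_dense fun a ha => ?_
  obtain ⟨b, hb0, hba, hbx⟩ := exists_lt_of_gauge_lt (absorbent_of_ball hB) ha
  obtain ⟨y, hy, rfl⟩ := hbx
  rw [div_le_iff₀ hρ]
  have h1 : maxI u (b • y) ≤ b * ρ := by
    rw [maxI_smul u hb0.le]
    exact mul_le_mul_of_nonneg_left (maxI_le u (hK y hy)) hb0.le
  have : b * ρ ≤ a * ρ := by gcongr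
  simpa using h1.trans this

theorem gauge_le_norm {K : Set (Eu n)} (hB : closedBall (0 : Eu n) 1 ⊆ K) (x : Eu n) : gauge K x ≤ ‖x‖ := by
  have := mul_gauge_le_norm (x := x) (ball_subset_closedBall.trans hB)
  linarith

theorem gauge_integrable {K : Set (Eu n)} (hKc : Convex ℝ K) (hB : closedBall (0 : Eu n) 1 ⊆ K) :
    Integrable (gauge K) (gaussianM n) :=
  (gaussianM_integrable_norm n).mono'
    (continuous_gauge hKc (Filter.mem_of_superset (closedBall_mem_nhds 0 one_pos) hB)).aestronglyMeasurable
    (Filter.Eventually.of_forall fun x => by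
      rw [Real.norm_of_nonneg (gauge_nonneg x)]; exact gauge_le_norm hB x)

theorem ball_subset_slab (hu : ∀ i, ‖u i‖ = 1) : closedBall (0 : Eu n) 1 ⊆ slab u := by
  intro x hx i
  refine (real_inner_le_norm _ _).trans ?_
  rw [hu, mul_one]; simpa using hx

theorem gauge_slab (hu : ∀ i, ‖u i‖ = 1) (h0 : ∀ x, 0 ≤ maxI u x) (x : Eu n) :
    gauge (slab u) x = maxI u x := by
  apply le_antisymm
  · refine le_of_forall_gt_imp_ge_of_dense fun a ha => ?_
    have ha0 : 0 < a := (h0 x).trans_lt ha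
    refine gauge_le_of_mem ha0.le ?_
    rw [mem_smul_set_iff_inv_smul_mem₀ ha0.ne']
    intro i
    rw [real_inner_smul_left, inv_mul_le_iff₀ ha0, mul_one]
    exact (le_maxI u x i).trans ha.le
  · have := maxI_le_gauge u (ball_subset_slab u hu) one_pos (fun x hx => hx) x
    simpa using this

end gauge

theorem shell {n : ℕ} (hn : 2 ≤ n) {K : Set (Eu n)} (hKcomp : IsCompact K) (hKconv : Convex ℝ K)
    (hB : closedBall (0 : Eu n) 1 ⊆ K) {w : Fin (n + 1) → Eu n} (hw : IsRegVerts w) {ρ : ℝ} (hρ1 : 1 ≤ ρ)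
    (hρ2 : ρ ≤ 2) (hKQ : ∀ x ∈ K, ∀ a, ⟪x, w a⟫ ≤ ρ) {E : ℝ}
    (hE : ∫ x, gauge K x ∂(gaussianM n) ≤ (∫ x, maxI w x ∂(gaussianM n)) / ρ + E) :
    volume.real ({x | maxI w x < ρ} \ K) ≤ 8 * n * (12 * n) ^ n * E := by
  have hn2 : (2:ℝ) ≤ n := by exact_mod_cast hn
  have hJ := simplex_john (by omega) hw
  have hmx := hJ.maxI_nonneg (by omega)
  have hρ0 : 0 < ρ := by linarith
  set A := {x | maxI w x < ρ} \ K with hA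
  have hAm : MeasurableSet A :=
    (measurableSet_lt (maxI_cont w).measurable measurable_const).diff hKcomp.isClosed.measurableSet
  have hAn : A ⊆ closedBall 0 (2 * n) := by
    intro x hx
    have h1 : ‖ρ⁻¹ • x‖ ≤ n := hJ.norm_le fun i => by
      rw [real_inner_smul_left, inv_mul_le_iff₀ hρ0, mul_one]
      exact (le_maxI w x i).trans hx.1.le
    rw [norm_smul, norm_inv, Real.norm_of_nonneg hρ0.le, inv_mul_le_iff₀ hρ0] at h1
    simp only [mem_closedBall, dist_zero_right]
    nlinarith
  have hAK : ∀ x ∈ A, 1 ≤ gauge K x := fun x hx =>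
    one_le_gauge_of_notMem (hKconv.starConvex (hB (by simp))) (absorbent_of_ball hB).absorbs hx.2
  set gQ : Eu n → ℝ := fun x => maxI w x / ρ with hgQ
  have hgQm : Measurable gQ := (maxI_cont w).measurable.div_const ρ
  have hgKm : Measurable (gauge K) :=
    (continuous_gauge hKconv (Filter.mem_of_superset (closedBall_mem_nhds 0 one_pos) hB)).measurable
  have hQK : ∀ x, gQ x ≤ gauge K x := maxI_le_gauge w hB hρ0 hKQ
  set C : ℝ≥0∞ := ENNReal.ofReal (1 / (2 * 3 ^ n)) * (ENNReal.ofReal ((1 / (4 * n)) ^ n) * volume A) with hC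
  have hpt : ∀ s ∈ Ioi (0:ℝ), gaussianM n {x | s ≤ gQ x} + (Icc (1 / (4 * n) : ℝ) (1 / (2 * n))).indicator (fun _ => C) s
      ≤ gaussianM n {x | s ≤ gauge K x} := by
    intro s hs
    have hs0 : 0 < s := hs
    by_cases hsI : s ∈ Icc (1 / (4 * n) : ℝ) (1 / (2 * n))
    · rw [indicator_of_mem hsI]
      have hsAm : MeasurableSet (s • A) := hAm.const_smul₀ s
      have hsub : s • A ⊆ closedBall 0 1 := by
        rintro _ ⟨x, hx, rfl⟩
        have := hAn hx
        simp only [mem_closedBall, dist_zero_right] at this ⊢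
        rw [norm_smul, Real.norm_of_nonneg hs0.le]
        calc s * ‖x‖ ≤ 1 / (2 * n) * (2 * n) := by
              have := hsI.2
              gcongr
          _ = 1 := by field_simp
      have hge : C ≤ gaussianM n (s • A) := by
        refine le_trans ?_ (gaussianM_ge_vol hsAm hsub)
        rw [hC, Measure.addHaar_smul]
        gcongr
        simp only [finrank_euclideanSpace, Fintype.card_fin]
        rw [abs_of_nonneg (by positivity)]
        have := hsI.1
        gcongr
      have hdisj : Disjoint {x | s ≤ gQ x} (s • A) := by
        rw [Set.disjoint_left]
        rintro _ h1 ⟨x, hx, rfl⟩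
        simp only [Set.mem_ofPred_eq, hgQ] at h1
        rw [maxI_smul w hs0.le, le_div_iff₀ hρ0] at h1
        have h2 : maxI w x < ρ := hx.1
        nlinarith
      calc _ ≤ gaussianM n {x | s ≤ gQ x} + gaussianM n (s • A) := by gcongr
        _ = gaussianM n ({x | s ≤ gQ x} ∪ s • A) := (measure_union hdisj hsAm).symm
        _ ≤ _ := by
          refine measure_mono (union_subset (fun x hx => le_trans hx (hQK x)) ?_)
          rintro _ ⟨x, hx, rfl⟩
          show s ≤ gauge K (s • x)
          rw [gauge_smul_of_nonneg hs0.le, smul_eq_mul]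
          have := hAK x hx
          nlinarith
    · rw [indicator_of_notMem hsI, add_zero]
      exact measure_mono fun x hx => le_trans hx (hQK x)
  have hIntg := setLIntegral_mono' (μ := (volume : Measure ℝ)) measurableSet_Ioi hpt
  rw [lintegral_add_right _ (measurable_const.indicator measurableSet_Icc), ← lcake_pos _ _ hgKm,
    ← lcake_pos _ _ hgQm, setLIntegral_indicator measurableSet_Icc, setLIntegral_const] at hIntg
  have e1 : Icc (1 / (4 * n) : ℝ) (1 / (2 * n)) ∩ Ioi 0 = Icc (1 / (4 * n) : ℝ) (1 / (2 * n)) :=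
    inter_eq_left.mpr fun s hs => lt_of_lt_of_le (by positivity) hs.1
  have hQint : Integrable gQ (gaussianM n) := (maxI_integrable w hw.1).div_const ρ
  have hgQ0 : ∀ x, 0 ≤ gQ x := fun x => div_nonneg (hmx x) hρ0.le
  rw [e1, Real.volume_Icc, ← ofReal_integral_eq_lintegral_ofReal hQint (Filter.Eventually.of_forall hgQ0),
    ← ofReal_integral_eq_lintegral_ofReal (gauge_integrable hKconv hB)
      (Filter.Eventually.of_forall fun x => gauge_nonneg x)] at hIntg
  have hAfin : volume A ≠ ⊤ := ne_top_of_le_ne_top measure_closedBall_lt_top.ne (measure_mono hAn)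
  have hCfin : C ≠ ⊤ := ENNReal.mul_ne_top ENNReal.ofReal_ne_top (ENNReal.mul_ne_top ENNReal.ofReal_ne_top hAfin)
  have hre := ENNReal.toReal_mono ENNReal.ofReal_ne_top hIntg
  rw [ENNReal.toReal_add ENNReal.ofReal_ne_top (ENNReal.mul_ne_top hCfin ENNReal.ofReal_ne_top),
    ENNReal.toReal_ofReal (integral_nonneg hgQ0), ENNReal.toReal_ofReal (integral_nonneg fun x => gauge_nonneg x),
    ENNReal.toReal_mul, hC, ENNReal.toReal_mul, ENNReal.toReal_mul, ENNReal.toReal_ofReal (by positivity),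
    ENNReal.toReal_ofReal (by positivity), ENNReal.toReal_ofReal (by
      rw [sub_nonneg]; apply one_div_le_one_div_of_le <;> linarith), hgQ, integral_div,
    ← measureReal_def] at hre
  have hfin : 1 / (2 * 3 ^ n) * ((1 / (4 * n)) ^ n * volume.real A) * (1 / (2 * n) - 1 / (4 * n)) ≤ E := by
    linarith
  have e2 : 8 * n * (12 * n) ^ n * (1 / (2 * 3 ^ n) * ((1 / (4 * n)) ^ n * volume.real A) * (1 / (2 * n) - 1 / (4 * n)))
      = volume.real A := by
    have : (12 * (n:ℝ)) ^ n = 3 ^ n * (4 * n) ^ n := by rw [← mul_pow]; congr 1; ring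
    rw [this, one_div_pow]
    field_simp
    ring
  rw [← e2]
  gcongr

end

section
open MeasureTheory Metric Set
open scoped RealInnerProductSpace ENNReal Pointwise


/-! ### Volume and Hausdorff distance estimates -/

theorem IsRegVerts.map {n : ℕ} {w : Fin (n + 1) → Eu n} (hw : IsRegVerts w) (T : Eu n ≃ₗᵢ[ℝ] Eu n) :
    IsRegVerts fun a => T (w a) :=
  ⟨fun a => by rw [T.norm_map, hw.1], fun a b hab => by rw [T.inner_map_map]; exact hw.2 a b hab⟩

theorem image_slab {n : ℕ} (w : Fin (n + 1) → Eu n) (T : Eu n ≃ₗᵢ[ℝ] Eu n) :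
    T '' slab w = slab fun a => T (w a) := by
  ext x
  constructor
  · rintro ⟨y, hy, rfl⟩ a
    rw [T.inner_map_map]; exact hy a
  · intro hx
    refine ⟨T.symm x, fun a => ?_, T.apply_symm_apply x⟩
    rw [← T.inner_map_map, T.apply_symm_apply]; exact hx a

theorem integral_maxI_map {n : ℕ} (w : Fin (n + 1) → Eu n) (T : Eu n ≃ₗᵢ[ℝ] Eu n) :
    ∫ x, maxI (fun a => T (w a)) x ∂(gaussianM n) = ∫ x, maxI w x ∂(gaussianM n) := by
  conv_lhs => rw [← gaussianM_map_isometry T]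
  rw [integral_map T.continuous.measurable.aemeasurable (maxI_cont _).aestronglyMeasurable]
  refine integral_congr_ae (Filter.Eventually.of_forall fun x => ?_)
  simp [maxI]

theorem slab_convex {n : ℕ} {ι : Type} (w : ι → Eu n) : Convex ℝ (slab w) := by
  intro x hx y hy a b ha hb hab i
  rw [inner_add_left, real_inner_smul_left, real_inner_smul_left]
  have h1 := hx i
  have h2 := hy i
  nlinarith

theorem slab_closed {n : ℕ} {ι : Type} (w : ι → Eu n) : IsClosed (slab w) := by
  have : slab w = ⋂ a, {x | ⟪x, w a⟫ ≤ 1} := by ext; simp [slab]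
  rw [this]
  exact isClosed_iInter fun a => isClosed_le (by fun_prop) continuous_const

/-- The excess volume. -/
theorem excess_vol {n : ℕ} (hn : 2 ≤ n) {w : Fin (n + 1) → Eu n} (hw : IsRegVerts w) {ζ : ℝ} (hζ0 : 0 ≤ ζ)
    (hζ1 : ζ ≤ 1) : volume.real ({x | maxI w x < 1 + ζ} \ slab w) ≤ n * ζ * (4 * n) ^ n := by
  have hn2 : (2:ℝ) ≤ n := by exact_mod_cast hn
  have hJ := simplex_john (by omega) hw
  have hρ0 : 0 < 1 + ζ := by linarith
  have hsub : slab w ⊆ closedBall 0 n := fun x hx => by simpa using hJ.norm_le hx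
  have hfin : volume (slab w) ≠ ⊤ := ne_top_of_le_ne_top measure_closedBall_lt_top.ne (measure_mono hsub)
  have hV : volume.real (slab w) ≤ (2 * n) ^ n :=
    (measureReal_mono hsub measure_closedBall_lt_top.ne).trans (vol_ball_le hn (by positivity))
  have hsc : volume.real ((1 + ζ) • slab w) = (1 + ζ) ^ n * volume.real (slab w) := by
    rw [measureReal_def, Measure.addHaar_smul, ENNReal.toReal_mul, ENNReal.toReal_ofReal (abs_nonneg _)]
    simp only [finrank_euclideanSpace, Fintype.card_fin]
    rw [abs_of_nonneg (by positivity), measureReal_def]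
  have hsubQ : slab w ⊆ (1 + ζ) • slab w := by
    intro x hx
    rw [mem_smul_set_iff_inv_smul_mem₀ hρ0.ne']
    intro a
    rw [real_inner_smul_left, inv_mul_le_iff₀ hρ0]
    have := hx a
    linarith
  have hQ : {x | maxI w x < 1 + ζ} \ slab w ⊆ ((1 + ζ) • slab w) \ slab w := by
    refine sdiff_subset_sdiff_left fun x hx => ?_
    rw [mem_smul_set_iff_inv_smul_mem₀ hρ0.ne']
    intro a
    rw [real_inner_smul_left, inv_mul_le_iff₀ hρ0, mul_one]
    exact (le_maxI w x a).trans (le_of_lt hx)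
  have hfin2 : volume ((1 + ζ) • slab w) ≠ ⊤ := by
    rw [Measure.addHaar_smul]; exact ENNReal.mul_ne_top ENNReal.ofReal_ne_top hfin
  have h1 : volume.real (((1 + ζ) • slab w) \ slab w) = (1 + ζ) ^ n * volume.real (slab w) - volume.real (slab w) := by
    rw [measureReal_sdiff hsubQ (slab_closed w).measurableSet hfin2, hsc]
  have h2 : (1 + ζ) ^ n - 1 ≤ n * ζ * 2 ^ n := by
    have key : ∀ m : ℕ, (1 + ζ) ^ m - 1 ≤ m * ζ * 2 ^ m := by
      intro m
      induction m with
      | zero => simp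
      | succ m ih =>
        have h3 : (1 + ζ) ^ m ≤ 2 ^ m := by gcongr; linarith
        have h4 : (1 + ζ) ^ (m + 1) - 1 = (1 + ζ) ^ m - 1 + ζ * (1 + ζ) ^ m := by ring
        have h5 : ζ * (1 + ζ) ^ m ≤ ζ * 2 ^ m := by gcongr
        have h6 : 0 ≤ (m:ℝ) * ζ * 2 ^ m := by positivity
        have h7 : 0 ≤ ζ * 2 ^ m := by positivity
        rw [h4]; push_cast; rw [pow_succ]
        nlinarith
    exact key n
  calc _ ≤ volume.real (((1 + ζ) • slab w) \ slab w) :=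
        measureReal_mono hQ (ne_top_of_le_ne_top hfin2 (measure_mono sdiff_subset))
    _ = ((1 + ζ) ^ n - 1) * volume.real (slab w) := by rw [h1]; ring
    _ ≤ (n * ζ * 2 ^ n) * (2 * n) ^ n := by
        have : 0 ≤ n * ζ * 2 ^ n := by positivity
        gcongr
    _ = n * ζ * (4 * n) ^ n := by
        have : (4 * (n:ℝ)) ^ n = 2 ^ n * (2 * n) ^ n := by rw [← mul_pow]; congr 1; ring
        rw [this]; ring

/-- The inner Hausdorff estimate. -/
theorem infDist_pow_le {n : ℕ} (hn : 2 ≤ n) {K : Set (Eu n)}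
    (hB : closedBall (0 : Eu n) 1 ⊆ K) {w : Fin (n + 1) → Eu n} (hw : IsRegVerts w) {ζ : ℝ} (hζ : 0 < ζ)
    {x : Eu n} (hx : x ∈ slab w) :
    (infDist x K / (2 * n * (n + 1))) ^ n ≤ volume.real ({x | maxI w x < 1 + ζ} \ K) := by
  have hn2 : (2:ℝ) ≤ n := by exact_mod_cast hn
  have hJ := simplex_john (by omega) hw
  have h0K : (0 : Eu n) ∈ K := hB (by simp)
  set d := infDist x K with hd
  have hd0 : 0 ≤ d := infDist_nonneg
  have hxn : ‖x‖ ≤ n := hJ.norm_le hx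
  have hdn : d ≤ n := (infDist_le_dist_of_mem h0K).trans (by simpa using hxn)
  have hfinA : volume ({x | maxI w x < 1 + ζ} \ K) ≠ ⊤ := by
    have : {x | maxI w x < 1 + ζ} \ K ⊆ closedBall 0 ((1 + ζ) * n) := by
      intro y hy
      have hρ0 : 0 < 1 + ζ := by linarith
      have h1 : ‖(1 + ζ)⁻¹ • y‖ ≤ n := hJ.norm_le fun i => by
        rw [real_inner_smul_left, inv_mul_le_iff₀ hρ0, mul_one]
        exact (le_maxI w y i).trans (le_of_lt hy.1)
      rw [norm_smul, norm_inv, Real.norm_of_nonneg hρ0.le, inv_mul_le_iff₀ hρ0] at h1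
      simpa using h1
    exact ne_top_of_le_ne_top measure_closedBall_lt_top.ne (measure_mono this)
  rcases hd0.eq_or_lt with h0 | hdpos
  · rw [← h0, zero_div, zero_pow (by omega)]; positivity
  set l := d / (2 * (n + 1)) with hl
  have hl0 : 0 < l := by positivity
  have hl1 : l ≤ 1 := by rw [hl, div_le_one (by positivity)]; linarith
  have hsub : closedBall ((1 - l) • x) l ⊆ {x | maxI w x < 1 + ζ} \ K := by
    intro y hy
    set b := l⁻¹ • (y - (1 - l) • x) with hb
    have hyb : y = (1 - l) • x + l • b := by
      rw [hb, smul_smul, mul_inv_cancel₀ hl0.ne', one_smul]; abel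
    have hbn : ‖b‖ ≤ 1 := by
      rw [hb, norm_smul, norm_inv, Real.norm_of_nonneg hl0.le, inv_mul_le_iff₀ hl0, mul_one, ← dist_eq_norm]
      exact hy
    have hbs : b ∈ slab w := ball_subset_slab w hw.1 (by simpa using hbn)
    have hys : y ∈ slab w := by
      rw [hyb]; exact slab_convex w hx hbs (by linarith) hl0.le (by ring)
    refine ⟨lt_of_le_of_lt (maxI_le w hys) (by linarith), fun hyK => ?_⟩
    have h1 : d ≤ dist x y := infDist_le_dist_of_mem hyK
    have h2 : x - y = l • (x - b) := by
      rw [hyb, sub_smul, one_smul, smul_sub]; abel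
    rw [dist_eq_norm, h2, norm_smul, Real.norm_of_nonneg hl0.le] at h1
    have h3 : ‖x - b‖ ≤ n + 1 := (norm_sub_le _ _).trans (by linarith)
    have h4 : l * ‖x - b‖ ≤ l * (n + 1) := by gcongr
    have h5 : l * (n + 1) = d / 2 := by rw [hl]; field_simp
    linarith
  refine le_trans ?_ ((vol_ball_ge hn ((1 - l) • x) hl0.le).trans (measureReal_mono hsub hfinA))
  have hpi : 1 ≤ √Real.pi := by
    rw [Real.one_le_sqrt]; have := Real.pi_gt_three; linarith
  have e : d / (2 * n * (n + 1)) = l / n := by rw [hl]; field_simp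
  rw [e, div_pow, div_eq_mul_one_div]
  have : (1:ℝ) ≤ √Real.pi ^ n := one_le_pow₀ hpi
  gcongr

end

section
open MeasureTheory Metric Set
open scoped RealInnerProductSpace ENNReal Pointwise


/-! ### The small deficit case -/

set_option maxHeartbeats 4000000 in
theorem core_estimate {n : ℕ} (hn : 2 ≤ n) {K : Set (Eu n)} (hKcomp : IsCompact K) (hKconv : Convex ℝ K)
    (hB : closedBall (0 : Eu n) 1 ⊆ K) {ι : Type} [Fintype ι] {c : ι → ℝ} {u : ι → Eu n}
    (h : IsJohn c u) (hKu : ∀ i, ∀ x ∈ K, ⟪x, u i⟫ ≤ 1) {w : Fin (n + 1) → Eu n} (hw : IsRegVerts w)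
    {q R : ℝ} (hq0 : 0 < q) (hR0 : 0 < R) (hRn : R ^ n = q) (hqR : q ≤ R) (hq : (n:ℝ) ^ (24 * n) * q ≤ 1)
    (hℓ : ∫ x, gauge K x ∂(gaussianM n) ≤ (1 + q ^ 4) * ∫ x, maxI w x ∂(gaussianM n)) :
    ∃ T : Eu n ≃ₗᵢ[ℝ] Eu n, volDist K (slab fun a => T (w a)) ≤ (n:ℝ) ^ (27 * n) * q ∧
      hausdorffDist K (slab fun a => T (w a)) ≤ (n:ℝ) ^ 27 * R := by
  have hne : Nonempty ι := h.nonempty (by omega)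
  have hn1 : 1 ≤ n := by omega
  set X : ℝ := (n : ℝ) with hX
  have hX2 : 2 ≤ X := by rw [hX]; exact_mod_cast hn
  have hX1 : 1 ≤ X := by linarith
  have hX0 : 0 < X := by linarith
  have hXp : ∀ k : ℕ, (2:ℝ) ^ k ≤ X ^ k := fun k => by gcongr
  have hXm : ∀ {k l : ℕ}, k ≤ l → X ^ k ≤ X ^ l := fun hkl => pow_le_pow_right₀ hX1 hkl
  have hX1sq : X + 1 ≤ X ^ 2 := by nlinarith
  -- small powers times `q` are at most one
  have hqs : ∀ k : ℕ, k ≤ 24 * n → X ^ k * q ≤ 1 := fun k hk =>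
    le_trans (by have := hXm hk; gcongr) hq
  have hq1 : q ≤ 1 := by simpa using hqs 0 (by omega)
  set L := ∫ x, maxI w x ∂(gaussianM n) with hL
  have hJ := simplex_john hn1 hw
  have hL0 : 0 ≤ L := integral_nonneg fun x => hJ.maxI_nonneg hn1 x
  have hLn : L ≤ X := by
    refine le_trans ?_ (gaussianM_norm_le n)
    exact integral_mono (maxI_integrable w hw.1) (gaussianM_integrable_norm n)
      fun x => (le_abs_self _).trans (maxI_abs_le w hw.1 x)
  have hq4 : 0 < q ^ 4 := by positivity
  -- the defect
  have hu : ∫ x, maxI u x ∂(gaussianM n) ≤ L + X * q ^ 4 := by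
    have h1 : ∫ x, maxI u x ∂(gaussianM n) ≤ ∫ x, gauge K x ∂(gaussianM n) :=
      integral_mono (maxI_integrable u h.unit) (gauge_integrable hKconv hB) fun x => by
        simpa using maxI_le_gauge u hB one_pos (fun x hx i => hKu i x hx) x
    nlinarith
  have hS := defect_of_integral hn h hw (ε := X * q ^ 4) (by positivity) hu
  set δ : ℝ := (X ^ (4 * n + 23) * q ^ 2) ^ 2 with hδ
  have hδ0 : 0 < δ := by positivity
  have hS2 : defectS (liftC n c) (liftV u) ≤ δ := by
    refine hS.trans ?_
    have h1 : 16 * (X + 1) ^ 2 ≤ X ^ 8 := by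
      have := hXp 4
      calc 16 * (X + 1) ^ 2 = 2 ^ 4 * (X + 1) ^ 2 := by norm_num
        _ ≤ X ^ 4 * (X ^ 2) ^ 2 := by gcongr
        _ = X ^ 8 := by ring
    calc 2 ^ 33 * (X + 1) * (16 * (X + 1) ^ 2) ^ (n + 1) * (2 * (X * q ^ 4))
        = 2 ^ 34 * (X + 1) * (16 * (X + 1) ^ 2) ^ (n + 1) * (X * q ^ 4) := by ring
      _ ≤ X ^ 34 * X ^ 2 * (X ^ 8) ^ (n + 1) * (X * q ^ 4) := by
          have := hXp 34
          gcongr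
      _ = X ^ (8 * n + 45) * q ^ 4 := by ring
      _ ≤ X ^ (8 * n + 46) * q ^ 4 := by
          have := hXm (show 8 * n + 45 ≤ 8 * n + 46 by omega)
          gcongr
      _ = δ := by rw [hδ]; ring
  obtain ⟨f, hf⟩ := h.select hn1 hδ0 hS2
  have hsδ : √δ = X ^ (4 * n + 23) * q ^ 2 := by rw [hδ]; exact Real.sqrt_sq (by positivity)
  rw [hsδ] at hf
  set ζ : ℝ := X ^ (4 * n + 36) * q ^ 2 with hζ
  have hζ0 : 0 < ζ := by positivity
  have hζq : ζ * X ≤ q := by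
    calc ζ * X = X ^ (4 * n + 37) * q * q := by rw [hζ]; ring
      _ ≤ 1 * q := by
        have := hqs (4 * n + 37) (by omega)
        gcongr
      _ = q := one_mul q
  have hζ1 : ζ ≤ 1 := by nlinarith
  set η : ℝ := X ^ (4 * n + 34) * q ^ 2 with hη
  have hη0 : 0 < η := by positivity
  have hηζ : X * η < ζ := by
    have : ζ = X * (X * η) := by rw [hζ, hη]; ring
    have : 0 < X * η := by positivity
    nlinarith
  have hτη : 2 * (X + 1) ^ 2 * (16 * (X + 1) * (X ^ (4 * n + 23) * q ^ 2)) ≤ η := by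
    calc 2 * (X + 1) ^ 2 * (16 * (X + 1) * (X ^ (4 * n + 23) * q ^ 2))
        = 2 ^ 5 * (X + 1) ^ 3 * (X ^ (4 * n + 23) * q ^ 2) := by ring
      _ ≤ X ^ 5 * (X ^ 2) ^ 3 * (X ^ (4 * n + 23) * q ^ 2) := by
          have := hXp 5
          gcongr
      _ = η := by rw [hη]; ring
  have hη1 : η ≤ 1 := by nlinarith
  obtain ⟨T, hT⟩ := exists_rotation hn1 hw (p := fun a => u (f a)) (fun a => h.unit _) hf (by positivity)
    (by linarith)
  have hT2 : ∀ a, ‖T (w a) - u (f a)‖ ≤ η := fun a => (hT a).trans hτη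
  refine ⟨T, ?_⟩
  set w' : Fin (n + 1) → Eu n := fun a => T (w a) with hw'
  have hw'r : IsRegVerts w' := hw.map T
  have hJ' := simplex_john hn1 hw'r
  have hKn : ∀ x ∈ K, ‖x‖ ≤ X := fun x hx => h.norm_le fun i => hKu i x hx
  have hKQ : ∀ x ∈ K, ∀ a, ⟪x, w' a⟫ ≤ 1 + X * η := by
    intro x hx a
    have e : ⟪x, w' a⟫ = ⟪x, u (f a)⟫ + ⟪x, T (w a) - u (f a)⟫ := by rw [inner_sub_right, hw']; ring
    have h1 : ⟪x, T (w a) - u (f a)⟫ ≤ X * η := by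
      refine (real_inner_le_norm _ _).trans ?_
      have := hKn x hx
      have := hT2 a
      gcongr
    have := hKu (f a) x hx
    linarith
  have hL' : ∫ x, maxI w' x ∂(gaussianM n) = L := integral_maxI_map w T
  have hqζ : q ^ 4 ≤ ζ := by
    have h1 : (1:ℝ) ≤ X ^ (4 * n + 36) := one_le_pow₀ hX1
    have h2 : q ^ 2 ≤ 1 := by nlinarith
    calc q ^ 4 = q ^ 2 * q ^ 2 := by ring
      _ ≤ X ^ (4 * n + 36) * q ^ 2 := by
        have := h2.trans h1
        gcongr
  have hA := shell hn hKcomp hKconv hB hw'r (ρ := 1 + ζ) (by linarith) (by linarith)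
    (fun x hx a => (hKQ x hx a).trans (by linarith)) (E := 2 * X * ζ) (by
      rw [hL']
      have h1 : L ≤ L / (1 + ζ) + L * ζ := by
        rw [div_add' _ _ _ (by positivity), le_div_iff₀ (by positivity)]
        nlinarith [mul_nonneg hL0 (mul_nonneg hζ0.le hζ0.le)]
      have h2 : L * ζ ≤ X * ζ := by gcongr
      have h3 : q ^ 4 * L ≤ ζ * X := by gcongr
      linarith)
  set A := {x | maxI w' x < 1 + ζ} \ K with hAdef
  have hAV : volume.real A ≤ X ^ (9 * n + 42) * q ^ 2 := by
    refine hA.trans ?_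
    have h1 : 12 * X ≤ X ^ 5 := by
      have := hXp 4
      calc 12 * X ≤ 2 ^ 4 * X := by norm_num; linarith
        _ ≤ X ^ 4 * X := by gcongr
        _ = X ^ 5 := by ring
    calc 8 * X * (12 * X) ^ n * (2 * X * ζ) = 2 ^ 4 * X ^ 2 * (12 * X) ^ n * ζ := by ring
      _ ≤ X ^ 4 * X ^ 2 * (X ^ 5) ^ n * ζ := by
          have := hXp 4
          gcongr
      _ = X ^ (9 * n + 42) * q ^ 2 := by rw [hζ]; ring
  have hex := excess_vol hn hw'r hζ0.le hζ1
  have hexV : volume.real ({x | maxI w' x < 1 + ζ} \ slab w') ≤ X ^ (9 * n + 42) * q ^ 2 := by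
    refine hex.trans ?_
    have h1 : 4 * X ≤ X ^ 3 := by nlinarith [hXp 2]
    calc X * ζ * (4 * X) ^ n ≤ X * ζ * (X ^ 3) ^ n := by gcongr
      _ = X ^ (7 * n + 37) * q ^ 2 := by rw [hζ]; ring
      _ ≤ _ := by
        have := hXm (show 7 * n + 37 ≤ 9 * n + 42 by omega)
        gcongr
  have hQfin : volume {x | maxI w' x < 1 + ζ} ≠ ⊤ := by
    have : {x | maxI w' x < 1 + ζ} ⊆ closedBall 0 ((1 + ζ) * n) := by
      intro y hy
      have hρ0 : 0 < 1 + ζ := by linarith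
      have h1 : ‖(1 + ζ)⁻¹ • y‖ ≤ n := hJ'.norm_le fun i => by
        rw [real_inner_smul_left, inv_mul_le_iff₀ hρ0, mul_one]
        exact (le_maxI w' y i).trans (le_of_lt hy)
      rw [norm_smul, norm_inv, Real.norm_of_nonneg hρ0.le, inv_mul_le_iff₀ hρ0] at h1
      simpa using h1
    exact ne_top_of_le_ne_top measure_closedBall_lt_top.ne (measure_mono this)
  have hKsub : K ⊆ {x | maxI w' x < 1 + ζ} := fun x hx =>
    lt_of_le_of_lt (maxI_le w' (hKQ x hx)) (by linarith)
  have hSsub : slab w' ⊆ {x | maxI w' x < 1 + ζ} := fun x hx =>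
    lt_of_le_of_lt (maxI_le w' hx) (by linarith)
  constructor
  · have h1 : volume.real (K \ slab w') ≤ X ^ (9 * n + 42) * q ^ 2 :=
      (measureReal_mono (sdiff_subset_sdiff_left hKsub)
        (ne_top_of_le_ne_top hQfin (measure_mono sdiff_subset))).trans hexV
    have h2 : volume.real (slab w' \ K) ≤ X ^ (9 * n + 42) * q ^ 2 :=
      (measureReal_mono (sdiff_subset_sdiff_left hSsub)
        (ne_top_of_le_ne_top hQfin (measure_mono sdiff_subset))).trans hAV
    calc volDist K (slab w') ≤ X ^ (9 * n + 42) * q ^ 2 + X ^ (9 * n + 42) * q ^ 2 := add_le_add h1 h2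
      _ = 2 * (X ^ (9 * n + 42) * q ^ 2) := by ring
      _ ≤ X * (X ^ (9 * n + 42) * q ^ 2) := by gcongr
      _ = X ^ (9 * n + 43) * q ^ 2 := by ring
      _ ≤ X ^ (51 * n) * q ^ 2 := by
          have := hXm (show 9 * n + 43 ≤ 51 * n by omega)
          gcongr
      _ = X ^ (27 * n) * q * (X ^ (24 * n) * q) := by ring
      _ ≤ X ^ (27 * n) * q * 1 := by gcongr
      _ = _ := mul_one _
  · refine hausdorffDist_le_of_infDist (by positivity) ?_ ?_
    · intro x hx
      have hρ0 : 0 < 1 + ζ := by linarith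
      have hmem : (1 + ζ)⁻¹ • x ∈ slab w' := by
        intro a
        rw [real_inner_smul_left, inv_mul_le_iff₀ hρ0, mul_one]
        exact (hKQ x hx a).trans (by linarith)
      refine (infDist_le_dist_of_mem hmem).trans ?_
      have e : x - (1 + ζ)⁻¹ • x = (ζ / (1 + ζ)) • x := by
        have : ζ / (1 + ζ) = 1 - (1 + ζ)⁻¹ := by field_simp; ring
        rw [this, sub_smul, one_smul]
      rw [dist_eq_norm, e, norm_smul, Real.norm_of_nonneg (by positivity)]
      have h1 : ζ / (1 + ζ) ≤ ζ := div_le_self hζ0.le (by linarith)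
      have h2 : (1:ℝ) ≤ X ^ 27 := one_le_pow₀ hX1
      calc ζ / (1 + ζ) * ‖x‖ ≤ ζ * X := by
            have := hKn x hx
            gcongr
        _ ≤ R := hζq.trans hqR
        _ ≤ X ^ 27 * R := by nlinarith
    · intro x hx
      have h1 := infDist_pow_le hn hB hw'r hζ0 hx
      have h2 : (infDist x K / (2 * X * (X + 1))) ^ n ≤ (X ^ 23 * R) ^ n := by
        refine (h1.trans hAV).trans ?_
        rw [mul_pow, hRn]
        calc X ^ (9 * n + 42) * q ^ 2 ≤ X ^ (47 * n) * q ^ 2 := by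
              have := hXm (show 9 * n + 42 ≤ 47 * n by omega)
              gcongr
          _ = X ^ (23 * n) * q * (X ^ (24 * n) * q) := by ring
          _ ≤ X ^ (23 * n) * q * 1 := by gcongr
          _ = (X ^ 23) ^ n * q := by rw [mul_one, ← pow_mul]
      have h3 := le_of_pow_le_pow_left₀ (by omega) (by positivity) h2
      rw [div_le_iff₀ (by positivity)] at h3
      refine h3.trans ?_
      calc X ^ 23 * R * (2 * X * (X + 1)) ≤ X ^ 23 * R * (X * X * X ^ 2) := by gcongr
        _ = X ^ 27 * R := by ring

end

section
open MeasureTheory Metric Set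
open scoped RealInnerProductSpace ENNReal Pointwise


/-! ### Assembling the cases -/

theorem large_case {n : ℕ} (hn : 2 ≤ n) {K : Set (Eu n)}
    (hB : closedBall (0 : Eu n) 1 ⊆ K) {ι : Type} [Fintype ι] {c : ι → ℝ} {u : ι → Eu n}
    (h : IsJohn c u) (hKu : ∀ i, ∀ x ∈ K, ⟪x, u i⟫ ≤ 1) {w : Fin (n + 1) → Eu n} (hw : IsRegVerts w)
    {q R : ℝ} (hR0 : 0 < R) (hRn : R ^ n = q) (hq : 1 ≤ (n:ℝ) ^ (24 * n) * q) :
    volDist K (slab w) ≤ (n:ℝ) ^ (27 * n) * q ∧ hausdorffDist K (slab w) ≤ (n:ℝ) ^ 27 * R := by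
  have hX2 : (2:ℝ) ≤ n := by exact_mod_cast hn
  generalize hX : (n : ℝ) = X at *
  have hX1 : 1 ≤ X := by linarith
  have hX0 : 0 < X := by linarith
  have hKn : ∀ x ∈ K, ‖x‖ ≤ X := fun x hx => hX ▸ h.norm_le fun i => hKu i x hx
  have hSn : ∀ x ∈ slab w, ‖x‖ ≤ X := fun x hx => hX ▸ (simplex_john (by omega) hw).norm_le hx
  have hV := vol_ball_le hn hX0.le
  constructor
  · have key : ∀ A B : Set (Eu n), (∀ x ∈ A, ‖x‖ ≤ X) → volume.real (A \ B) ≤ (2 * X) ^ n := by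
      intro A B hA
      refine (measureReal_mono (fun x hx => ?_) measure_closedBall_lt_top.ne).trans hV
      simpa using hA x hx.1
    have h1 := key K (slab w) hKn
    have h2 := key (slab w) K hSn
    have hm : X ^ (2 * n + 1) ≤ X ^ (3 * n) := pow_le_pow_right₀ hX1 (by omega)
    calc volDist K (slab w) ≤ (2 * X) ^ n + (2 * X) ^ n := add_le_add h1 h2
      _ = 2 * (2 * X) ^ n := by ring
      _ ≤ X * (X * X) ^ n := by gcongr
      _ = X ^ (2 * n + 1) := by ring
      _ ≤ X ^ (3 * n) := hm
      _ ≤ X ^ (3 * n) * (X ^ (24 * n) * q) := le_mul_of_one_le_right (by positivity) hq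
      _ = X ^ (27 * n) * q := by ring
  · have hR1 : 1 ≤ X ^ 24 * R := by
      have : (1:ℝ) ^ n ≤ (X ^ 24 * R) ^ n := by rw [one_pow, mul_pow, hRn, ← pow_mul]; exact hq
      exact le_of_pow_le_pow_left₀ (by omega) (by positivity) this
    have hXR : X ≤ X ^ 27 * R := by
      have h3 : X ^ 1 ≤ X ^ 3 := pow_le_pow_right₀ hX1 (by omega)
      calc X = X ^ 1 := (pow_one X).symm
        _ ≤ X ^ 3 := h3
        _ ≤ X ^ 3 * (X ^ 24 * R) := le_mul_of_one_le_right (by positivity) hR1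
        _ = X ^ 27 * R := by ring
    have h0K : (0 : Eu n) ∈ K := hB (by simp)
    have h0S : (0 : Eu n) ∈ slab w := ball_subset_slab w hw.1 (by simp)
    refine hausdorffDist_le_of_infDist (by positivity) ?_ ?_
    · intro x hx
      refine (infDist_le_dist_of_mem h0S).trans ?_
      rw [dist_zero_right]
      exact (hKn x hx).trans hXR
    · intro x hx
      refine (infDist_le_dist_of_mem h0K).trans ?_
      rw [dist_zero_right]
      exact (hSn x hx).trans hXR

theorem main_slab
    (n : ℕ) (hn : 1 ≤ n) (K : Set (Eu n))
    (hKcomp : IsCompact K) (hKconv : Convex ℝ K)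
    (hJohn : IsJohnEllipsoid (closedBall (0 : Eu n) 1) K)
    (w : Fin (n + 1) → Eu n) (hw : IsRegVerts w)
    (ε : ℝ) (hε0 : 0 < ε)
    (hℓ : ellNorm n K ≤ (1 + ε) * ellNorm n (slab w)) :
    ∃ T : Eu n ≃ₗᵢ[ℝ] Eu n,
      volDist K (slab fun a => T (w a)) ≤ (n : ℝ) ^ (27 * n) * ε ^ ((1 : ℝ) / 4) ∧
      hausdorffDist K (slab fun a => T (w a)) ≤ (n : ℝ) ^ 27 * ε ^ (1 / (4 * (n : ℝ))) := by
  obtain ⟨ι, _, c, u, hc, hu, hKu, hb, hfr⟩ := john_decomp hn K hKcomp hKconv hJohn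
  have h : IsJohn c u := ⟨⟨hc, hu, hfr⟩, hb⟩
  have hB : closedBall (0 : Eu n) 1 ⊆ K := hJohn.2.1
  have hn0 : (n : ℝ) ≠ 0 := by positivity
  have hq0 : 0 < ε ^ ((1 : ℝ) / 4) := by positivity
  have hR0 : 0 < ε ^ (1 / (4 * (n : ℝ))) := by positivity
  have hRn : (ε ^ (1 / (4 * (n : ℝ)))) ^ n = ε ^ ((1 : ℝ) / 4) := by
    rw [← Real.rpow_natCast, ← Real.rpow_mul hε0.le]
    congr 1
    field_simp
  have hq4 : (ε ^ ((1 : ℝ) / 4)) ^ 4 = ε := by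
    rw [← Real.rpow_natCast, ← Real.rpow_mul hε0.le]
    norm_num
  generalize ε ^ ((1 : ℝ) / 4) = q at *
  generalize ε ^ (1 / (4 * (n : ℝ))) = R at *
  rcases Nat.lt_or_ge 1 n with hn2 | hn2
  · rcases le_or_gt ((n:ℝ) ^ (24 * n) * q) 1 with hq | hq
    · have hX1 : (1:ℝ) ≤ n := by exact_mod_cast hn
      have hq1 : q ≤ 1 := (le_mul_of_one_le_left hq0.le (one_le_pow₀ hX1)).trans hq
      have hR1 : R ≤ 1 := by
        by_contra hcon
        have := one_lt_pow₀ (not_le.1 hcon) (show n ≠ 0 by omega)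
        linarith
      have hqR : q ≤ R := hRn ▸ pow_le_of_le_one hR0.le hR1 (by omega)
      have e : ∀ x, gauge (slab w) x = maxI w x := fun x =>
        gauge_slab w hw.1 ((simplex_john hn hw).maxI_nonneg hn) x
      refine core_estimate hn2 hKcomp hKconv hB h hKu hw hq0 hR0 hRn hqR hq ?_
      rw [hq4]
      simpa only [ellNorm, e] using hℓ
    · exact ⟨LinearIsometryEquiv.refl ℝ _, large_case hn2 hB h hKu hw hR0 hRn hq.le⟩
  · obtain rfl : n = 1 := by omega
    refine ⟨LinearIsometryEquiv.refl ℝ _, ?_⟩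
    have hK : K = closedBall 0 1 := by
      refine Subset.antisymm (fun x hx => ?_) hB
      simpa using h.norm_le fun i => hKu i x hx
    have hS : slab w = closedBall 0 1 := by
      refine Subset.antisymm (fun x hx => ?_) (ball_subset_slab w hw.1)
      simpa using (simplex_john hn hw).norm_le hx
    have hS2 : (slab fun a => (LinearIsometryEquiv.refl ℝ (Eu 1)) (w a)) = closedBall 0 1 := hS
    rw [hS2, hK, hausdorffDist_self_zero]
    refine ⟨?_, by positivity⟩
    simp [volDist, hq0.le]

end

theorem john_ell_stability
    (n : ℕ) (hn : 1 ≤ n) (K : Set (EuclideanSpace ℝ (Fin n)))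
    (hKcomp : IsCompact K) (hKconv : Convex ℝ K) (hKint : (interior K).Nonempty)
    (hJohn : IsJohnEllipsoid (closedBall (0 : EuclideanSpace ℝ (Fin n)) 1) K)
    (w : Fin (n + 1) → EuclideanSpace ℝ (Fin n)) (hw : IsRegVerts w)
    (ε : ℝ) (hε0 : 0 < ε)
    (hℓ : ellNorm n K ≤ (1 + ε) * ellNorm n (polarSet (convexHull ℝ (Set.range w)))) :
    ∃ T : EuclideanSpace ℝ (Fin n) ≃ₗᵢ[ℝ] EuclideanSpace ℝ (Fin n),
      volDist K (T '' polarSet (convexHull ℝ (Set.range w))) ≤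
        (n : ℝ) ^ (27 * n) * ε ^ ((1 : ℝ) / 4) ∧
      hausdorffDist K (T '' polarSet (convexHull ℝ (Set.range w))) ≤
        (n : ℝ) ^ 27 * ε ^ (1 / (4 * (n : ℝ))) := by
  rw [polar_eq_slab] at hℓ ⊢
  obtain ⟨T, h1, h2⟩ := main_slab n hn K hKcomp hKconv hJohn w hw ε hε0 hℓ
  refine ⟨T, ?_⟩
  rw [image_slab]
  exact ⟨h1, h2⟩

end
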